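/- arXiv:2107.01416 — 5 statements merged into one kernel-verified Lean document; each statement's English description precedes it below -/
import Mathlib

section
/- Let n, c, k, s be integers with n-1 ≥ c ≥ 2k ≥ 4 and s ≥ 2. If G is a 2-connected graph of order n with circumference c(G) = c and minimum degree exactly k, then N_s(G) ≤ max{f_s(n,c,k), g_s(n,c,k)}. -/
open SimpleGraph

/-- The degree of a vertex, as `Nat.card` of its neighbor set. -/
noncomputable def degN {V : Type*} (G : SimpleGraph V) (v : V) : ℕ :=
  Nat.card (G.neighborSet v)

/-- `G` has minimum degree exactly `k`. -/
def MinDegreeEq {V : Type*} (G : SimpleGraph V) (k : ℕ) : Prop :=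
  (∀ v, k ≤ degN G v) ∧ ∃ v, degN G v = k

/-- `G` is 2-connected: at least 3 vertices and deleting any vertex leaves a connected graph. -/
def TwoConnected {V : Type*} (G : SimpleGraph V) : Prop :=
  3 ≤ Nat.card V ∧ ∀ v : V, (G.induce {u | u ≠ v}).Connected

/-- The circumference of `G`: the length of a longest cycle (0 if there are none). -/
noncomputable def circ {V : Type*} (G : SimpleGraph V) : ℕ :=
  sSup {n | ∃ (v : V) (w : G.Walk v v), w.IsCycle ∧ w.length = n}

/-- The detour order of `G`: the number of vertices of a longest path. -/
noncomputable def detour {V : Type*} (G : SimpleGraph V) : ℕ :=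
  sSup {n | ∃ (u v : V) (p : G.Walk u v), p.IsPath ∧ p.length + 1 = n}

/-- The number of cliques of cardinality `s` in `G`. -/
noncomputable def cliquesN {V : Type*} (G : SimpleGraph V) (s : ℕ) : ℕ :=
  Nat.card {S : Finset V // G.IsNClique s S}

/-- The number of edges of `G`. -/
noncomputable def edgeCount {V : Type*} (G : SimpleGraph V) : ℕ :=
  Nat.card G.edgeSet

/-- `G` contains a Hamilton cycle. -/
def IsHamiltonianGr {V : Type*} (G : SimpleGraph V) : Prop :=
  ∃ (v : V) (w : G.Walk v v), w.IsCycle ∧ ∀ u : V, u ∈ w.support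

/-- `G` contains a Hamilton path. -/
def IsTraceableGr {V : Type*} (G : SimpleGraph V) : Prop :=
  ∃ (u v : V) (p : G.Walk u v), p.IsPath ∧ ∀ w : V, w ∈ p.support

/-- `f_s(n,c,k) = C(c+1-k, s) + (n-c-1+k)·C(k, s-1)`. -/
def fCliques (n c k s : ℕ) : ℕ :=
  Nat.choose (c + 1 - k) s + (n + k - c - 1) * Nat.choose k (s - 1)

/-- `g_s(n,c,k) = C(c+1-t, s) + (n-c-2+t)·C(t, s-1) + C(k, s-1)` with `t = ⌊c/2⌋`. -/
def gCliques (n c k s : ℕ) : ℕ :=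
  Nat.choose (c + 1 - c / 2) s + (n + c / 2 - c - 2) * Nat.choose (c / 2) (s - 1)
    + Nat.choose k (s - 1)

/-- `g_s(n,c,k,q) = q·C(k, s-1) + (n-q-c-1+t)·C(t, s-1) + C(c+1-t, s)` with `t = ⌊c/2⌋`. -/
def gCliquesQ (n c k q s : ℕ) : ℕ :=
  q * Nat.choose k (s - 1) + (n + c / 2 - q - c - 1) * Nat.choose (c / 2) (s - 1)
    + Nat.choose (c + 1 - c / 2) s

/-- `F(n,c,k) = K_k ∨ (K_{c+1-2k} + \overline{K_{n-c-1+k}})`, realized on `Fin n`: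
vertices `0,…,k-1` are the dominating clique `K_k`, vertices `k,…,c-k` extend it to
`K_{c+1-k}`, and vertices `c-k+1,…,n-1` form the independent part. -/
def Fgraph (n c k : ℕ) : SimpleGraph (Fin n) where
  Adj x y := x ≠ y ∧ (x.val < k ∨ y.val < k ∨ (x.val ≤ c - k ∧ y.val ≤ c - k))
  symm := ⟨by intro x y h; exact ⟨h.1.symm, by tauto⟩⟩
  loopless := ⟨by intro x h; exact h.1 rfl⟩

/-- `G(n,c,k)`: from `K_t ∨ (K_{c+1-2t} + \overline{K_{n-c-1+t}})` (with `t = ⌊c/2⌋`)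
delete `t-k` edges incident to one common vertex (the vertex `n-1`) of the independent
part, keeping only its `k` neighbors `0,…,k-1`. -/
def Ggraph (n c k : ℕ) : SimpleGraph (Fin n) :=
  (Fgraph n c (c / 2)).deleteEdges
    {e | ∃ x y : Fin n, e = s(x, y) ∧ x.val = n - 1 ∧ k ≤ y.val ∧ y.val < c / 2}

section
namespace Kop

/-- `l` is the interior of a walk from `a` to `b`. -/
def Lk {V : Type*} (G : SimpleGraph V) (a : V) (l : List V) (b : V) : Prop :=
  List.IsChain G.Adj (a :: (l ++ [b]))

theorem lk_nil {V : Type*} {G : SimpleGraph V} {a b : V} : Lk G a [] b ↔ G.Adj a b := by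
  simp [Lk]

theorem lk_split {V : Type*} {G : SimpleGraph V} {a b z : V} {X Y : List V} :
    Lk G a (X ++ z :: Y) b ↔ Lk G a X z ∧ Lk G z Y b := by
  unfold Lk
  have := @List.isChain_split _ G.Adj z (a :: X) (Y ++ [b])
  simpa using this

theorem lk_cons {V : Type*} {G : SimpleGraph V} {a b z : V} {Y : List V} :
    Lk G a (z :: Y) b ↔ G.Adj a z ∧ Lk G z Y b := by
  have := @lk_split _ G a b z [] Y
  simpa [lk_nil] using this

theorem lk_snoc {V : Type*} {G : SimpleGraph V} {a b z : V} {X : List V} :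
    Lk G a (X ++ [z]) b ↔ Lk G a X z ∧ G.Adj z b := by
  have := @lk_split _ G a b z X []
  simpa [lk_nil] using this

theorem lk_rev {V : Type*} {G : SimpleGraph V} {a b : V} {X : List V} (h : Lk G a X b) :
    Lk G b X.reverse a := by
  unfold Lk at *
  have h2 : (a :: (X ++ [b])).reverse.IsChain G.Adj := by
    rw [List.isChain_reverse]
    exact h.imp (fun _ _ h => h.symm)
  simpa using h2

theorem lk_mono {V : Type*} {G H : SimpleGraph V} (hle : G ≤ H) {a b : V} {X : List V}
    (h : Lk G a X b) : Lk H a X b :=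
  List.IsChain.imp (fun _ _ h => hle h) h

/-- no cycle with more than `c` vertices -/
def NoLong {V : Type*} (G : SimpleGraph V) (c : ℕ) : Prop :=
  ∀ a l b, Lk G a l b → (a :: (l ++ [b])).Nodup → G.Adj b a → l.length + 2 ≤ c

theorem two_links {V : Type*} {G : SimpleGraph V} {c : ℕ} (hN : NoLong G c) {u w : V}
    {X Y : List V} (h1 : Lk G u X w) (h2 : Lk G w Y u) (hn : (u :: (X ++ w :: Y)).Nodup) :
    X.length + Y.length + 2 ≤ c := by
  rcases List.eq_nil_or_concat' Y with rfl | ⟨Y', y, rfl⟩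
  · have := hN u X w h1 (by simpa using hn) (lk_nil.1 h2)
    simpa using this
  · rw [lk_snoc] at h2
    have := hN u (X ++ w :: Y') y (lk_split.2 ⟨h1, h2.1⟩) (by simpa using hn) h2.2
    simp at this ⊢
    omega

/-- weak form of 2-connectivity -/
def Conn2 {V : Type*} (G : SimpleGraph V) : Prop :=
  ∀ v a b, a ≠ v → b ≠ v → a ≠ b → ∃ L, v ∉ L ∧ Lk G a L b

theorem Conn2.mono {V : Type*} {G H : SimpleGraph V} (hle : G ≤ H) (h : Conn2 G) : Conn2 H := by
  intro v a b h1 h2 h3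
  obtain ⟨L, hL, hl⟩ := h v a b h1 h2 h3
  exact ⟨L, hL, lk_mono hle hl⟩

/-- Extract from a walk starting in `S` a path with only the starting vertex in `S`. -/
theorem extract {V : Type*} {G : SimpleGraph V} (S : Set V) (L : List V) : ∀ (a w : V),
    a ∈ S → w ∉ S → Lk G a L w → ∃ u ∈ S, ∃ I : List V, Lk G u I w ∧ I.Nodup ∧ w ∉ I ∧
      (∀ x ∈ I, x ∉ S) ∧ (∀ x ∈ I, x ∈ L) ∧ (u = a ∨ u ∈ L) := by
  classical
  induction L using List.reverseRecOn with
  | nil => 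
    intro a w ha hw h
    exact ⟨a, ha, [], h, by simp⟩
  | append_singleton L z ih =>
    intro a w ha hw h
    rw [lk_snoc] at h
    by_cases hz : z ∈ S
    · exact ⟨z, hz, [], lk_nil.2 h.2, by simp⟩
    · obtain ⟨u, hu, I, h1, h2, h3, h4, h5, h6⟩ := ih a z ha hz h.1
      by_cases hw' : w ∈ I
      · obtain ⟨X, Y, rfl⟩ := List.append_of_mem hw'
        rw [lk_split] at h1
        exact ⟨u, hu, X, h1.1, by grind, by grind, by grind, by grind, by grind⟩
      · exact ⟨u, hu, I ++ [z], lk_snoc.2 ⟨h1, h.2⟩, by grind, by grind [h.2.ne], by grind, by grind, by grind⟩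

/-- connect a set to a vertex avoiding a vertex -/
theorem conn_set {V : Type*} {G : SimpleGraph V} (hC : Conn2 G) (S : Set V) (v w : V)
    (hv : v ∉ S) (hw : w ∉ S) (hvw : w ≠ v) (hS : S.Nonempty) :
    ∃ u ∈ S, ∃ I : List V, Lk G u I w ∧ I.Nodup ∧ w ∉ I ∧ v ∉ I ∧ (∀ x ∈ I, x ∉ S) := by
  obtain ⟨a, ha⟩ := hS
  obtain ⟨L, hL, hl⟩ := hC v a w (by rintro rfl; exact hv ha) hvw (by rintro rfl; exact hw ha)
  obtain ⟨u, hu, I, h1, h2, h3, h4, h5, h6⟩ := extract S L a w ha hw hl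
  exact ⟨u, hu, I, h1, h2, h3, fun h => hL (h5 _ h), h4⟩

theorem nodup_left {V : Type*} {X Y : List V} {z : V} (h : (X ++ z :: Y).Nodup) :
    X.Nodup ∧ z ∉ X := by
  rw [List.nodup_append'] at h
  exact ⟨h.1, fun hz => h.2.2 hz (by simp)⟩

theorem nodup_glue {V : Type*} {X J : List V} {z : V} (h : X.Nodup) (hz : z ∉ X)
    (hJ : J.Nodup) (hzJ : z ∉ J) (hd : ∀ x ∈ J, x ∉ X) : (X ++ z :: J).Nodup := by
  rw [List.nodup_append', List.nodup_cons]
  refine ⟨h, ⟨hzJ, hJ⟩, ?_⟩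
  intro x hx hx'
  rcases List.mem_cons.1 hx' with rfl | h'
  · exact hz hx
  · exact hd x h' hx

theorem nodup_snoc {V : Type*} {X : List V} {z : V} (h : X.Nodup) (hz : z ∉ X) :
    (X ++ [z]).Nodup := nodup_glue h hz List.nodup_nil (by simp) (by simp)

/-- disjoint legs -/
def Legs {V : Type*} (A : Set V) (I1 I2 : List V) : Prop :=
  I1.Nodup ∧ I2.Nodup ∧ (∀ x ∈ I1, x ∉ I2 ∧ x ∉ A) ∧ ∀ x ∈ I2, x ∉ A

theorem Legs.symm {V : Type*} {A : Set V} {I1 I2 : List V} (h : Legs A I1 I2) :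
    Legs A I2 I1 := by
  obtain ⟨h1, h2, h3, h4⟩ := h
  exact ⟨h2, h1, fun x hx => ⟨fun hx' => (h3 x hx').1 hx, h4 x hx⟩, fun x hx => (h3 x hx).2⟩

theorem Legs.left {V : Type*} {A : Set V} {I2 X Y : List V} {z : V}
    (h : Legs A (X ++ z :: Y) I2) : Legs A X I2 ∧ z ∉ X ∧ z ∉ I2 ∧ z ∉ A := by
  obtain ⟨h1, h2, h3, h4⟩ := h
  obtain ⟨n1, n2⟩ := nodup_left h1
  exact ⟨⟨n1, h2, fun x hx => h3 x (by simp [hx]), h4⟩, n2, h3 z (by simp)⟩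

theorem Legs.snoc {V : Type*} {A : Set V} {I1 I2 : List V} {w : V}
    (h : Legs A I1 I2) (h1 : w ∉ I1) (h2 : w ∉ I2) (h3 : w ∉ A) : Legs A I1 (I2 ++ [w]) := by
  obtain ⟨n1, n2, n3, n4⟩ := h
  refine ⟨n1, nodup_snoc n2 h2, ?_, ?_⟩ <;> simp only [List.mem_append, List.mem_singleton] <;> grind

theorem Legs.repl {V : Type*} {A : Set V} {I1 I2 J : List V}
    (h : Legs A I1 I2) (hJ : J.Nodup) (h1 : ∀ x ∈ J, x ∉ I2) (h3 : ∀ x ∈ J, x ∉ A) :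
    Legs A J I2 := by
  obtain ⟨n1, n2, n3, n4⟩ := h
  exact ⟨hJ, n2, fun x hx => ⟨h1 x hx, h3 x hx⟩, n4⟩

theorem Legs.glue {V : Type*} {A : Set V} {I2 X Y J : List V} {z : V}
    (h : Legs A (X ++ z :: Y) I2) (hJ : J.Nodup) (h1 : ∀ x ∈ J, x ∉ (X ++ z :: Y))
    (h2 : ∀ x ∈ J, x ∉ I2) (h3 : ∀ x ∈ J, x ∉ A) :
    Legs A (X ++ z :: J) I2 := by
  obtain ⟨⟨n1, n2, n3, n4⟩, m1, m2, m3⟩ := h.left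
  refine ⟨nodup_glue n1 m1 hJ ?_ ?_, n2, ?_, n4⟩
  · intro hz; exact h1 z hz (by simp)
  · intro x hx hx'; exact h1 x hx (by simp [hx'])
  · intro x hx
    simp only [List.mem_append, List.mem_cons] at hx
    rcases hx with hx | rfl | hx
    · exact n3 x hx
    · exact ⟨m2, m3⟩
    · exact ⟨h2 x hx, h3 x hx⟩

/-- a fan from the set `A` to `w`, one of whose legs starts at `a0` -/
def Fan {V : Type*} (G : SimpleGraph V) (A : Set V) (a0 w : V) : Prop :=
  ∃ u ∈ A, u ≠ a0 ∧ ∃ I1 I2 : List V, Lk G a0 I1 w ∧ Lk G u I2 w ∧ Legs A I1 I2 ∧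
    w ∉ I1 ∧ w ∉ I2

theorem fan_step {V : Type*} {G : SimpleGraph V} (hC : Conn2 G) (A : Set V) (a0 w v : V)
    (ha : a0 ∈ A) (hw : w ∉ A) (hv : v ∉ A) (hwv : G.Adj w v) (h : Fan G A a0 w) :
    Fan G A a0 v := by
  obtain ⟨u, hu, hua, I1, I2, h1, h2, h3, h4, h4'⟩ := h
  have hne := hwv.ne
  by_cases c1 : v ∈ I1
  · obtain ⟨X, Y, rfl⟩ := List.append_of_mem c1
    rw [lk_split] at h1
    obtain ⟨g1, g2, g3, g4⟩ := h3.left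
    have hwX : w ∉ X := fun h => h4 (by simp [h])
    exact ⟨u, hu, hua, X, I2 ++ [w], h1.1, lk_snoc.2 ⟨h2, hwv⟩, g1.snoc hwX h4' hw, g2,
      by simp [g3, hne.symm]⟩
  by_cases c2 : v ∈ I2
  · obtain ⟨X, Y, rfl⟩ := List.append_of_mem c2
    rw [lk_split] at h2
    obtain ⟨g1, g2, g3, g4⟩ := h3.symm.left
    have hwX : w ∉ X := fun h => h4' (by simp [h])
    exact ⟨u, hu, hua, I1 ++ [w], X, lk_snoc.2 ⟨h1, hwv⟩, h2.1, (g1.snoc hwX h4 hw).symm,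
      by simp [g3, hne.symm], g2⟩
  obtain ⟨z, hz, J, j1, j2, j3, j4, j5⟩ := conn_set hC {x | x ∈ A ∨ x ∈ I1 ∨ x ∈ I2} w v
    (by simp; grind) (by simp; grind) hne.symm ⟨a0, Or.inl ha⟩
  have k1 : ∀ x ∈ J, x ∉ A := fun x hx h => j5 x hx (Or.inl h)
  have k2 : ∀ x ∈ J, x ∉ I1 := fun x hx h => j5 x hx (Or.inr (Or.inl h))
  have k3 : ∀ x ∈ J, x ∉ I2 := fun x hx h => j5 x hx (Or.inr (Or.inr h))
  have e1 : v ∉ I1 ++ [w] := by simp [c1, hne.symm]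
  have e2 : v ∉ I2 ++ [w] := by simp [c2, hne.symm]
  have k4 : ∀ x ∈ J, x ∉ I1 ++ [w] := by
    intro x hx; have := k2 x hx; have : x ≠ w := by { rintro rfl; exact j4 hx }
    simp [*]
  have k5 : ∀ x ∈ J, x ∉ I2 ++ [w] := by
    intro x hx; have := k3 x hx; have : x ≠ w := by { rintro rfl; exact j4 hx }
    simp [*]
  have L1 := h3.snoc h4 h4' hw
  have L2 := h3.symm.snoc h4' h4 hw
  by_cases c3 : z = a0
  · subst c3
    exact ⟨u, hu, hua, J, I2 ++ [w], j1, lk_snoc.2 ⟨h2, hwv⟩, L1.repl j2 k5 k1, j3, e2⟩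
  by_cases c4 : z ∈ A
  · exact ⟨z, c4, c3, I1 ++ [w], J, lk_snoc.2 ⟨h1, hwv⟩, j1, (L2.repl j2 k4 k1).symm, e1, j3⟩
  rcases hz.resolve_left c4 with c5 | c5
  · obtain ⟨X, Y, rfl⟩ := List.append_of_mem c5
    rw [lk_split] at h1
    exact ⟨u, hu, hua, X ++ z :: J, I2 ++ [w], lk_split.2 ⟨h1.1, j1⟩, lk_snoc.2 ⟨h2, hwv⟩,
      L1.glue j2 k2 k5 k1, by simp at c1 ⊢; tauto, e2⟩
  · obtain ⟨X, Y, rfl⟩ := List.append_of_mem c5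
    rw [lk_split] at h2
    exact ⟨u, hu, hua, I1 ++ [w], X ++ z :: J, lk_snoc.2 ⟨h1, hwv⟩, lk_split.2 ⟨h2.1, j1⟩,
      (L2.glue j2 k3 k4 k1).symm, e1, by simp at c2 ⊢; tauto⟩

theorem fan_exists {V : Type*} {G : SimpleGraph V} (hC : Conn2 G) (A : Set V) (a0 a1 : V)
    (ha : a0 ∈ A) (ha1 : a1 ∈ A) (hne : a1 ≠ a0) (R : List V) : ∀ w, w ∉ A →
    (∀ x ∈ R, x ∉ A) → Lk G a0 R w → Fan G A a0 w := by
  induction R using List.reverseRecOn with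
  | nil =>
    intro w hw _ h
    obtain ⟨u, hu, I, i1, i2, i3, i4, i5⟩ := conn_set hC (A \ {a0}) a0 w (by simp)
      (fun h => hw h.1) (by rintro rfl; exact hw ha) ⟨a1, ha1, hne⟩
    refine ⟨u, hu.1, hu.2, [], I, h, i1, ⟨by simp, i2, by simp, ?_⟩, by simp, i3⟩
    intro x hx hxA
    refine i5 x hx ⟨hxA, ?_⟩
    rintro rfl
    exact i4 hx
  | append_singleton R z ih =>
    intro w hw hR h
    rw [lk_snoc] at h
    exact fan_step hC A a0 z w ha (hR z (by simp)) hw h.2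
      (ih z (hR z (by simp)) (fun x hx => hR x (by simp [hx])) h.1)

/-- cut a walk at the first element of a set -/
theorem first_hit {V : Type*} {G : SimpleGraph V} (B : Set V) (L : List V) (a b : V) (hb : b ∈ B)
    (h : Lk G a L b) (hn : L.Nodup) :
    ∃ J e, Lk G a J e ∧ e ∈ B ∧ (∀ x ∈ J, x ∉ B) ∧ J.Nodup ∧ (∀ x ∈ J, x ∈ L) ∧
      (e = b ∨ e ∈ L) := by
  classical
  induction L generalizing a with
  | nil => exact ⟨[], b, h, hb, by simp⟩
  | cons z L ih =>
    rw [lk_cons] at h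
    by_cases hz : z ∈ B
    · exact ⟨[], z, lk_nil.2 h.1, hz, by simp⟩
    · rw [List.nodup_cons] at hn
      obtain ⟨J, e, h1, h2, h3, h4, h5, h6⟩ := ih z h.2 hn.2
      refine ⟨z :: J, e, lk_cons.2 ⟨h.1, h1⟩, h2, ?_, ?_, ?_, ?_⟩
      · simpa [hz] using h3
      · rw [List.nodup_cons]; exact ⟨fun hh => hn.1 (h5 _ hh), h4⟩
      · intro x hx
        rcases List.mem_cons.1 hx with rfl | hx
        · simp
        · simp [h5 x hx]
      · rcases h6 with h6 | h6 <;> simp [h6]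

theorem linkage {V : Type*} {G : SimpleGraph V} (hC : Conn2 G) (A B : Set V) (a0 a1 b0 b1 : V)
    (ha : a0 ∈ A) (ha1 : a1 ∈ A) (hne : a1 ≠ a0) (hb : b0 ∈ B) (hb1 : b1 ∈ B) (hbne : b1 ≠ b0)
    (hAB : ∀ x ∈ A, x ∉ B) (R : List V) (hR : Lk G a0 R b0) (hRA : ∀ x ∈ R, x ∉ A ∪ B) :
    ∃ u ∈ A, u ≠ a0 ∧ ∃ w ∈ B, w ≠ b0 ∧ ∃ I1 I2 : List V, Legs (A ∪ B) I1 I2 ∧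
      ((Lk G a0 I1 b0 ∧ Lk G u I2 w) ∨ (Lk G a0 I1 w ∧ Lk G u I2 b0)) := by
  have hb0A : b0 ∉ A := fun h => hAB _ h hb
  have hb1A : b1 ∉ A := fun h => hAB _ h hb1
  obtain ⟨u, hu, hua, I1, I2, h1, h2, ⟨f1, f2, f3, f4⟩, h4, h5⟩ := fan_exists hC A a0 a1 ha ha1 hne R b0
    hb0A (fun x hx h => (hRA x hx) (Or.inl h)) hR
  obtain ⟨J1, e1, l1, p2, p3, p4, p5, p6⟩ := first_hit B I1 a0 b0 hb h1 f1
  obtain ⟨J2, e2, l2, q2, q3, q4, q5, q6⟩ := first_hit B I2 u b0 hb h2 f2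
  have hL : Legs (A ∪ B) J1 J2 := by
    refine ⟨p4, q4, fun x hx => ⟨fun hx' => (f3 x (p5 x hx)).1 (q5 x hx'), ?_⟩, fun x hx => ?_⟩
    · rintro (h | h)
      · exact (f3 x (p5 x hx)).2 h
      · exact p3 x hx h
    · rintro (h | h)
      · exact f4 x (q5 x hx) h
      · exact q3 x hx h
  have bJ1 : ∀ b ∈ B, b ∉ J1 := fun b hb h => p3 b h hb
  have bJ2 : ∀ b ∈ B, b ∉ J2 := fun b hb h => q3 b h hb
  clear h1 h2 f1 f2 f3 f4 h4 h5 p4 p5 p6 q4 q5 q6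
  by_cases c1 : e1 = b0
  · by_cases c2 : e2 = b0
    · rw [c1] at l1
      rw [c2] at l2
      obtain ⟨z, hz, J, j1, j2, j3, j4, j5⟩ := conn_set hC {x | x ∈ A ∨ x ∈ J1 ∨ x ∈ J2} b0 b1
        (by simp [hb0A, bJ1 _ hb, bJ2 _ hb]) (by simp [hb1A, bJ1 _ hb1, bJ2 _ hb1]) hbne
        ⟨a0, Or.inl ha⟩
      obtain ⟨M, w, l3, m2, m3, m4, m5, m6⟩ := first_hit B J z b1 hb1 j1 j2
      have hwb : w ≠ b0 := by
        rcases m6 with rfl | h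
        · exact hbne
        · rintro rfl; exact j4 h
      have k1 : ∀ x ∈ M, x ∉ A ∪ B := by
        rintro x hx (h | h)
        · exact j5 x (m5 x hx) (Or.inl h)
        · exact m3 x hx h
      have k2 : ∀ x ∈ M, x ∉ J1 := fun x hx h => j5 x (m5 x hx) (Or.inr (Or.inl h))
      have k3 : ∀ x ∈ M, x ∉ J2 := fun x hx h => j5 x (m5 x hx) (Or.inr (Or.inr h))
      by_cases c3 : z = a0
      · subst c3
        exact ⟨u, hu, hua, w, m2, hwb, M, J2, hL.repl m4 k3 k1, Or.inr ⟨l3, l2⟩⟩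
      by_cases c4 : z ∈ A
      · exact ⟨z, c4, c3, w, m2, hwb, J1, M, (hL.symm.repl m4 k2 k1).symm, Or.inl ⟨l1, l3⟩⟩
      rcases hz.resolve_left c4 with c5 | c5
      · obtain ⟨X, Y, rfl⟩ := List.append_of_mem c5
        rw [lk_split] at l1
        exact ⟨u, hu, hua, w, m2, hwb, X ++ z :: M, J2, hL.glue m4 k2 k3 k1,
          Or.inr ⟨lk_split.2 ⟨l1.1, l3⟩, l2⟩⟩
      · obtain ⟨X, Y, rfl⟩ := List.append_of_mem c5
        rw [lk_split] at l2
        exact ⟨u, hu, hua, w, m2, hwb, J1, X ++ z :: M, (hL.symm.glue m4 k3 k2 k1).symm,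
          Or.inl ⟨l1, lk_split.2 ⟨l2.1, l3⟩⟩⟩
    · rw [c1] at l1
      exact ⟨u, hu, hua, e2, q2, c2, J1, J2, hL, Or.inl ⟨l1, l2⟩⟩
  · by_cases c2 : e2 = b0
    · rw [c2] at l2
      exact ⟨u, hu, hua, e1, p2, c1, J1, J2, hL, Or.inr ⟨l1, l2⟩⟩
    · obtain ⟨z, hz, M, m1, m2, m3, m4, m5, m6⟩ := extract {x | x ∈ A ∨ x ∈ J1 ∨ x ∈ J2} R a0 b0
        (Or.inl ha) (by simp [hb0A, bJ1 _ hb, bJ2 _ hb]) hR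
      have k1 : ∀ x ∈ M, x ∉ A ∪ B := fun x hx => hRA x (m5 x hx)
      have k2 : ∀ x ∈ M, x ∉ J1 := fun x hx h => m4 x hx (Or.inr (Or.inl h))
      have k3 : ∀ x ∈ M, x ∉ J2 := fun x hx h => m4 x hx (Or.inr (Or.inr h))
      by_cases c3 : z = a0
      · subst c3
        exact ⟨u, hu, hua, e2, q2, c2, M, J2, hL.repl m2 k3 k1, Or.inl ⟨m1, l2⟩⟩
      have c4 : z ∉ A := fun h => hRA z (m6.resolve_left c3) (Or.inl h)
      rcases hz.resolve_left c4 with c5 | c5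
      · obtain ⟨X, Y, rfl⟩ := List.append_of_mem c5
        rw [lk_split] at l1
        exact ⟨u, hu, hua, e2, q2, c2, X ++ z :: M, J2, hL.glue m2 k2 k3 k1,
          Or.inl ⟨lk_split.2 ⟨l1.1, m1⟩, l2⟩⟩
      · obtain ⟨X, Y, rfl⟩ := List.append_of_mem c5
        rw [lk_split] at l2
        exact ⟨u, hu, hua, e1, p2, c1, J1, X ++ z :: M, (hL.symm.glue m2 k3 k2 k1).symm,
          Or.inr ⟨l1, lk_split.2 ⟨l2.1, m1⟩⟩⟩
end Kop
end

section
namespace Kop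

theorem list_ends {V : Type*} {L : List V} {a b : V} (h2 : 2 ≤ L.length) (ha : L.head? = some a)
    (hb : L.getLast? = some b) : ∃ I, L = a :: (I ++ [b]) := by
  cases L with
  | nil => simp at ha
  | cons x L =>
    simp at ha
    subst ha
    rcases List.eq_nil_or_concat' L with rfl | ⟨Y', y, rfl⟩
    · simp at h2
    · refine ⟨Y', ?_⟩
      have : x :: (Y' ++ [y]) = (x :: Y') ++ [y] := by simp
      rw [this, List.getLast?_concat] at hb
      simp at hb
      rw [hb]

theorem cycle_of_list {V : Type*} {G : SimpleGraph V} {c : ℕ} (hN : NoLong G c) {L : List V}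
    {a b : V} (h2 : 2 ≤ L.length) (ha : L.head? = some a) (hb : L.getLast? = some b)
    (hc : L.IsChain G.Adj) (hn : L.Nodup) (hab : G.Adj b a) : L.length ≤ c := by
  obtain ⟨I, rfl⟩ := list_ends h2 ha hb
  have := hN a I b hc hn hab
  simp only [List.length_cons, List.length_append, List.length_nil]; omega

/-- segment of a sequence -/
def seg {V : Type*} (f : ℕ → V) (i n : ℕ) : List V := (List.range' i n).map f

theorem seg_length {V : Type*} (f : ℕ → V) (i n : ℕ) : (seg f i n).length = n := by simp [seg]

theorem mem_seg {V : Type*} {f : ℕ → V} {i n : ℕ} {x : V} :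
    x ∈ seg f i n ↔ ∃ l, i ≤ l ∧ l < i + n ∧ f l = x := by
  simp [seg, List.mem_range'_1, and_assoc]

theorem seg_head {V : Type*} (f : ℕ → V) (i n : ℕ) : (seg f i (n + 1)).head? = some (f i) := by
  simp [seg, List.range'_succ]

theorem seg_concat {V : Type*} (f : ℕ → V) (i n : ℕ) :
    seg f i (n + 1) = seg f i n ++ [f (i + n)] := by
  simp [seg, List.range'_1_concat]

theorem seg_last {V : Type*} (f : ℕ → V) (i n : ℕ) :
    (seg f i (n + 1)).getLast? = some (f (i + n)) := by
  rw [seg_concat]; simp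

theorem seg_chain {V : Type*} {G : SimpleGraph V} (f : ℕ → V) (m : ℕ)
    (hadj : ∀ i, i + 1 < m → G.Adj (f i) (f (i + 1))) (i n : ℕ) (h : i + n ≤ m) :
    (seg f i n).IsChain G.Adj := by
  induction n with
  | zero => simp [seg]
  | succ n ih =>
    rw [seg_concat]
    refine List.IsChain.append (ih (by omega)) (by simp) ?_
    intro x hx y hy
    simp at hy
    subst hy
    cases n with
    | zero => simp [seg] at hx
    | succ n =>
      rw [seg_last] at hx
      simp at hx
      subst hx
      exact hadj (i + n) (by omega)

theorem seg_nodup {V : Type*} (f : ℕ → V) (m : ℕ) (hinj : ∀ i j, i < m → j < m → f i = f j → i = j)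
    (i n : ℕ) (h : i + n ≤ m) : (seg f i n).Nodup := by
  unfold seg
  refine List.Nodup.map_on ?_ List.nodup_range'
  intro x hx y hy hxy
  simp [List.mem_range'_1] at hx hy
  exact hinj x y (by omega) (by omega) hxy

open Finset in
theorem lolli {V : Type*} {G : SimpleGraph V} [DecidableRel G.Adj] (f : ℕ → V) (m : ℕ)
    (hinj : ∀ i j, i < m → j < m → f i = f j → i = j)
    (hadj : ∀ i, i + 1 < m → G.Adj (f i) (f (i + 1))) (p : ℕ) (hp : p < m)
    (hpadj : G.Adj (f 0) (f p)) (hmax : ∀ l < m, G.Adj (f 0) (f l) → l ≤ p) (i : ℕ) (hi : i < p) :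
    ∃ I, Lk G (f i) I (f p) ∧ (f i :: (I ++ [f p])).Nodup ∧
      (∀ x ∈ f i :: (I ++ [f p]), ∃ l ≤ p, f l = x) ∧
      #{l ∈ range m | G.Adj (f 0) (f l)} + 1 ≤ I.length + 2 := by
  have hex : ∃ j, i < j ∧ j ≤ p ∧ G.Adj (f 0) (f j) := ⟨p, hi, le_rfl, hpadj⟩
  classical
  obtain ⟨h1, h2, h3⟩ := Nat.find_spec hex
  have h4 : ∀ l, i < l → l ≤ p → G.Adj (f 0) (f l) → Nat.find hex ≤ l :=
    fun l a b c => Nat.find_min' hex ⟨a, b, c⟩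
  generalize Nat.find hex = j at h1 h2 h3 h4
  obtain ⟨n, rfl⟩ : ∃ n, p = j + n := ⟨p - j, by omega⟩
  have hL2 : 2 ≤ ((seg f 0 (i + 1)).reverse ++ seg f j (n + 1)).length := by
    simp [seg_length]; omega
  obtain ⟨I, hI⟩ := list_ends (a := f i) (b := f (j + n)) hL2
    (by rw [List.head?_append, List.head?_reverse, seg_last]; simp)
    (by rw [List.getLast?_append, seg_last]; simp)
  have hlen : ((seg f 0 (i + 1)).reverse ++ seg f j (n + 1)).length = I.length + 2 := by
    rw [hI]; simp
  refine ⟨I, ?_, ?_, ?_, ?_⟩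
  · unfold Lk
    rw [← hI]
    refine List.IsChain.append ?_ (seg_chain f m hadj _ _ (by omega)) ?_
    · rw [List.isChain_reverse]
      exact (seg_chain f m hadj 0 (i + 1) (by omega)).imp (fun _ _ h => h.symm)
    · intro x hx y hy
      rw [List.getLast?_reverse, seg_head] at hx
      rw [seg_head] at hy
      simp at hx hy
      subst hx hy
      exact h3
  · rw [← hI, List.nodup_append']
    refine ⟨List.nodup_reverse.2 (seg_nodup f m hinj _ _ (by omega)),
      seg_nodup f m hinj _ _ (by omega), ?_⟩
    intro x hx hx'
    rw [List.mem_reverse, mem_seg] at hx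
    rw [mem_seg] at hx'
    obtain ⟨a, a1, a2, rfl⟩ := hx
    obtain ⟨b, b1, b2, b3⟩ := hx'
    have := hinj b a (by omega) (by omega) b3
    omega
  · intro x hx
    rw [← hI, List.mem_append, List.mem_reverse, mem_seg, mem_seg] at hx
    rcases hx with ⟨l, a, b, e⟩ | ⟨l, a, b, e⟩
    · exact ⟨l, by omega, e⟩
    · exact ⟨l, by omega, e⟩
  · rw [← hlen]
    have : ({l ∈ range m | G.Adj (f 0) (f l)} : Finset ℕ) ⊆ Icc 1 i ∪ Icc j (j + n) := by
      intro l hl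
      simp at hl
      have := hmax l hl.1 hl.2
      have : l ≠ 0 := by rintro rfl; exact hl.2.ne rfl
      simp
      by_cases hil : i < l
      · right; exact ⟨h4 l hil (by omega) hl.2, by omega⟩
      · left; omega
    have := (card_le_card this).trans (card_union_le _ _)
    simp [seg_length] at this ⊢
    omega

theorem assemble {V : Type*} {G : SimpleGraph V} {c : ℕ} (hN : NoLong G c) {A B : Set V}
    (hAB : ∀ x ∈ A, x ∉ B) {u a b w : V} {I I1 I' I2 : List V} (h1 : Lk G u I a) (h2 : Lk G a I1 b)
    (h3 : Lk G b I' w) (h4 : Lk G u I2 w) (n1 : (u :: (I ++ [a])).Nodup)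
    (n2 : (b :: (I' ++ [w])).Nodup) (hL : Legs (A ∪ B) I1 I2)
    (hA : ∀ x ∈ u :: (I ++ [a]), x ∈ A) (hB : ∀ x ∈ b :: (I' ++ [w]), x ∈ B) :
    I.length + I'.length + 4 ≤ c := by
  have := two_links hN (lk_split.2 ⟨h1, lk_split.2 ⟨h2, h3⟩⟩) (lk_rev h4) (by
    have e : u :: (I ++ a :: (I1 ++ b :: I') ++ w :: I2.reverse) =
      (u :: (I ++ [a])) ++ (I1 ++ ((b :: (I' ++ [w])) ++ I2.reverse)) := by simp
    rw [e]
    obtain ⟨g1, g2, g3, g4⟩ := hL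
    rw [List.nodup_append', List.nodup_append', List.nodup_append']
    refine ⟨n1, ⟨g1, ⟨n2, List.nodup_reverse.2 g2, ?_⟩, ?_⟩, ?_⟩
    · intro x hx hx'
      exact g4 x (List.mem_reverse.1 hx') (Or.inr (hB x hx))
    · intro x hx hx'
      rcases List.mem_append.1 hx' with h | h
      · exact (g3 x hx).2 (Or.inr (hB x h))
      · exact (g3 x hx).1 (List.mem_reverse.1 h)
    · intro x hx hx'
      rcases List.mem_append.1 hx' with h | h
      · exact (g3 x h).2 (Or.inl (hA x hx))
      rcases List.mem_append.1 h with h | h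
      · exact hAB x (hA x hx) (hB x h)
      · exact g4 x (List.mem_reverse.1 h) (Or.inl (hA x hx)))
  simp at this
  omega

theorem nodup_rev_path {V : Type*} {a b : V} {I : List V} (h : (a :: (I ++ [b])).Nodup) :
    (b :: (I.reverse ++ [a])).Nodup := by
  have := List.nodup_reverse.2 h
  simpa using this

theorem mem_rev_path {V : Type*} {a b : V} {I : List V} {P : V → Prop}
    (h : ∀ x ∈ a :: (I ++ [b]), P x) : ∀ x ∈ b :: (I.reverse ++ [a]), P x := by
  intro x hx
  apply h
  simp at hx ⊢
  tauto

theorem seg_link {V : Type*} {G : SimpleGraph V} (f : ℕ → V) (m : ℕ)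
    (hadj : ∀ i, i + 1 < m → G.Adj (f i) (f (i + 1))) (i n : ℕ) (h : i + n + 1 < m) :
    Lk G (f i) (seg f (i + 1) n) (f (i + n + 1)) := by
  have := seg_chain f m hadj i (n + 2) (by omega)
  unfold Lk
  convert this using 1
  rw [show n + 2 = (n + 1) + 1 by rfl, seg_concat]
  simp [seg, List.range'_succ]
  congr 1

open Finset in
theorem kopylov {V : Type*} {G : SimpleGraph V} [DecidableRel G.Adj] {c : ℕ} (hC : Conn2 G)
    (f : ℕ → V) (m : ℕ) (hm : 3 ≤ m)
    (hinj : ∀ i j, i < m → j < m → f i = f j → i = j)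
    (hadj : ∀ i, i + 1 < m → G.Adj (f i) (f (i + 1))) (hmc : c + 1 ≤ m)
    (hd : c + 1 ≤ #{l ∈ range m | G.Adj (f 0) (f l)} + #{l ∈ range m | G.Adj (f (m - 1)) (f l)}) :
    ¬ NoLong G c := by
  intro hN
  classical
  set A0 : Finset ℕ := {l ∈ range m | G.Adj (f 0) (f l)} with hA0
  set B0 : Finset ℕ := {l ∈ range m | G.Adj (f (m - 1)) (f l)} with hB0
  have memA : ∀ l, l ∈ A0 ↔ l < m ∧ G.Adj (f 0) (f l) := by intro l; simp [hA0]
  have memB : ∀ l, l ∈ B0 ↔ l < m ∧ G.Adj (f (m - 1)) (f l) := by intro l; simp [hB0]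
  have A0nz : ∀ l ∈ A0, l ≠ 0 := by
    rintro l hl rfl; exact ((memA _).1 hl).2.ne rfl
  have B0nz : ∀ l ∈ B0, l ≠ m - 1 := by
    rintro l hl rfl; exact ((memB _).1 hl).2.ne rfl
  by_cases hcross : ∃ d, ∃ i ∈ B0, i + d + 1 ∈ A0
  · obtain ⟨i, hi, hj⟩ := Nat.find_spec hcross
    have hmin : ∀ d < Nat.find hcross, ¬ ∃ i ∈ B0, i + d + 1 ∈ A0 :=
      fun d hd => Nat.find_min hcross hd
    generalize Nat.find hcross = d at hi hj hmin
    have hi' := (memB _).1 hi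
    have hj' := (memA _).1 hj
    obtain ⟨n, hn⟩ : ∃ n, m = i + d + 1 + (n + 1) := ⟨m - (i + d + 1) - 1, by omega⟩
    have key := cycle_of_list hN (L := seg f 0 (i + 1) ++ (seg f (i + d + 1) (n + 1)).reverse)
      (a := f 0) (b := f (i + d + 1)) (by simp [seg_length]; omega)
      (by rw [List.head?_append, seg_head]; simp)
      (by rw [List.getLast?_append, List.getLast?_reverse, seg_head]; simp)
      (by
        refine List.IsChain.append (seg_chain f m hadj _ _ (by omega)) ?_ ?_
        · rw [List.isChain_reverse]
          exact (seg_chain f m hadj _ _ (by omega)).imp (fun _ _ h => h.symm)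
        · intro x hx y hy
          rw [seg_last] at hx
          rw [List.head?_reverse, seg_last] at hy
          simp at hx hy
          subst hx hy
          have : i + d + 1 + n = m - 1 := by omega
          rw [this]
          exact hi'.2.symm)
      (by
        rw [List.nodup_append']
        refine ⟨seg_nodup f m hinj _ _ (by omega),
          List.nodup_reverse.2 (seg_nodup f m hinj _ _ (by omega)), ?_⟩
        intro x hx hx'
        rw [List.mem_reverse, mem_seg] at hx'
        rw [mem_seg] at hx
        obtain ⟨a, a1, a2, rfl⟩ := hx
        obtain ⟨b, b1, b2, b3⟩ := hx'
        have := hinj b a (by omega) (by omega) b3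
        omega)
      hj'.2.symm
    simp [seg_length] at key
    rcases Nat.eq_zero_or_pos d with rfl | hdpos
    · omega
    · have hdisj : Disjoint A0 (B0.image (· + 1)) := by
        rw [Finset.disjoint_left]
        intro x hx hx'
        simp at hx'
        obtain ⟨b, hb, rfl⟩ := hx'
        exact hmin 0 hdpos ⟨b, hb, by simpa using hx⟩
      have hsub : A0 ∪ B0.image (· + 1) ⊆ Icc 1 (m - 1) \ Icc (i + 2) (i + d) := by
        intro x hx
        simp only [mem_union, mem_image] at hx
        simp only [mem_sdiff, mem_Icc, not_and, not_le]
        rcases hx with hx | ⟨b, hb, rfl⟩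
        · have h0 := A0nz x hx
          have h1 := (memA x).1 hx
          refine ⟨by omega, ?_⟩
          intro h2
          by_contra h3
          exact hmin (x - i - 1) (by omega) ⟨i, hi, by
            rw [show i + (x - i - 1) + 1 = x by omega]; exact hx⟩
        · have h0 := B0nz b hb
          have h1 := (memB b).1 hb
          refine ⟨by omega, ?_⟩
          intro h2
          by_contra h3
          exact hmin (i + d - b) (by omega) ⟨b, hb, by
            rw [show b + (i + d - b) + 1 = i + d + 1 by omega]; exact hj⟩
      have h1 := card_le_card hsub
      rw [card_union_of_disjoint hdisj, card_image_of_injective _ (add_left_injective 1),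
        card_sdiff_of_subset (by intro x; simp; omega)] at h1
      simp at h1
      omega
  · push Not at hcross
    have hA1 : 1 ∈ A0 := (memA 1).2 ⟨by omega, hadj 0 (by omega)⟩
    have hB1 : m - 2 ∈ B0 := (memB _).2 ⟨by omega, by
      have := hadj (m - 2) (by omega)
      rw [show m - 2 + 1 = m - 1 by omega] at this
      exact this.symm⟩
    set p := A0.max' ⟨1, hA1⟩ with hp
    set q := B0.min' ⟨_, hB1⟩ with hq
    have hpA : p ∈ A0 := A0.max'_mem _
    have hqB : q ∈ B0 := B0.min'_mem _
    have hpmax : ∀ l ∈ A0, l ≤ p := fun l hl => A0.le_max' l hl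
    have hqmin : ∀ l ∈ B0, q ≤ l := fun l hl => B0.min'_le l hl
    have hpq : p ≤ q := by
      by_contra h
      exact hcross (p - q - 1) q hqB (by rw [show q + (p - q - 1) + 1 = p by omega]; exact hpA)
    have hp1 : 1 ≤ p := hpmax 1 hA1
    have hq1 : q ≤ m - 2 := hqmin _ hB1
    clear_value p q
    have hpA' := (memA p).1 hpA
    have hqB' := (memB q).1 hqB
    have lolA := fun i hi => lolli f m hinj hadj p (by omega) hpA'.2
      (fun l h1 h2 => hpmax l ((memA l).2 ⟨h1, h2⟩)) i hi
    have lolB : ∀ j, q < j → j < m → ∃ I, Lk G (f j) I (f q) ∧ (f j :: (I ++ [f q])).Nodup ∧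
      (∀ x ∈ f j :: (I ++ [f q]), ∃ l, q ≤ l ∧ l < m ∧ f l = x) ∧
      #B0 + 1 ≤ I.length + 2 := by
      intro j hj hjm
      obtain ⟨I, i1, i2, i3, i4⟩ := lolli (G := G) (fun l => f (m - 1 - l)) m
        (by
          intro a b ha hb h
          have := hinj _ _ (by omega) (by omega) h
          omega)
        (by
          intro a ha
          have := hadj (m - 1 - (a + 1)) (by omega)
          rw [show m - 1 - (a + 1) + 1 = m - 1 - a by omega] at this
          exact this.symm)
        (m - 1 - q) (by omega)
        (by
          have : m - 1 - (m - 1 - q) = q := by omega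
          simp only [this, Nat.sub_zero]
          exact hqB'.2)
        (by
          intro l hl h
          have := hqmin (m - 1 - l) ((memB _).2 ⟨by omega, by simpa using h⟩)
          omega)
        (m - 1 - j) (by omega)
      have e1 : m - 1 - (m - 1 - q) = q := by omega
      have e2 : m - 1 - (m - 1 - j) = j := by omega
      simp only [e1, e2] at i1 i2 i3 i4
      refine ⟨I, i1, i2, ?_, ?_⟩
      · intro x hx
        obtain ⟨l, hl, rfl⟩ := i3 x hx
        exact ⟨m - 1 - l, by omega, by omega, rfl⟩
      · refine le_trans (Nat.add_le_add_right ?_ 1) i4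
        rw [← card_image_of_injOn (s := B0) (f := fun l => m - 1 - l)]
        · apply card_le_card
          intro x hx
          simp only [mem_image] at hx
          obtain ⟨l, hl, rfl⟩ := hx
          have hl' := (memB l).1 hl
          simp only [mem_filter, mem_range, Nat.sub_zero]
          refine ⟨by omega, ?_⟩
          rw [show m - 1 - (m - 1 - l) = l by omega]
          exact hl'.2
        · intro a ha b hb hab
          have h1 := (memB a).1 ha
          have h2 := (memB b).1 hb
          simp at hab
          omega
    rcases Nat.lt_or_ge p q with hlt | hge
    · -- disjoint lollipops
      have hAB : ∀ x ∈ {x | ∃ l ≤ p, f l = x}, x ∉ {x | ∃ l, q ≤ l ∧ l < m ∧ f l = x} := by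
        rintro x ⟨l, hl, rfl⟩ ⟨l', h1, h2, h3⟩
        have := hinj _ _ h2 (by omega) h3
        omega
      have hR := seg_link f m hadj p (q - p - 1) (by omega)
      rw [show p + (q - p - 1) + 1 = q by omega] at hR
      obtain ⟨u, ⟨i, hi, rfl⟩, hu, w, ⟨j, hj, hj', rfl⟩, hw, I1, I2, hL, hor⟩ :=
        linkage hC {x | ∃ l ≤ p, f l = x} {x | ∃ l, q ≤ l ∧ l < m ∧ f l = x}
        (f p) (f 0) (f q) (f (m - 1)) ⟨p, le_rfl, rfl⟩ ⟨0, by omega, rfl⟩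
        (fun h => by have := hinj _ _ (by omega) (by omega) h; omega)
        ⟨q, le_rfl, by omega, rfl⟩ ⟨m - 1, by omega, by omega, rfl⟩
        (fun h => by have := hinj _ _ (by omega) (by omega) h; omega)
        hAB _ hR
        (by
          intro x hx
          rw [mem_seg] at hx
          obtain ⟨l, h1, h2, rfl⟩ := hx
          rintro (⟨l', h3, h4⟩ | ⟨l', h3, h3', h4⟩)
          · have := hinj _ _ (by omega) (by omega) h4; omega
          · have := hinj _ _ (by omega) (by omega) h4; omega)
      have hip : i < p := by
        rcases Nat.lt_or_ge i p with h | h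
        · exact h
        · exact absurd (by rw [show i = p by omega]) hu
      have hjq : q < j := by
        rcases Nat.lt_or_ge q j with h | h
        · exact h
        · exact absurd (by rw [show j = q by omega]) hw
      obtain ⟨I, i1, i2, i3, i4⟩ := lolA i hip
      have i4' : #A0 + 1 ≤ I.length + 2 := by convert i4
      obtain ⟨I', j1, j2, j3, j4⟩ := lolB j hjq hj'
      rcases hor with ⟨k1, k2⟩ | ⟨k1, k2⟩
      · have := assemble hN hAB i1 k1 (lk_rev j1) k2 i2 (nodup_rev_path j2) hL i3
          (mem_rev_path j3)
        simp at this
        omega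
      · have := assemble hN hAB i1 k1 j1 k2 i2 j2 hL i3 j3
        omega
    · -- common vertex
      have hqp : q = p := by omega
      subst hqp
      have hS : f (m - 1) ∉ {x | ∃ l < q, f l = x} := by
        rintro ⟨l, hl, h⟩
        have := hinj _ _ (by omega) (by omega) h
        omega
      obtain ⟨u, ⟨i, hi, rfl⟩, J, j1, j2, j3, j4, j5⟩ := conn_set hC {x | ∃ l < q, f l = x}
        (f q) (f (m - 1))
        (by
          rintro ⟨l, hl, h⟩
          have := hinj _ _ (by omega) (by omega) h
          omega) hS
        (fun h => by have := hinj _ _ (by omega) (by omega) h; omega) ⟨f 0, 0, by omega, rfl⟩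
      obtain ⟨M, w, l3, ⟨j, hj, hj', rfl⟩, m3, m4, m5, m6⟩ :=
        first_hit {x | ∃ l, q < l ∧ l < m ∧ f l = x} J _ _ ⟨m - 1, by omega, by omega, rfl⟩ j1 j2
      obtain ⟨I, i1, i2, i3, i4⟩ := lolA i hi
      have i4' : #A0 + 1 ≤ I.length + 2 := by convert i4
      obtain ⟨I', j1', j2', j3', j4'⟩ := lolB j hj hj'
      have hMM : ∀ x ∈ M, ∀ l < m, f l ≠ x := by
        rintro x hx l hl rfl
        rcases Nat.lt_trichotomy l q with h | h | h
        · exact j5 _ (m5 _ hx) ⟨l, h, rfl⟩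
        · subst h; exact j4 (m5 _ hx)
        · exact m3 _ hx ⟨l, h, hl, rfl⟩
      have := two_links hN (lk_split.2 ⟨i1, lk_rev j1'⟩) (lk_rev l3) (by
        have e : f i :: (I ++ f q :: I'.reverse ++ f j :: M.reverse) =
          (f i :: (I ++ [f q])) ++ ((I'.reverse ++ [f j]) ++ M.reverse) := by simp
        have n3 := nodup_rev_path j2'
        rw [List.nodup_cons] at n3
        have hB3 := mem_rev_path j3'
        rw [e, List.nodup_append', List.nodup_append']
        refine ⟨i2, ⟨n3.2, List.nodup_reverse.2 m4, ?_⟩, ?_⟩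
        · intro x hx hx'
          obtain ⟨l, h1, h2, h3⟩ := hB3 x (List.mem_cons_of_mem _ hx)
          exact hMM x (List.mem_reverse.1 hx') l h2 h3
        · intro x hx hx'
          obtain ⟨l, h1, h2⟩ := i3 x hx
          rcases List.mem_append.1 hx' with h | h
          · obtain ⟨l', h1', h2', h3'⟩ := hB3 x (List.mem_cons_of_mem _ h)
            have := hinj l l' (by omega) h2' (h2.trans h3'.symm)
            have hl : l = q := by omega
            subst hl
            exact n3.1 (h2 ▸ h)
          · exact hMM x (List.mem_reverse.1 h) l (by omega) h2)
      simp at this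
      omega

end Kop
end

section
namespace Kop

/-- nonadjacent pairs off `F` are joined by long paths -/
def Sat {V : Type*} (G : SimpleGraph V) (c : ℕ) (F : Set V) : Prop :=
  ∀ x y, x ∉ F → y ∉ F → x ≠ y → ¬ G.Adj x y →
    ∃ I, Lk G x I y ∧ (x :: (I ++ [y])).Nodup ∧ c + 1 ≤ I.length + 2

theorem adj_or {V : Type*} {G : SimpleGraph V} {x y a b : V} (h : (G ⊔ edge x y).Adj a b) :
    G.Adj a b ∨ (a = x ∧ b = y) ∨ (a = y ∧ b = x) := by
  rw [sup_adj, edge_adj] at h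
  tauto

theorem chain_avoid {V : Type*} {G : SimpleGraph V} {x y : V} {L : List V}
    (h : L.IsChain (G ⊔ edge x y).Adj) (hy : x ∉ L ∨ y ∉ L) : L.IsChain G.Adj := by
  refine List.IsChain.imp_of_mem_imp ?_ h
  intro a b ha hb hab
  rcases adj_or hab with h | ⟨rfl, rfl⟩ | ⟨rfl, rfl⟩
  · exact h
  · tauto
  · tauto

theorem chain_cases {V : Type*} {G : SimpleGraph V} {x y : V} (L : List V)
    (h : L.IsChain (G ⊔ edge x y).Adj) : L.IsChain G.Adj ∨
      ∃ L1 L2, L = L1 ++ x :: y :: L2 ∨ L = L1 ++ y :: x :: L2 := by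
  induction L with
  | nil => left; exact List.isChain_nil
  | cons a L ih =>
    cases L with
    | nil => left; exact List.isChain_singleton _
    | cons b L =>
      rw [List.isChain_cons_cons] at h
      rcases ih h.2 with h' | ⟨L1, L2, h'⟩
      · rcases adj_or h.1 with h1 | ⟨rfl, rfl⟩ | ⟨rfl, rfl⟩
        · left; rw [List.isChain_cons_cons]; exact ⟨h1, h'⟩
        · right; exact ⟨[], L, Or.inl rfl⟩
        · right; exact ⟨[], L, Or.inr rfl⟩
      · right
        refine ⟨a :: L1, L2, ?_⟩
        rcases h' with h' | h' <;> rw [h'] <;> simp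

theorem split_case {V : Type*} {G : SimpleGraph V} {c : ℕ} {x y a b : V}
    (hc : 2 ≤ c) {L1 L2 : List V}
    (h : (L1 ++ x :: y :: L2).IsChain (G ⊔ edge x y).Adj) (hn : (L1 ++ x :: y :: L2).Nodup)
    (ha : (L1 ++ x :: y :: L2).head? = some a) (hb : (L1 ++ x :: y :: L2).getLast? = some b)
    (hab : (G ⊔ edge x y).Adj b a) (hl : c + 1 ≤ (L1 ++ x :: y :: L2).length) :
    ∃ I, Lk G y I x ∧ (y :: (I ++ [x])).Nodup ∧ c + 1 ≤ I.length + 2 := by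
  have e : L1 ++ x :: y :: L2 = (L1 ++ [x]) ++ (y :: L2) := by simp
  rw [e] at h hn ha hb
  rw [List.isChain_append] at h
  rw [List.nodup_append'] at hn
  obtain ⟨h1, h2, h3⟩ := h
  obtain ⟨n1, n2, n3⟩ := hn
  have hy : y ∉ L1 ++ [x] := fun hh => n3 hh (by simp)
  have hx : x ∉ y :: L2 := fun hh => n3 (by simp) hh
  have h1' := chain_avoid h1 (Or.inr hy)
  have h2' := chain_avoid h2 (Or.inl hx)
  have hb' : (y :: L2).getLast? = some b := by
    rw [← hb, List.getLast?_append]; simp [List.getLast?_cons]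
  have ha' : (L1 ++ [x]).head? = some a := by
    rw [← ha, List.head?_append]; cases L1 <;> simp
  have hba : G.Adj b a := by
    rcases adj_or hab with h | ⟨rfl, rfl⟩ | ⟨rfl, rfl⟩
    · exact h
    · exact absurd (List.mem_of_mem_getLast? hb') hx
    · exfalso
      have e1 : L1 = [] := by
        cases L1 with
        | nil => rfl
        | cons z L1 =>
          simp at ha'
          subst ha'
          simp at n1
      have e2 : L2 = [] := by
        rcases List.eq_nil_or_concat' L2 with h | ⟨Y, z, rfl⟩
        · exact h
        · rw [show b :: (Y ++ [z]) = (b :: Y) ++ [z] by simp, List.getLast?_concat] at hb'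
          simp at hb'
          subst hb'
          simp at n2
      subst e1 e2
      simp at hl
      omega
  refine ⟨L2 ++ L1, ?_, ?_, ?_⟩
  · unfold Lk
    rw [show y :: (L2 ++ L1 ++ [x]) = (y :: L2) ++ (L1 ++ [x]) by simp, List.isChain_append]
    refine ⟨h2', h1', ?_⟩
    intro u hu w hw
    rw [hb'] at hu
    rw [ha'] at hw
    simp at hu hw
    subst hu hw
    exact hba
  · rw [show y :: (L2 ++ L1 ++ [x]) = (y :: L2) ++ (L1 ++ [x]) by simp, List.nodup_append']
    exact ⟨n2, n1, fun u h h' => n3 h' h⟩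
  · simp at hl ⊢
    omega

theorem path_symm {V : Type*} {G : SimpleGraph V} {c : ℕ} {x y : V}
    (h : ∃ I, Lk G y I x ∧ (y :: (I ++ [x])).Nodup ∧ c + 1 ≤ I.length + 2) :
    ∃ I, Lk G x I y ∧ (x :: (I ++ [y])).Nodup ∧ c + 1 ≤ I.length + 2 := by
  obtain ⟨I, h1, h2, h3⟩ := h
  exact ⟨I.reverse, lk_rev h1, nodup_rev_path h2, by simpa using h3⟩

theorem add_edge {V : Type*} {G : SimpleGraph V} {c : ℕ} (hc : 2 ≤ c) (hN : NoLong G c) {x y : V}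
    (h : ¬ NoLong (G ⊔ edge x y) c) :
    ∃ I, Lk G x I y ∧ (x :: (I ++ [y])).Nodup ∧ c + 1 ≤ I.length + 2 := by
  unfold NoLong at h
  push Not at h
  obtain ⟨a, l, b, h1, h2, h3, h4⟩ := h
  have ha : (a :: (l ++ [b])).head? = some a := rfl
  have hb : (a :: (l ++ [b])).getLast? = some b := by
    rw [show a :: (l ++ [b]) = (a :: l) ++ [b] by simp, List.getLast?_concat]
  have hl : c + 1 ≤ (a :: (l ++ [b])).length := by simp; omega
  rcases chain_cases _ h1 with h | ⟨L1, L2, h | h⟩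
  · rcases adj_or h3 with h' | ⟨rfl, rfl⟩ | ⟨rfl, rfl⟩
    · have := hN a l b h h2 h'
      omega
    · exact path_symm ⟨l, h, h2, by omega⟩
    · exact ⟨l, h, h2, by omega⟩
  · unfold Lk at h1
    rw [h] at h1 h2 ha hb hl
    exact path_symm (split_case hc h1 h2 ha hb h3 hl)
  · unfold Lk at h1
    rw [h] at h1 h2 ha hb hl
    rw [edge_comm] at h1 h3
    exact split_case hc h1 h2 ha hb h3 hl

theorem saturate {V : Type*} [Finite V] (G : SimpleGraph V) {c : ℕ} (hc : 2 ≤ c)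
    (hN : NoLong G c) (F : Set V) : ∃ H, G ≤ H ∧ NoLong H c ∧ Sat H c F ∧
      ∀ u ∈ F, ∀ w, H.Adj u w ↔ G.Adj u w := by
  classical
  have hfin : Set.Finite {H : SimpleGraph V | G ≤ H ∧ NoLong H c ∧
    ∀ u ∈ F, ∀ w, H.Adj u w ↔ G.Adj u w} := Set.toFinite _
  obtain ⟨H, hH⟩ := hfin.exists_maximal ⟨G, le_rfl, hN, fun _ _ _ => Iff.rfl⟩
  obtain ⟨h1, h2, h3⟩ := hH.prop
  refine ⟨H, h1, h2, ?_, h3⟩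
  intro x y hx hy hxy hadj
  apply add_edge hc h2
  intro hN'
  have hle : H ≤ H ⊔ edge x y := le_sup_left
  have := hH.le_of_ge (y := H ⊔ edge x y) ⟨h1.trans hle, hN', by
    intro u hu w
    rw [← h3 u hu w]
    constructor
    · intro h
      rcases adj_or h with h | ⟨rfl, rfl⟩ | ⟨rfl, rfl⟩
      · exact h
      · exact absurd hu hx
      · exact absurd hu hy
    · intro h; exact hle h⟩ hle
  apply hadj
  apply this
  rw [sup_adj, edge_adj]
  exact Or.inr ⟨by tauto, hxy⟩

end Kop
end

section
namespace Kop
open Finset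

open Classical in
/-- degree into a finite set -/
noncomputable def dg {V : Type*} (G : SimpleGraph V) (U : Finset V) (x : V) : ℕ :=
  #{u ∈ U | G.Adj x u}

theorem lemmaK {V : Type*} [Fintype V] {G : SimpleGraph V} {c : ℕ} {F : Set V}
    (hC : Conn2 G) (hN : NoLong G c) (hS : Sat G c F) (X Y : Finset V) (hX : ∀ x ∈ X, x ∉ F)
    (hY : ∀ y ∈ Y, y ∉ F) (α β : ℕ) (hα : ∀ x ∈ X, α ≤ dg G X x) (hβ : ∀ y ∈ Y, β ≤ dg G Y y)
    (hab : c + 1 ≤ α + β) : ∀ x ∈ X, ∀ y ∈ Y, x ≠ y → G.Adj x y := by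
  classical
  by_contra hcon
  push Not at hcon
  obtain ⟨x0, hx0, y0, hy0, hne0, hnad0⟩ := hcon
  obtain ⟨I0, i1, i2, i3⟩ := hS x0 y0 (hX _ hx0) (hY _ hy0) hne0 hnad0
  let P : ℕ → Prop := fun m => ∃ x ∈ X, ∃ y ∈ Y, ∃ I, ¬ G.Adj x y ∧ Lk G x I y ∧
    (x :: (I ++ [y])).Nodup ∧ I.length = m
  have hP0 : P I0.length := ⟨x0, hx0, y0, hy0, I0, hnad0, i1, i2, rfl⟩
  have hbd : ∀ m, P m → m ≤ Fintype.card V := by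
    rintro m ⟨x, -, y, -, I, -, -, h, rfl⟩
    have := h.length_le_card
    simp at this
    omega
  have hsp := Nat.findGreatest_spec (hbd _ hP0) hP0
  have hmx : ∀ m, P m → m ≤ Nat.findGreatest P (Fintype.card V) :=
    fun m hm => Nat.le_findGreatest (hbd m hm) hm
  have hlen := hmx _ hP0
  generalize Nat.findGreatest P (Fintype.card V) = M at *
  obtain ⟨x, hx, y, hy, I, hnad, hlk, hnd, rfl⟩ := hsp
  have onx : ∀ z ∈ X, G.Adj x z → z ∈ x :: (I ++ [y]) := by
    intro z hz hxz
    by_contra hmem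
    have hn' : (z :: ((x :: I) ++ [y])).Nodup := by
      rw [List.cons_append, List.nodup_cons]; exact ⟨hmem, hnd⟩
    have hl' : Lk G z (x :: I) y := lk_cons.2 ⟨hxz.symm, hlk⟩
    by_cases hzy : G.Adj z y
    · have := hN z (x :: I) y hl' hn' hzy.symm
      simp at this
      omega
    · have := hmx (I.length + 1) ⟨z, hz, y, hy, x :: I, hzy, hl', hn', by simp⟩
      omega
  have ony : ∀ z ∈ Y, G.Adj y z → z ∈ x :: (I ++ [y]) := by
    intro z hz hyz
    by_contra hmem
    have hn' : (x :: ((I ++ [y]) ++ [z])).Nodup := by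
      rw [← List.cons_append]; exact nodup_snoc hnd hmem
    have hl' : Lk G x (I ++ [y]) z := lk_snoc.2 ⟨hlk, hyz⟩
    by_cases hzy : G.Adj x z
    · have := hN x (I ++ [y]) z hl' hn' hzy.symm
      simp at this
      omega
    · have := hmx (I.length + 1) ⟨x, hx, z, hz, I ++ [y], hzy, hl', hn', by simp⟩
      omega
  by_cases hI : I = []
  · subst hI; exact hnad (lk_nil.1 hlk)
  have hIpos : 1 ≤ I.length := List.length_pos_iff.2 hI
  obtain ⟨L, hL⟩ : ∃ L, L = x :: (I ++ [y]) := ⟨_, rfl⟩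
  have hLl : L.length = I.length + 2 := by rw [hL]; simp
  rw [← hL] at hnd onx ony
  unfold Lk at hlk
  rw [← hL] at hlk
  set f : ℕ → V := fun i => L.getD i x with hf
  have fget : ∀ i (h : i < L.length), f i = L[i] := by
    intro i h
    simp [hf, List.getD_eq_getElem?_getD, h]
  have f0 : f 0 = x := by simp [hf, hL]
  have fl : f (I.length + 2 - 1) = y := by
    rw [fget _ (by omega)]
    simp [hL]
  have count : ∀ (w : V) (Z : Finset V), (∀ z ∈ Z, G.Adj w z → z ∈ L) →
      dg G Z w ≤ #{l ∈ range (I.length + 2) | G.Adj w (f l)} := by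
    intro w Z h
    unfold dg
    refine le_trans (card_le_card (t := image f {l ∈ range (I.length + 2) | G.Adj w (f l)}) ?_)
      card_image_le
    intro z hz
    simp only [mem_filter] at hz
    obtain ⟨i, hi, rfl⟩ := List.mem_iff_getElem.1 (h z hz.1 hz.2)
    simp only [mem_image, mem_filter, mem_range]
    refine ⟨i, ⟨by omega, ?_⟩, fget i hi⟩
    rw [fget i hi]; exact hz.2
  refine kopylov (G := G) (c := c) hC f (I.length + 2) (by omega) ?_ ?_ (by omega) ?_ hN
  · intro i j hi hj h
    rw [fget i (by omega), fget j (by omega)] at h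
    exact (List.Nodup.getElem_inj_iff hnd).1 h
  · intro i hi
    rw [fget i (by omega), fget (i+1) (by omega)]
    exact List.isChain_iff_getElem.1 hlk i (by omega)
  · rw [f0, fl]
    have := count x X onx
    have := count y Y ony
    have := hα x hx
    have := hβ y hy
    omega

theorem dg_mono {V : Type*} (G : SimpleGraph V) {U W : Finset V} (h : U ⊆ W) (x : V) :
    dg G U x ≤ dg G W x := by
  classical
  exact card_le_card (filter_subset_filter _ h)

open Classical in
/-- number of `s`-cliques inside a finite set -/
noncomputable def nc {V : Type*} (G : SimpleGraph V) (s : ℕ) (U : Finset V) : ℕ :=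
  #(Finset.filter (fun S : Finset V => G.IsClique (S : Set V)) (U.powersetCard s))

theorem nc_le {V : Type*} (G : SimpleGraph V) (s : ℕ) (U : Finset V) :
    nc G s U ≤ (#U).choose s := by
  classical
  unfold nc
  exact (card_filter_le _ _).trans (by rw [card_powersetCard])

open Classical in
theorem nc_remove {V : Type*} (G : SimpleGraph V) (s : ℕ) (U : Finset V) (x : V) :
    nc G s U ≤ nc G s (U.erase x) + (dg G U x).choose (s - 1) := by
  unfold nc dg
  rw [← card_powersetCard]
  refine le_trans (card_le_card (t := Finset.filter (fun S : Finset V => G.IsClique (S : Set V))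
      ((U.erase x).powersetCard s) ∪ Finset.image (fun T : Finset V => insert x T)
      (powersetCard (s - 1) (Finset.filter (fun u => G.Adj x u) U))) ?_)
    ((card_union_le _ _).trans (Nat.add_le_add_left card_image_le _))
  intro S hS
  simp only [mem_filter, mem_powersetCard] at hS
  obtain ⟨⟨h1, h2⟩, h3⟩ := hS
  simp only [mem_union, mem_filter, mem_powersetCard, mem_image]
  by_cases hx : x ∈ S
  · right
    refine ⟨S.erase x, ⟨?_, by rw [card_erase_of_mem hx, h2]⟩, insert_erase hx⟩
    intro u hu
    have hu' := mem_erase.1 hu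
    exact mem_filter.2 ⟨h1 hu'.2, h3 hx hu'.2 hu'.1.symm⟩
  · left
    refine ⟨⟨?_, h2⟩, h3⟩
    intro u hu
    exact mem_erase.2 ⟨fun h => hx (h ▸ hu), h1 hu⟩

theorem deg2 {V : Type*} (G : SimpleGraph V) (s : ℕ) (m d : ℕ) (j : ℕ) :
    ∀ W : Finset V, #W = m + j → (∀ U ⊆ W, m < #U → ∃ x ∈ U, dg G U x ≤ d) →
      nc G s W ≤ m.choose s + j * d.choose (s - 1) := by
  classical
  induction j with
  | zero =>
    intro W hW _
    have := nc_le G s W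
    simp at hW
    rw [hW] at this
    omega
  | succ j ih =>
    intro W hW h
    obtain ⟨x, hx, hd⟩ := h W (Subset.refl _) (by omega)
    have h1 := nc_remove G s W x
    have h2 := ih (W.erase x) (by rw [card_erase_of_mem hx]; omega)
      (fun U hU => h U (hU.trans (erase_subset _ _)))
    have h3 : (dg G W x).choose (s - 1) ≤ d.choose (s - 1) := Nat.choose_le_choose _ hd
    rw [add_mul]
    omega

theorem nc_mono {V : Type*} {G H : SimpleGraph V} (h : G ≤ H) (s : ℕ) (U : Finset V) :
    nc G s U ≤ nc H s U := by
  classical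
  unfold nc
  apply card_le_card
  intro S hS
  rw [mem_filter] at hS ⊢
  exact ⟨hS.1, hS.2.mono h⟩

end Kop
end

section
namespace Kop
open Finset

theorem walk_link {V : Type*} {G : SimpleGraph V} (v : V) {a b : {u | u ≠ v}}
    (p : (G.induce {u | u ≠ v}).Walk a b) :
    ∃ L, v ∉ L ∧ (a = b ∨ Lk G a.1 L b.1) := by
  induction p with
  | nil => exact ⟨[], by simp, Or.inl rfl⟩
  | @cons a d b h p ih =>
    obtain ⟨L, h1, h2⟩ := ih
    have h' : G.Adj a.1 d.1 := h
    rcases h2 with rfl | h2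
    · exact ⟨[], by simp, Or.inr (lk_nil.2 h')⟩
    · refine ⟨d.1 :: L, ?_, Or.inr (lk_cons.2 ⟨h', h2⟩)⟩
      rw [List.mem_cons]
      rintro (h3 | h3)
      · exact d.2 h3.symm
      · exact h1 h3

theorem conn2_of {V : Type*} {G : SimpleGraph V} (h : TwoConnected G) : Conn2 G := by
  intro v a b ha hb hab
  obtain ⟨p⟩ := (h.2 v).preconnected ⟨a, ha⟩ ⟨b, hb⟩
  obtain ⟨L, h1, h2⟩ := walk_link v p
  refine ⟨L, h1, ?_⟩
  rcases h2 with h2 | h2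
  · exact absurd (congrArg Subtype.val h2) hab
  · exact h2

theorem link_walk {V : Type*} {G : SimpleGraph V} {b : V} (l : List V) : ∀ a, Lk G a l b →
    ∃ p : G.Walk a b, p.support = a :: (l ++ [b]) := by
  induction l with
  | nil =>
    intro a h
    exact ⟨Walk.cons (lk_nil.1 h) Walk.nil, by simp⟩
  | cons d l ih =>
    intro a h
    obtain ⟨h1, h2⟩ := lk_cons.1 h
    obtain ⟨p, hp⟩ := ih d h2
    exact ⟨Walk.cons h1 p, by simp [hp]⟩

theorem nolong_of {V : Type*} [Fintype V] {G : SimpleGraph V} {c : ℕ} (hc : 2 ≤ c)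
    (h : circ G = c) : NoLong G c := by
  intro a l b hl hn hba
  cases l with
  | nil => simpa using hc
  | cons d l =>
    obtain ⟨h1, h2⟩ := lk_cons.1 hl
    obtain ⟨q, hq⟩ := link_walk l d h2
    have hcyc : (Walk.cons hba (Walk.cons h1 q)).IsCycle := by
      rw [Walk.cons_isCycle_iff]
      constructor
      · rw [Walk.isPath_def, Walk.support_cons, hq]
        exact hn
      · rw [Walk.edges_cons, List.mem_cons]
        rw [List.cons_append, List.nodup_cons, List.nodup_cons] at hn
        rintro (h | h)
        · rw [Sym2.eq_iff] at h
          rcases h with ⟨rfl, -⟩ | ⟨rfl, -⟩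
          · exact hn.1 (by simp)
          · exact hn.2.1 (by simp)
        · have := Walk.snd_mem_support_of_mem_edges _ h
          rw [hq] at this
          exact hn.1 this
    have hlen : (Walk.cons hba (Walk.cons h1 q)).length = (d :: l).length + 2 := by
      have := q.length_support
      rw [hq] at this
      simp at this ⊢
      omega
    rw [← hlen, ← h]
    apply le_csSup
    · refine ⟨Fintype.card V, ?_⟩
      rintro m ⟨v, w, hw, rfl⟩
      have h3 := hw.support_nodup.length_le_card
      have := w.length_support
      simp at h3
      omega
    · exact ⟨b, _, hcyc, rfl⟩

theorem cliques_eq {V : Type*} [Fintype V] (G : SimpleGraph V) (s : ℕ) :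
    cliquesN G s = nc G s univ := by
  classical
  unfold cliquesN nc
  apply Nat.subtype_card
  intro S
  simp [isNClique_iff, and_comm]

theorem degN_eq {V : Type*} [Fintype V] (G : SimpleGraph V) (v : V) :
    degN G v = dg G univ v := by
  classical
  unfold degN dg
  apply Nat.subtype_card
  intro S
  simp

theorem convex_max (φ : ℕ → ℕ) (k t : ℕ)
    (h : ∀ a, k ≤ a → a + 2 ≤ t → φ (a + 1) + φ (a + 1) ≤ φ a + φ (a + 2)) (a : ℕ) (hk : k ≤ a)
    (ht : a ≤ t) : φ a ≤ max (φ k) (φ t) := by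
  have mono : ∀ b, k ≤ b → φ b ≤ φ (b + 1) → ∀ j, b + j + 1 ≤ t →
      φ b ≤ φ (b + j + 1) ∧ φ (b + j) ≤ φ (b + j + 1) := by
    intro b hb hb1 j
    induction j with
    | zero => intro _; exact ⟨hb1, hb1⟩
    | succ j ih =>
      intro hj
      have h1 := ih (by omega)
      have h2 := h (b + j) (by omega) (by omega)
      have e : b + (j + 1) + 1 = b + j + 2 := by ring
      rw [e, show b + (j + 1) = b + j + 1 by ring]
      omega
  have key : ∀ j, k + j ≤ t → φ (k + j) ≤ φ k ∨ (1 ≤ j ∧ φ (k + j - 1) ≤ φ (k + j)) := by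
    intro j
    induction j with
    | zero => intro _; left; simp
    | succ j ih =>
      intro hj
      have e1 : k + (j + 1) - 1 = k + j := by omega
      rw [e1, ← add_assoc]
      rcases ih (by omega) with h1 | ⟨h1, h2⟩
      · by_cases h3 : φ (k + j) ≤ φ (k + j + 1)
        · right; exact ⟨by omega, h3⟩
        · left; omega
      · right
        have h4 := h (k + j - 1) (by omega) (by omega)
        rw [show k + j - 1 + 1 = k + j by omega, show k + j - 1 + 2 = k + j + 1 by omega] at h4
        exact ⟨by omega, by omega⟩
  obtain ⟨j, rfl⟩ := Nat.exists_eq_add_of_le hk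
  rcases key j ht with h1 | ⟨h1, h2⟩
  · exact le_max_of_le_left h1
  · apply le_max_of_le_right
    rcases Nat.eq_or_lt_of_le ht with h3 | h3
    · rw [h3]
    · have h4 := (mono (k + j - 1) (by omega) (by rw [show k + j - 1 + 1 = k + j by omega]; exact h2)
        (t - (k + j)) (by omega)).1
      have h4' := (mono (k + j - 1) (by omega) (by rw [show k + j - 1 + 1 = k + j by omega]; exact h2)
        1 (by omega)).2
      rw [show k + j - 1 + 1 = k + j by omega] at h4'
      have h5 := (mono (k + j) (by omega) h4' (t - (k + j) - 1) (by omega)).1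
      rw [show k + j + (t - (k + j) - 1) + 1 = t by omega] at h5
      exact h5

/-- the interpolating function -/
def hh (n c k s a : ℕ) : ℕ :=
  Nat.choose (c + 1 - a) s + (n + a - c - 2) * Nat.choose a (s - 1) + Nat.choose k (s - 1)

theorem hh_le (n c k s a : ℕ) (h1 : c + 1 ≤ n) (h3 : 2 ≤ k) (h4 : 2 ≤ s)
    (hk : k ≤ a) (ha : a ≤ c / 2) :
    hh n c k s a ≤ max (fCliques n c k s) (gCliques n c k s) := by
  have e1 : hh n c k s k = fCliques n c k s := by
    unfold hh fCliques
    rw [show n + k - c - 1 = n + k - c - 2 + 1 by omega, add_mul]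
    ring
  have e2 : hh n c k s (c / 2) = gCliques n c k s := by
    unfold hh gCliques
    rfl
  rw [← e1, ← e2]
  apply convex_max (hh n c k s) k (c / 2) _ a hk ha
  intro a hka hat
  obtain ⟨r, rfl⟩ := Nat.exists_eq_add_of_le' h4
  unfold hh
  obtain ⟨e, he⟩ : ∃ e, n + a - c - 2 = e := ⟨_, rfl⟩
  obtain ⟨b, hb⟩ : ∃ b, c + 1 - (a + 2) = b := ⟨_, rfl⟩
  rw [show n + (a + 1) - c - 2 = e + 1 by omega, show n + (a + 2) - c - 2 = e + 2 by omega, he, hb,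
    show c + 1 - (a + 1) = b + 1 by omega, show c + 1 - a = b + 2 by omega,
    show r + 2 - 1 = r + 1 by omega, Nat.choose_succ_succ (b + 1) (r + 1),
    Nat.choose_succ_succ b (r + 1), Nat.choose_succ_succ (a + 1) r, Nat.choose_succ_succ a r]
  have m1 : b.choose (r + 1) ≤ (b + 1).choose (r + 1) := Nat.choose_le_choose _ (by omega)
  have m2 : a.choose r ≤ (a + 1).choose r := Nat.choose_le_choose _ (by omega)
  have m3 := Nat.mul_le_mul_left (e + 2) m2
  simp only [Nat.succ_eq_add_one]
  nlinarith

end Kop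
end

section
namespace Kop
open Finset

theorem dg_ge {V : Type*} (G : SimpleGraph V) (H : Finset V) (x : V)
    (h : ∀ y ∈ H, x ≠ y → G.Adj x y) : #H - 1 ≤ dg G H x := by
  classical
  unfold dg
  refine le_trans (pred_card_le_card_erase (a := x)) (card_le_card ?_)
  intro y hy
  rw [mem_erase] at hy
  exact mem_filter.2 ⟨hy.2, h y hy.2 hy.1.symm⟩

theorem complete_long {V : Type*} [Fintype V] {G : SimpleGraph V} {c : ℕ} (hc : 2 ≤ c)
    (hN : NoLong G c) (hcard : c + 1 ≤ Fintype.card V) (h : ∀ x y : V, x ≠ y → G.Adj x y) :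
    False := by
  classical
  obtain ⟨L, hL, hl⟩ : ∃ L : List V, L.Nodup ∧ L.length = Fintype.card V :=
    ⟨univ.toList, univ.nodup_toList, by simp⟩
  cases L with
  | nil => simp at hl; omega
  | cons a L =>
    rcases List.eq_nil_or_concat' L with rfl | ⟨I, b, rfl⟩
    · simp at hl; omega
    · have := hN a I b ((List.nodup_iff_pairwise_ne.1 hL).isChain.imp (fun x y hxy => h x y hxy)) hL
        (h b a (by rintro rfl; simp at hL))
      simp at hl
      omega

theorem clique_bound {V : Type*} [Fintype V] (G : SimpleGraph V) (n c k s : ℕ) (h1 : c + 1 ≤ n)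
    (h2 : 2 * k ≤ c) (h3 : 2 ≤ k) (h4 : 2 ≤ s) (hV : Fintype.card V = n) (hC : Conn2 G)
    (hN : NoLong G c) (hmin : ∀ v, k ≤ dg G univ v) (v : V) (hv : dg G univ v = k) :
    nc G s univ ≤ max (fCliques n c k s) (gCliques n c k s) := by
  classical
  obtain ⟨G', hle, hN', hS', hF⟩ := saturate G (c := c) (by omega) hN {v}
  have hC' := hC.mono hle
  have hdv : dg G' univ v = k := by
    rw [← hv]
    unfold dg
    congr 1
    ext w
    simp [hF v rfl w]
  refine (nc_mono hle s univ).trans ((nc_remove G' s univ v).trans ?_)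
  rw [hdv]
  set W := (univ : Finset V).erase v with hW
  have hWc : #W = n - 1 := by rw [hW, card_erase_of_mem (mem_univ v), card_univ, hV]
  have hWv : ∀ U ⊆ W, ∀ x ∈ U, x ∉ ({v} : Set V) := by
    intro U hU x hx hxv
    have := hU hx
    rw [hW, mem_erase] at this
    exact this.1 hxv
  obtain ⟨t, ht⟩ : ∃ t, t = c / 2 := ⟨_, rfl⟩
  -- reduction to a degeneracy statement
  have fin : ∀ a, k ≤ a → a ≤ t → c + 1 - a ≤ n - 1 →
      (∀ U ⊆ W, c + 1 - a < #U → ∃ x ∈ U, dg G' U x ≤ a) →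
      nc G' s W + k.choose (s - 1) ≤ max (fCliques n c k s) (gCliques n c k s) := by
    intro a hka hat hcn hU
    refine le_trans ?_ (hh_le n c k s a h1 h3 h4 hka (by omega))
    have := deg2 G' s (c + 1 - a) a (n + a - c - 2) W (by omega) hU
    unfold hh
    omega
  by_cases hcase : ∀ U ⊆ W, c + 1 - t < #U → ∃ x ∈ U, dg G' U x ≤ t
  · exact fin t (by omega) le_rfl (by omega) hcase
  push Not at hcase
  obtain ⟨U0, hU0, hU0c, hU0d⟩ := hcase
  obtain ⟨H, hHm, hHmax⟩ := exists_max_image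
    (W.powerset.filter (fun U => c + 1 - t < #U ∧ ∀ x ∈ U, t < dg G' U x)) card
    ⟨U0, mem_filter.2 ⟨mem_powerset.2 hU0, hU0c, hU0d⟩⟩
  rw [mem_filter, mem_powerset] at hHm
  obtain ⟨hHW, hHc, hHd⟩ := hHm
  have hcl := lemmaK hC' hN' hS' H H (hWv H hHW) (hWv H hHW) (t + 1) (t + 1) hHd hHd (by omega)
  have hHd' : ∀ y ∈ H, #H - 1 ≤ dg G' H y := fun y hy => dg_ge G' H y (hcl y hy)
  have hHn : #H ≤ n - 1 := by rw [← hWc]; exact card_le_card hHW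
  by_cases hr : c + 2 - k ≤ #H
  · exfalso
    obtain ⟨K, hle2, hN2, hS2, -⟩ := saturate G' (c := c) (by omega) hN' ∅
    have hC2 := hC'.mono hle2
    have dmono : ∀ {A B : SimpleGraph V} (_ : A ≤ B) (U : Finset V) (x : V),
        dg A U x ≤ dg B U x := by
      intro A B hAB U x
      unfold dg
      apply card_le_card
      intro y hy
      rw [mem_filter] at hy ⊢
      exact ⟨hy.1, hAB hy.2⟩
    have a1 := lemmaK hC2 hN2 hS2 univ H (by simp) (by simp) k (#H - 1)
      (fun x _ => (hmin x).trans ((dmono hle _ _).trans (dmono hle2 _ _)))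
      (fun y hy => (hHd' y hy).trans (dmono hle2 _ _)) (by omega)
    have a2 : ∀ x ∈ (univ : Finset V), #H - 1 ≤ dg K univ x := fun x hx =>
      (dg_ge K H x (a1 x hx)).trans (dg_mono K (subset_univ _) x)
    have a3 := lemmaK hC2 hN2 hS2 univ univ (by simp) (by simp) (#H - 1) (#H - 1) a2 a2 (by omega)
    exact complete_long (by omega) hN2 (by omega)
      (fun x y => a3 x (mem_univ _) y (mem_univ _))
  · apply fin (c + 1 - #H) (by omega) (by omega) (by omega)
    rw [show c + 1 - (c + 1 - #H) = #H by omega]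
    by_contra hbad
    push Not at hbad
    obtain ⟨U, hUW, hUc, hUd⟩ := hbad
    have hUH : U ∪ H ⊆ W := union_subset hUW hHW
    have b1 := lemmaK hC' hN' hS' (U ∪ H) H (hWv _ hUH) (hWv _ hHW) (c + 1 - #H + 1) (#H - 1)
      (by
        intro x hx
        rcases mem_union.1 hx with h | h
        · exact (hUd x h).trans_le (dg_mono G' subset_union_left x)
        · have := hHd' x h
          have := dg_mono G' (subset_union_right (s₁ := U) (s₂ := H)) x
          omega) hHd' (by omega)
    obtain ⟨x, hx, hxH⟩ : ∃ x ∈ U, x ∉ H := by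
      by_contra hcon
      push Not at hcon
      have := card_le_card (show U ⊆ H from hcon)
      omega
    have hins : ∀ y ∈ insert x H, ∀ z ∈ insert x H, y ≠ z → G'.Adj y z := by
      intro y hy z hz hyz
      rcases mem_insert.1 hy with rfl | hy'
      · rcases mem_insert.1 hz with rfl | hz'
        · exact absurd rfl hyz
        · exact b1 y (mem_union_left _ hx) z hz' hyz
      · rcases mem_insert.1 hz with rfl | hz'
        · exact (b1 z (mem_union_left _ hx) y hy' hyz.symm).symm
        · exact hcl y hy' z hz' hyz
    have := hHmax (insert x H) (by
      rw [mem_filter, mem_powerset, card_insert_of_notMem hxH]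
      refine ⟨insert_subset (hUW hx) hHW, by omega, ?_⟩
      intro y hy
      have := dg_ge G' (insert x H) y (hins y hy)
      rw [card_insert_of_notMem hxH] at this
      omega)
    rw [card_insert_of_notMem hxH] at this
    omega

end Kop

end

theorem stmt0 (n c k s : ℕ) (h1 : c ≤ n - 1) (h2 : 2 * k ≤ c) (h3 : 2 ≤ k) (h4 : 2 ≤ s)
    (V : Type) (G : SimpleGraph V) (hV : Nat.card V = n)
    (hconn : TwoConnected G) (hcirc : circ G = c) (hdeg : MinDegreeEq G k) :
    cliquesN G s ≤ max (fCliques n c k s) (gCliques n c k s) := by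
  have hfin : Finite V := Nat.finite_of_card_ne_zero (by omega)
  have : Fintype V := Fintype.ofFinite V
  rw [Kop.cliques_eq]
  obtain ⟨v, hv⟩ := hdeg.2
  exact Kop.clique_bound G n c k s (by omega) h2 h3 h4 (by rw [← hV, Nat.card_eq_fintype_card])
    (Kop.conn2_of hconn) (Kop.nolong_of (by omega) hcirc)
    (fun u => by rw [← Kop.degN_eq]; exact hdeg.1 u) v (by rw [← Kop.degN_eq]; exact hv)
end

section
/- Let n, c, k, s be integers with n-1 ≥ c ≥ 2k ≥ 4 and s ≥ 2. The graph F(n,c,k) is 2-connected, has order n, minimum degree exactly k, circumference exactly c (in particular it is nonhamiltonian), and its number of cliques of cardinality s equals f_s(n,c,k) = C(c+1-k, s) + (n-c-1+k)·C(k, s-1). -/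
open SimpleGraph

lemma fg_adj {n c k : ℕ} (x y : Fin n) : (Fgraph n c k).Adj x y ↔
    x ≠ y ∧ (x.val < k ∨ y.val < k ∨ (x.val ≤ c - k ∧ y.val ≤ c - k)) := Iff.rfl

lemma fg_two_connected (n c k : ℕ) (h1 : c ≤ n - 1) (h2 : 2 * k ≤ c) (h3 : 2 ≤ k) :
    TwoConnected (Fgraph n c k) := by
  refine ⟨by simp; omega, fun v => ?_⟩
  obtain ⟨a, hav, hak⟩ : ∃ a : Fin n, a ≠ v ∧ a.val < k := by
    by_cases hv : v.val = 0
    · exact ⟨⟨1, by omega⟩, by intro h; rw [← h] at hv; simp at hv, by simp; omega⟩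
    · exact ⟨⟨0, by omega⟩, by intro h; rw [← h] at hv; simp at hv, by simp; omega⟩
  rw [connected_iff_exists_forall_reachable]
  refine ⟨⟨a, hav⟩, fun w => ?_⟩
  by_cases hw : (⟨a, hav⟩ : {u | u ≠ v}) = w
  · rw [hw]
  · apply Adj.reachable
    rw [comap_adj, fg_adj]
    refine ⟨fun h => hw (Subtype.ext h), Or.inl hak⟩

lemma fg_min_degree (n c k : ℕ) (h1 : c ≤ n - 1) (h2 : 2 * k ≤ c) (h3 : 2 ≤ k) :
    MinDegreeEq (Fgraph n c k) k := by
  have hc : ∀ j, j ≤ n → (Finset.univ.filter (fun x : Fin n => x.val < j)).card = j := by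
    intro j hj
    rw [Fin.card_filter_val_lt]; omega
  constructor
  · intro v
    rw [degN, Nat.card_coe_set_eq]
    by_cases hv : v.val < k
    · have hs : (((Finset.univ.filter (fun x : Fin n => x.val < k + 1)).erase v : Finset (Fin n)) :
          Set (Fin n)) ⊆ (Fgraph n c k).neighborSet v := by
        intro x hx
        simp at hx
        rw [mem_neighborSet, fg_adj]
        exact ⟨fun h => hx.2 h.symm, Or.inl hv⟩
      have := Set.ncard_le_ncard hs (Set.toFinite _)
      rw [Set.ncard_coe_finset, Finset.card_erase_of_mem (by simp; omega), hc _ (by omega)] at this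
      omega
    · have hs : (((Finset.univ.filter (fun x : Fin n => x.val < k)) : Finset (Fin n)) :
          Set (Fin n)) ⊆ (Fgraph n c k).neighborSet v := by
        intro x hx
        simp at hx
        rw [mem_neighborSet, fg_adj]
        exact ⟨fun h => hv (h ▸ hx), Or.inr (Or.inl hx)⟩
      have := Set.ncard_le_ncard hs (Set.toFinite _)
      rw [Set.ncard_coe_finset, hc _ (by omega)] at this
      omega
  · refine ⟨⟨n - 1, by omega⟩, ?_⟩
    rw [degN, Nat.card_coe_set_eq]
    have : (Fgraph n c k).neighborSet ⟨n - 1, by omega⟩ =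
        (((Finset.univ.filter (fun x : Fin n => x.val < k)) : Finset (Fin n)) : Set (Fin n)) := by
      ext x
      rw [mem_neighborSet, fg_adj]
      simp [Fin.ext_iff]
      omega
    rw [this, Set.ncard_coe_finset, hc _ (by omega)]

open Fin.NatCast Fin.CommRing in
lemma fg_upper_aux (n c k l : ℕ) (h2 : 2 * k ≤ c) (h3 : 2 ≤ k)
    (f : Fin (l + 2) → Fin n) (hf : Function.Injective f)
    (hadj : ∀ i, (Fgraph n c k).Adj (f i) (f (i + 1))) : l + 2 ≤ c := by
  classical
  set PI := Finset.univ.filter (fun i => c - k < (f i).val) with hPI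
  set PM := Finset.univ.filter (fun i => ¬ (c - k < (f i).val)) with hPM
  set PA := Finset.univ.filter (fun i => (f i).val < k) with hPA
  have hsum : PI.card + PM.card = l + 2 := by
    rw [hPI, hPM, Finset.card_filter_add_card_filter_not]; simp
  have hA : PA.card ≤ k := by
    have := Finset.card_le_card_of_injOn (s := PA) (t := Finset.range k) (fun i => (f i).val)
      (by intro i hi; simpa [hPA] using hi)
      (by intro i _ j _ h; exact hf (Fin.ext h))
    simpa using this
  have hM : PM.card ≤ c - k + 1 := by
    have := Finset.card_le_card_of_injOn (s := PM) (t := Finset.range (c - k + 1))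
      (fun i => (f i).val)
      (by intro i hi; simp [hPM] at hi; simp; omega)
      (by intro i _ j _ h; exact hf (Fin.ext h))
    simpa using this
  have i1 : PI.image (· + 1) ⊆ PA := by
    intro x hx
    simp only [Finset.mem_image, hPI, Finset.mem_filter, Finset.mem_univ, true_and] at hx
    obtain ⟨i, hi, rfl⟩ := hx
    simp only [hPA, Finset.mem_filter, Finset.mem_univ, true_and]
    have := (hadj i).2
    omega
  have i2 : PI.image (· - 1) ⊆ PA := by
    intro x hx
    simp only [Finset.mem_image, hPI, Finset.mem_filter, Finset.mem_univ, true_and] at hx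
    obtain ⟨i, hi, rfl⟩ := hx
    simp only [hPA, Finset.mem_filter, Finset.mem_univ, true_and]
    have := (hadj (i - 1)).2
    rw [sub_add_cancel] at this
    omega
  have c1 : (PI.image (· + 1)).card = PI.card :=
    Finset.card_image_of_injective _ (add_left_injective 1)
  have c2 : (PI.image (· - 1)).card = PI.card :=
    Finset.card_image_of_injective _ (sub_left_injective)
  have hle := Finset.card_le_card i1
  by_cases hlt : PI.card ≤ k - 1
  · omega
  have e2 := Finset.eq_of_subset_of_card_le i2 (by omega)
  have hcl : ∀ x ∈ PI ∪ PA, x + 1 ∈ PI ∪ PA := by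
    intro x hx
    rw [Finset.mem_union] at hx ⊢
    rcases hx with hx | hx
    · exact Or.inr (i1 (Finset.mem_image_of_mem _ hx))
    · rw [← e2, Finset.mem_image] at hx
      obtain ⟨i, hi, rfl⟩ := hx
      left
      simpa using hi
  obtain ⟨a, ha⟩ : PI.Nonempty := by
    rw [← Finset.card_pos]; omega
  have hall : ∀ j : ℕ, a + (j : Fin (l + 2)) ∈ PI ∪ PA := by
    intro j
    induction j with
    | zero => simpa using Or.inl ha
    | succ j ih =>
      have := hcl _ ih
      rwa [add_assoc, ← Nat.cast_succ] at this
  have huniv : PI ∪ PA = Finset.univ := by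
    ext x
    have := hall (x - a).val
    rw [Fin.cast_val_eq_self, add_sub_cancel] at this
    simpa using this
  have h5 := Finset.card_union_le PI PA
  rw [huniv] at h5
  simp at h5
  omega

lemma fg_upper (n c k : ℕ) (h2 : 2 * k ≤ c) (h3 : 2 ≤ k) (v : Fin n)
    (w : (Fgraph n c k).Walk v v) (hw : w.IsCycle) : w.length ≤ c := by
  have h := hw.three_le_length
  obtain ⟨f⟩ := (cycleGraph_isContained_iff (G := Fgraph n c k) (n := w.length)
    (by omega)).2 ⟨v, w, hw, rfl⟩
  generalize w.length = L at h f
  obtain ⟨l, rfl⟩ : ∃ l, L = l + 2 := ⟨L - 2, by omega⟩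
  refine fg_upper_aux n c k l h2 h3 f f.injective fun i => ?_
  apply f.toHom.map_adj
  rw [cycleGraph_adj]
  right; simp

lemma fg_lower (n c k : ℕ) (h1 : c ≤ n - 1) (h2 : 2 * k ≤ c) (h3 : 2 ≤ k) :
    ∃ (v : Fin n) (w : (Fgraph n c k).Walk v v), w.IsCycle ∧ w.length = c := by
  rw [← cycleGraph_isContained_iff (by omega)]
  obtain ⟨l, rfl⟩ : ∃ l, c = l + 2 := ⟨c - 2, by omega⟩
  let g : ℕ → ℕ := fun j => if j < 2 * k - 1 then
    (if j % 2 = 0 then j / 2 else l + 2 - k + 1 + j / 2) else j - (k - 1)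
  have hg : ∀ j, g j = if j < 2 * k - 1 then
    (if j % 2 = 0 then j / 2 else l + 2 - k + 1 + j / 2) else j - (k - 1) := fun _ => rfl
  have hlt : ∀ j, j < l + 2 → g j < n := by
    intro j hj; rw [hg]; split_ifs <;> omega
  have hinj : ∀ i j, i < l + 2 → j < l + 2 → g i = g j → i = j := by
    intro i j hi hj h; rw [hg, hg] at h; split_ifs at h <;> omega
  have key : ∀ i : Fin (l + 2), (Fgraph n (l + 2) k).Adj ⟨g i, hlt i i.2⟩
      ⟨g (i + 1 : Fin (l + 2)), hlt _ (i + 1).2⟩ := by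
    intro i
    rw [fg_adj]
    have hi := i.2
    have hv : (i + 1).val = if i.val = l + 1 then 0 else i.val + 1 := by
      rw [Fin.val_add_one]
      simp [Fin.ext_iff]
    constructor
    · intro h
      have := hinj _ _ i.2 (i + 1).2 (Fin.mk.inj h)
      rw [hv] at this
      split_ifs at this <;> omega
    · simp only
      rw [hv]
      split_ifs with h
      · rw [h]; right; left; rw [hg]; split_ifs <;> omega
      · rw [hg, hg]; split_ifs <;> omega
  refine ⟨⟨⟨fun i => ⟨g i, hlt i i.2⟩, ?_⟩, ?_⟩⟩
  · intro a b hab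
    rw [cycleGraph_adj] at hab
    rcases hab with h | h
    · have : a = b + 1 := by rw [← h]; simp
      rw [this]; exact (key b).symm
    · have : b = a + 1 := by rw [← h]; simp
      rw [this]; exact key a
  · intro a b h
    exact Fin.ext (hinj _ _ a.2 b.2 (Fin.mk.inj h))

lemma fg_circ (n c k : ℕ) (h1 : c ≤ n - 1) (h2 : 2 * k ≤ c) (h3 : 2 ≤ k) :
    circ (Fgraph n c k) = c := by
  apply IsGreatest.csSup_eq
  refine ⟨fg_lower n c k h1 h2 h3, ?_⟩
  rintro _ ⟨v, w, hw, rfl⟩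
  exact fg_upper n c k h2 h3 v w hw

lemma fg_not_ham (n c k : ℕ) (h1 : c ≤ n - 1) (h2 : 2 * k ≤ c) (h3 : 2 ≤ k) :
    ¬ IsHamiltonianGr (Fgraph n c k) := by
  rintro ⟨v, w, hw, hall⟩
  have hle := fg_upper n c k h2 h3 v w hw
  have h : (Finset.univ : Finset (Fin n)) ⊆ w.support.tail.toFinset := by
    intro u _
    rw [List.mem_toFinset]
    have := hall u
    rw [← w.cons_tail_support, List.mem_cons] at this
    rcases this with rfl | h
    · exact Walk.end_mem_tail_support hw.not_nil
    · exact h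
  have h5 := Finset.card_le_card h
  have h6 := List.toFinset_card_le w.support.tail
  simp at h5 h6
  omega

lemma fg_cliques (n c k s : ℕ) (h1 : c ≤ n - 1) (h2 : 2 * k ≤ c) (h3 : 2 ≤ k) (h4 : 2 ≤ s) :
    cliquesN (Fgraph n c k) s = fCliques n c k s := by
  classical
  set M := Finset.univ.filter (fun x : Fin n => x.val < c + 1 - k) with hM
  set A := Finset.univ.filter (fun x : Fin n => x.val < k) with hA
  set I := Finset.univ.filter (fun x : Fin n => ¬ (x.val < c + 1 - k)) with hI
  have cM : M.card = c + 1 - k := by rw [hM, Fin.card_filter_val_lt]; omega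
  have cA : A.card = k := by rw [hA, Fin.card_filter_val_lt]; omega
  have cI : I.card = n + k - c - 1 := by
    have : M.card + I.card = n := by
      rw [hI, hM, Finset.card_filter_add_card_filter_not]; simp
    omega
  have mM : ∀ x, x ∈ M ↔ x.val < c + 1 - k := by simp [hM]
  have mA : ∀ x, x ∈ A ↔ x.val < k := by simp [hA]
  have mI : ∀ x, x ∈ I ↔ ¬ (x.val < c + 1 - k) := by simp [hI]
  clear_value M A I
  set J := (I ×ˢ A.powersetCard (s - 1)).image (fun p => insert p.1 p.2) with hJ
  have cJ : J.card = I.card * (A.powersetCard (s - 1)).card := by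
    rw [hJ, Finset.card_image_of_injOn, Finset.card_product]
    rintro ⟨x, T⟩ hx ⟨y, U⟩ hy h
    simp only [Finset.coe_product, Set.mem_prod, Finset.mem_coe, Finset.mem_powersetCard] at hx hy
    simp only at h
    have hIA : ∀ z ∈ I, z ∉ A := by
      intro z hz hz'
      rw [mI] at hz; rw [mA] at hz'; omega
    have hxy : x = y := by
      have : x ∈ insert y U := h ▸ Finset.mem_insert_self _ _
      rw [Finset.mem_insert] at this
      rcases this with h | h
      · exact h
      · exact absurd (hy.2.1 h) (hIA _ hx.1)
    subst hxy
    have hT : x ∉ T := fun h => hIA _ hx.1 (hx.2.1 h)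
    have hU : x ∉ U := fun h => hIA _ hx.1 (hy.2.1 h)
    have := congrArg (fun S => Finset.erase S x) h
    simp only [Finset.erase_insert hT, Finset.erase_insert hU] at this
    rw [this]
  have hdisj : Disjoint (M.powersetCard s) J := by
    rw [Finset.disjoint_left]
    intro S hS hS'
    rw [Finset.mem_powersetCard] at hS
    rw [hJ, Finset.mem_image] at hS'
    obtain ⟨⟨x, T⟩, hx, rfl⟩ := hS'
    rw [Finset.mem_product] at hx
    have h5 := hS.1 (Finset.mem_insert_self x T)
    have h6 := hx.1
    rw [mM] at h5
    rw [mI] at h6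
    exact h6 h5
  have hset : ∀ S : Finset (Fin n), (Fgraph n c k).IsNClique s S ↔ S ∈ M.powersetCard s ∪ J := by
    intro S
    rw [isNClique_iff, Finset.mem_union, Finset.mem_powersetCard, hJ, Finset.mem_image]
    constructor
    · rintro ⟨hcl, hcard⟩
      by_cases hSM : S ⊆ M
      · exact Or.inl ⟨hSM, hcard⟩
      · right
        obtain ⟨x, hxS, hxM⟩ := Finset.not_subset.1 hSM
        refine ⟨(x, S.erase x), ?_, Finset.insert_erase hxS⟩
        rw [Finset.mem_product, Finset.mem_powersetCard, Finset.card_erase_of_mem hxS, hcard]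
        rw [mM] at hxM
        refine ⟨(mI _).2 hxM, ?_, rfl⟩
        intro y hy
        rw [Finset.mem_erase] at hy
        have := (hcl hxS hy.2 hy.1.symm).2
        rw [mA]
        omega
    · rintro (⟨hS, hcard⟩ | ⟨⟨x, T⟩, hx, rfl⟩)
      · refine ⟨?_, hcard⟩
        intro a ha b hb hab
        have h5 := (mM _).1 (hS ha)
        have h6 := (mM _).1 (hS hb)
        exact ⟨hab, by omega⟩
      · rw [Finset.mem_product, Finset.mem_powersetCard] at hx
        obtain ⟨hxI, hTA, hTc⟩ := hx
        simp only at hxI hTA hTc ⊢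
        rw [mI] at hxI
        have hxT : x ∉ T := fun h => by
          have := (mA _).1 (hTA h); omega
        refine ⟨?_, by rw [Finset.card_insert_of_notMem hxT, hTc]; omega⟩
        intro a ha b hb hab
        rw [Finset.mem_coe, Finset.mem_insert] at ha hb
        refine ⟨hab, ?_⟩
        rcases ha with rfl | ha
        · rcases hb with rfl | hb
          · exact absurd rfl hab
          · exact Or.inr (Or.inl ((mA _).1 (hTA hb)))
        · exact Or.inl ((mA _).1 (hTA ha))
  rw [cliquesN, Nat.card_congr (Equiv.subtypeEquivRight hset), Nat.card_eq_fintype_card,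
    Fintype.card_coe, Finset.card_union_of_disjoint hdisj, cJ, Finset.card_powersetCard,
    Finset.card_powersetCard, cM, cA, cI, fCliques]

theorem stmt1 (n c k s : ℕ) (h1 : c ≤ n - 1) (h2 : 2 * k ≤ c) (h3 : 2 ≤ k) (h4 : 2 ≤ s) :
    TwoConnected (Fgraph n c k) ∧ Nat.card (Fin n) = n ∧
    MinDegreeEq (Fgraph n c k) k ∧ circ (Fgraph n c k) = c ∧
    ¬ IsHamiltonianGr (Fgraph n c k) ∧ cliquesN (Fgraph n c k) s = fCliques n c k s := by
  exact ⟨fg_two_connected n c k h1 h2 h3, by simp, fg_min_degree n c k h1 h2 h3,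
    fg_circ n c k h1 h2 h3, fg_not_ham n c k h1 h2 h3, fg_cliques n c k s h1 h2 h3 h4⟩
end

section
/- Let n, c, k, s be integers with n-1 ≥ c ≥ 2k ≥ 4 and s ≥ 2, and set t = ⌊c/2⌋. The graph G(n,c,k) is 2-connected, has order n, minimum degree exactly k, circumference exactly c (in particular it is nonhamiltonian), and its number of cliques of cardinality s equals g_s(n,c,k) = C(c+1-t, s) + (n-c-2+t)·C(t, s-1) + C(k, s-1). -/
open SimpleGraph

lemma Ggraph_adj (n c k : ℕ) (x y : Fin n) : (Ggraph n c k).Adj x y ↔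
    (x ≠ y ∧ (x.val < c / 2 ∨ y.val < c / 2 ∨ (x.val ≤ c - c / 2 ∧ y.val ≤ c - c / 2))) ∧
    ¬ (x.val = n - 1 ∧ k ≤ y.val ∧ y.val < c / 2) ∧
    ¬ (y.val = n - 1 ∧ k ≤ x.val ∧ x.val < c / 2) := by
  unfold Ggraph
  rw [deleteEdges_adj]
  apply and_congr Iff.rfl
  constructor
  · intro h
    exact ⟨fun h' => h ⟨x, y, rfl, h'⟩, fun h' => h ⟨y, x, Sym2.eq_swap, h'⟩⟩
  · rintro ⟨ha, hb⟩ ⟨a, b, hab, h'⟩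
    rcases Sym2.eq_iff.mp hab with ⟨rfl, rfl⟩ | ⟨rfl, rfl⟩
    · exact ha h'
    · exact hb h'

/-- vertices below `k` dominate -/
lemma Ggraph_adj_dom (n c k : ℕ) (h1 : c ≤ n - 1) (h2 : 2 * k ≤ c) (h3 : 2 ≤ k)
    (x y : Fin n) (hx : x.val < k) (hxy : x ≠ y) : (Ggraph n c k).Adj x y := by
  rw [Ggraph_adj]
  refine ⟨⟨hxy, by omega⟩, by omega, by omega⟩

lemma two_conn (n c k : ℕ) (h1 : c ≤ n - 1) (h2 : 2 * k ≤ c) (h3 : 2 ≤ k) :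
    TwoConnected (Ggraph n c k) := by
  refine ⟨by simp; omega, fun v => ?_⟩
  obtain ⟨z, hz, hzv⟩ : ∃ z : Fin n, z.val < k ∧ z ≠ v := by
    by_cases hv : v.val = 0
    · exact ⟨⟨1, by omega⟩, by simp; omega, by intro h; rw [← h] at hv; simp at hv⟩
    · exact ⟨⟨0, by omega⟩, by simp; omega, by intro h; rw [← h] at hv; simp at hv⟩
  rw [connected_iff_exists_forall_reachable]
  refine ⟨⟨z, hzv⟩, fun w => ?_⟩
  by_cases hw : z = w.1
  · have : (⟨z, hzv⟩ : {u | u ≠ v}) = w := Subtype.ext hw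
    rw [this]
  · apply Adj.reachable
    exact Ggraph_adj_dom n c k h1 h2 h3 z w.1 hz hw

lemma card_lt (n m : ℕ) (h : m ≤ n) :
    (Finset.univ.filter (fun i : Fin n => i.val < m)).card = m := by
  rw [Fin.card_filter_val_lt]; omega

lemma min_deg (n c k : ℕ) (h1 : c ≤ n - 1) (h2 : 2 * k ≤ c) (h3 : 2 ≤ k) :
    MinDegreeEq (Ggraph n c k) k := by
  classical
  have key : ∀ v, degN (Ggraph n c k) v = ((Ggraph n c k).neighborFinset v).card := by
    intro v
    unfold degN
    rw [Nat.card_eq_fintype_card, card_neighborSet_eq_degree, card_neighborFinset_eq_degree]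
  refine ⟨fun v => ?_, ⟨n - 1, by omega⟩, ?_⟩
  · rw [key]
    by_cases hv : v.val < k
    · have hs : Finset.univ.erase v ⊆ (Ggraph n c k).neighborFinset v := by
        intro y hy
        rw [mem_neighborFinset]
        exact Ggraph_adj_dom n c k h1 h2 h3 v y hv (Finset.ne_of_mem_erase hy).symm
      have := Finset.card_le_card hs
      rw [Finset.card_erase_of_mem (Finset.mem_univ _)] at this
      simp only [Finset.card_univ, Fintype.card_fin] at this
      omega
    · have hs : Finset.univ.filter (fun i : Fin n => i.val < k) ⊆
          (Ggraph n c k).neighborFinset v := by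
        intro y hy
        rw [mem_neighborFinset]
        simp only [Finset.mem_filter, Finset.mem_univ, true_and] at hy
        exact (Ggraph_adj_dom n c k h1 h2 h3 y v hy (by rintro rfl; exact hv hy)).symm
      have := Finset.card_le_card hs
      rwa [card_lt n k (by omega)] at this
  · rw [key]
    refine Eq.trans (congrArg Finset.card ?_) (card_lt n k (by omega))
    ext y
    simp only [mem_neighborFinset, Finset.mem_filter, Finset.mem_univ, true_and, Ggraph_adj,
      ne_eq, Fin.ext_iff]
    omega

lemma exists_cycle (n c k : ℕ) (h1 : c ≤ n - 1) (h2 : 2 * k ≤ c) (h3 : 2 ≤ k) :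
    ∃ (v : Fin n) (w : (Ggraph n c k).Walk v v), w.IsCycle ∧ w.length = c := by
  rw [← cycleGraph_isContained_iff (by omega)]
  have cyc : ∀ u v : Fin c, (cycleGraph c).Adj u v → u ≠ v ∧ (u.val = v.val + 1 ∨
      v.val = u.val + 1 ∨ (u.val = 0 ∧ v.val = c - 1) ∨ (v.val = 0 ∧ u.val = c - 1)) := by
    intro u v h
    refine ⟨h.ne, ?_⟩
    have hu := u.2
    have hv := v.2
    rw [cycleGraph_adj'] at h
    rcases lt_trichotomy u v with hlt | heq | hlt
    · rw [Fin.coe_sub_iff_lt.mpr hlt, Fin.coe_sub_iff_le.mpr hlt.le] at h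
      have : u.val < v.val := hlt
      omega
    · subst heq
      simp at h
      rw [Fin.coe_sub_iff_le.mpr le_rfl] at h
      omega
    · rw [Fin.coe_sub_iff_lt.mpr hlt, Fin.coe_sub_iff_le.mpr hlt.le] at h
      have : v.val < u.val := hlt
      omega
  rcases Nat.even_or_odd' c with ⟨t, ht | ht⟩
  · let f : Fin c → Fin n := fun p =>
      ⟨if p.val % 2 = 0 then p.val / 2 else t + p.val / 2, by have := p.2; split_ifs <;> omega⟩
    have hf : Function.Injective f := by
      intro a b hab
      simp only [f, Fin.mk.injEq] at hab
      ext
      split_ifs at hab <;> omega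
    refine ⟨⟨⟨f, ?_⟩, hf⟩⟩
    intro a b hab
    obtain ⟨hne, h⟩ := cyc a b hab
    rw [Ggraph_adj]
    refine ⟨⟨hf.ne hne, ?_⟩, ?_, ?_⟩ <;> simp only [f] <;> split_ifs <;> omega
  · let f : Fin c → Fin n := fun p =>
      ⟨if p.val = 0 then t else if p.val % 2 = 0 then p.val / 2 - 1 else t + (p.val + 1) / 2,
        by have := p.2; split_ifs <;> omega⟩
    have hf : Function.Injective f := by
      intro a b hab
      simp only [f, Fin.mk.injEq] at hab
      ext
      split_ifs at hab <;> omega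
    refine ⟨⟨⟨f, ?_⟩, hf⟩⟩
    intro a b hab
    obtain ⟨hne, h⟩ := cyc a b hab
    rw [Ggraph_adj]
    refine ⟨⟨hf.ne hne, ?_⟩, ?_, ?_⟩ <;> simp only [f] <;> split_ifs <;> omega

lemma cycle_le (n c k : ℕ) (h1 : c ≤ n - 1) (h2 : 2 * k ≤ c) (h3 : 2 ≤ k)
    (v : Fin n) (w : (Ggraph n c k).Walk v v) (hw : w.IsCycle) : w.length ≤ c := by
  classical
  have hcard : w.edges.toFinset.card = w.length := by
    rw [List.toFinset_card_of_nodup hw.edges_nodup, Walk.length_edges]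
  let D : Finset (Fin n) := Finset.univ.filter (fun i => i.val < c / 2)
  have hD : D.card = c / 2 := card_lt n _ (by omega)
  let I : Fin n → Finset (Sym2 (Fin n)) := fun d => w.edges.toFinset.filter (fun e => d ∈ e)
  have hI : ∀ d, (I d).card ≤ 2 := by
    intro d
    have hsub : I d ⊆ (w.toSubgraph.neighborSet d).toFinset.image (fun y => s(d, y)) := by
      intro e he
      simp only [I, Finset.mem_filter, List.mem_toFinset] at he
      obtain ⟨he, hd⟩ := he
      obtain ⟨y, rfl⟩ := Sym2.mem_iff_exists.mp hd
      simp only [Finset.mem_image, Set.mem_toFinset]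
      exact ⟨y, Walk.adj_toSubgraph_iff_mem_edges.mpr he, rfl⟩
    by_cases hds : d ∈ w.support
    · calc (I d).card ≤ _ := Finset.card_le_card hsub
        _ ≤ _ := Finset.card_image_le
        _ = 2 := by
          rw [← Set.ncard_eq_toFinset_card', hw.ncard_neighborSet_toSubgraph_eq_two hds]
    · have : I d = ∅ := by
        apply Finset.eq_empty_of_forall_notMem
        intro e he
        simp only [I, Finset.mem_filter, List.mem_toFinset] at he
        obtain ⟨he, hd⟩ := he
        obtain ⟨y, rfl⟩ := Sym2.mem_iff_exists.mp hd
        exact hds (Walk.fst_mem_support_of_mem_edges _ he)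
      simp [this]
  let R : Finset (Sym2 (Fin n)) := if c % 2 = 0 then ∅ else
    {s(⟨c / 2, by omega⟩, ⟨c / 2 + 1, by omega⟩)}
  have hR : R.card ≤ c % 2 := by
    simp only [R]
    split_ifs
    · simp
    · simp; omega
  have hsub : w.edges.toFinset ⊆ D.biUnion I ∪ R := by
    intro e he
    rw [List.mem_toFinset] at he
    induction e using Sym2.ind with
    | _ x y =>
    have hadj := Walk.adj_of_mem_edges w he
    rw [Ggraph_adj] at hadj
    obtain ⟨⟨hne, hxy⟩, -⟩ := hadj
    rw [Finset.mem_union]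
    by_cases hx : x.val < c / 2
    · left
      rw [Finset.mem_biUnion]
      exact ⟨x, by simp [D, hx], by simp [I, he]⟩
    by_cases hy : y.val < c / 2
    · left
      rw [Finset.mem_biUnion]
      exact ⟨y, by simp [D, hy], by simp [I, he]⟩
    right
    have hne' : x.val ≠ y.val := fun h => hne (Fin.ext h)
    have hodd : ¬ c % 2 = 0 := by omega
    simp only [R, if_neg hodd, Finset.mem_singleton]
    rw [Sym2.eq_iff]
    simp only [Fin.ext_iff]
    omega
  have h5 := Finset.card_le_card hsub
  have h6 := Finset.card_union_le (D.biUnion I) R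
  have h7 : (D.biUnion I).card ≤ D.card * 2 := Finset.card_biUnion_le_card_mul _ _ _ (fun d _ => hI d)
  omega

lemma circ_eq (n c k : ℕ) (h1 : c ≤ n - 1) (h2 : 2 * k ≤ c) (h3 : 2 ≤ k) :
    circ (Ggraph n c k) = c := by
  apply IsGreatest.csSup_eq
  refine ⟨exists_cycle n c k h1 h2 h3, ?_⟩
  rintro m ⟨v, w, hw, rfl⟩
  exact cycle_le n c k h1 h2 h3 v w hw

lemma not_ham (n c k : ℕ) (h1 : c ≤ n - 1) (h2 : 2 * k ≤ c) (h3 : 2 ≤ k) :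
    ¬ IsHamiltonianGr (Ggraph n c k) := by
  classical
  rintro ⟨v, w, hw, hall⟩
  have hle := cycle_le n c k h1 h2 h3 v w hw
  have hsub : (Finset.univ : Finset (Fin n)) ⊆ w.support.tail.toFinset := by
    intro u _
    rw [List.mem_toFinset]
    by_cases huv : u = v
    · rw [huv]
      exact Walk.end_mem_tail_support hw.not_nil
    · have := hall u
      rw [Walk.mem_support_iff] at this
      tauto
  have h5 := Finset.card_le_card hsub
  have h6 := List.toFinset_card_le w.support.tail
  simp only [Finset.card_univ, Fintype.card_fin, List.length_tail, Walk.length_support] at h5 h6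
  omega

lemma cliques_eq (n c k s : ℕ) (h1 : c ≤ n - 1) (h2 : 2 * k ≤ c) (h3 : 2 ≤ k) (h4 : 2 ≤ s) :
    cliquesN (Ggraph n c k) s = gCliques n c k s := by
  classical
  let A : Finset (Fin n) := Finset.univ.filter (fun i => i.val < c + 1 - c / 2)
  let N : Fin n → Finset (Fin n) := fun v =>
    Finset.univ.filter (fun i => i.val < if v.val = n - 1 then k else c / 2)
  have hA : A.card = c + 1 - c / 2 := card_lt n _ (by omega)
  have hN : ∀ v, (N v).card = if v.val = n - 1 then k else c / 2 := by
    intro v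
    exact card_lt n _ (by split_ifs <;> omega)
  have memA : ∀ x, x ∈ A ↔ x.val ≤ c - c / 2 := by
    intro x; simp only [A, Finset.mem_filter, Finset.mem_univ, true_and]; omega
  have memN : ∀ v x, x ∈ N v ↔ x.val < if v.val = n - 1 then k else c / 2 := by
    intro v x; simp only [N, Finset.mem_filter, Finset.mem_univ, true_and]
  have NA : ∀ v, N v ⊆ A := by
    intro v x
    rw [memA, memN]
    split_ifs <;> omega
  have adjA : ∀ x ∈ A, ∀ y ∈ A, x ≠ y → (Ggraph n c k).Adj x y := by
    intro x hx y hy hxy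
    rw [memA] at hx hy
    rw [Ggraph_adj]
    exact ⟨⟨hxy, by omega⟩, by omega, by omega⟩
  have adjB : ∀ v ∉ A, ∀ y, (Ggraph n c k).Adj v y ↔ y ∈ N v := by
    intro v hv y
    rw [memA] at hv
    have := v.2
    rw [Ggraph_adj, memN, ne_eq, Fin.ext_iff]
    split_ifs <;> omega
  have main : (Finset.univ.filter (fun S : Finset (Fin n) => (Ggraph n c k).IsNClique s S)) =
      A.powersetCard s ∪ Aᶜ.biUnion (fun v => ((N v).powersetCard (s - 1)).image (insert v)) := by
    ext S
    simp only [Finset.mem_filter, Finset.mem_univ, true_and, Finset.mem_union,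
      Finset.mem_powersetCard, Finset.mem_biUnion, Finset.mem_image, Finset.mem_compl]
    rw [isNClique_iff]
    constructor
    · rintro ⟨hc, hs⟩
      by_cases hSA : S ⊆ A
      · exact Or.inl ⟨hSA, hs⟩
      · right
        obtain ⟨v, hvS, hvA⟩ := Finset.not_subset.mp hSA
        refine ⟨v, hvA, S.erase v, ⟨?_, ?_⟩, Finset.insert_erase hvS⟩
        · intro y hy
          rw [Finset.mem_erase] at hy
          rw [← adjB v hvA]
          exact hc hvS hy.2 hy.1.symm
        · rw [Finset.card_erase_of_mem hvS, hs]
    · rintro (⟨hSA, hs⟩ | ⟨v, hvA, T, ⟨hT, hTs⟩, rfl⟩)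
      · exact ⟨fun x hx y hy hxy => adjA x (hSA hx) y (hSA hy) hxy, hs⟩
      · refine ⟨?_, ?_⟩
        · rw [Finset.coe_insert, isClique_insert]
          refine ⟨fun x hx y hy hxy => adjA x (NA v (hT hx)) y (NA v (hT hy)) hxy, ?_⟩
          intro y hy _
          exact (adjB v hvA y).mpr (hT hy)
        · rw [Finset.card_insert_of_notMem (fun h => hvA (NA v (hT h))), hTs]
          omega
  have hdisj : Disjoint (A.powersetCard s)
      (Aᶜ.biUnion (fun v => ((N v).powersetCard (s - 1)).image (insert v))) := by
    rw [Finset.disjoint_left]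
    intro S hS hS'
    simp only [Finset.mem_powersetCard, Finset.mem_biUnion, Finset.mem_image,
      Finset.mem_compl] at hS hS'
    obtain ⟨v, hvA, T, -, rfl⟩ := hS'
    exact hvA (hS.1 (Finset.mem_insert_self _ _))
  have hpair : ∀ v ∈ Aᶜ, ∀ v' ∈ Aᶜ, v ≠ v' →
      Disjoint (((N v).powersetCard (s - 1)).image (insert v))
        (((N v').powersetCard (s - 1)).image (insert v')) := by
    intro v hv v' hv' hne
    rw [Finset.disjoint_left]
    intro S hS hS'
    simp only [Finset.mem_powersetCard, Finset.mem_image, Finset.mem_compl] at hS hS' hv hv'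
    obtain ⟨T, hT, rfl⟩ := hS
    obtain ⟨T', hT', he⟩ := hS'
    have : v ∈ insert v' T' := by rw [he]; exact Finset.mem_insert_self _ _
    rcases Finset.mem_insert.mp this with h | h
    · exact hne h
    · exact hv (NA v' (hT'.1 h))
  have himg : ∀ v ∈ Aᶜ, (((N v).powersetCard (s - 1)).image (insert v)).card =
      if v.val = n - 1 then k.choose (s - 1) else (c / 2).choose (s - 1) := by
    intro v hv
    rw [Finset.mem_compl] at hv
    rw [Finset.card_image_of_injOn, Finset.card_powersetCard, hN]
    · split_ifs <;> rfl
    · intro T hT T' hT' he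
      simp only [Finset.mem_coe,
        Finset.mem_powersetCard] at hT hT'
      have e1 : (insert v T).erase v = T :=
        Finset.erase_insert (fun h => hv (NA v (hT.1 h)))
      have e2 : (insert v T').erase v = T' :=
        Finset.erase_insert (fun h => hv (NA v (hT'.1 h)))
      have he' : insert v T = insert v T' := he
      rw [← e1, ← e2, he']
  unfold cliquesN gCliques
  rw [Nat.card_eq_fintype_card, Fintype.card_subtype, main, Finset.card_union_of_disjoint hdisj,
    Finset.card_powersetCard, hA, Finset.card_biUnion hpair, Finset.sum_congr rfl himg, add_assoc]
  congr 1
  have hlast : (⟨n - 1, by omega⟩ : Fin n) ∈ Aᶜ := by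
    rw [Finset.mem_compl, memA]; simp only; omega
  rw [← Finset.sum_erase_add _ _ hlast]
  simp only [if_true]
  congr 1
  rw [Finset.sum_congr rfl (g := fun _ => (c / 2).choose (s - 1))]
  · rw [Finset.sum_const, smul_eq_mul, Finset.card_erase_of_mem hlast, Finset.card_compl, hA,
      Fintype.card_fin]
    congr 1
    omega
  · intro v hv
    rw [if_neg]
    intro h
    exact (Finset.ne_of_mem_erase hv) (Fin.ext h)

theorem stmt2 (n c k s : ℕ) (h1 : c ≤ n - 1) (h2 : 2 * k ≤ c) (h3 : 2 ≤ k) (h4 : 2 ≤ s) :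
    TwoConnected (Ggraph n c k) ∧ Nat.card (Fin n) = n ∧
    MinDegreeEq (Ggraph n c k) k ∧ circ (Ggraph n c k) = c ∧
    ¬ IsHamiltonianGr (Ggraph n c k) ∧ cliquesN (Ggraph n c k) s = gCliques n c k s := by
  exact ⟨two_conn n c k h1 h2 h3, by simp, min_deg n c k h1 h2 h3, circ_eq n c k h1 h2 h3,
    not_ham n c k h1 h2 h3, cliques_eq n c k s h1 h2 h3 h4⟩
end

section
/- Let n, k be integers with k ≥ 2 and n ≥ 2k+1, and let φ(n,k) denote the maximum number of edges of a nonhamiltonian 2-connected graph of order n with minimum degree exactly k. Then: φ(n,k) = C(n-k,2) + k² if (n is odd and n ≥ 6k-5) or (n is even and n ≥ 6k-8); φ(n,k) = (3n²-8n+5)/8 + k if n is odd and 2k+1 ≤ n ≤ 6k-7; and φ(n,k) = (3n²-10n+16)/8 + k if n is even and 2k+2 ≤ n ≤ 6k-10. -/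
open SimpleGraph

/-- `M` is the maximum number of edges of a nonhamiltonian 2-connected graph of order `n`
with minimum degree exactly `k`. -/
def MaxNonhamEdges (n k M : ℕ) : Prop :=
  (∀ (V : Type) (G : SimpleGraph V), Nat.card V = n → TwoConnected G →
      ¬ IsHamiltonianGr G → MinDegreeEq G k → edgeCount G ≤ M) ∧
  (∃ G : SimpleGraph (Fin n), TwoConnected G ∧ ¬ IsHamiltonianGr G ∧ MinDegreeEq G k ∧
      edgeCount G = M)

/-- `f 0, …, f (n-1)` is a cyclic sequence of distinct, consecutively adjacent vertices. -/
def HamW {V : Type*} (G : SimpleGraph V) (n : ℕ) (f : ℕ → V) : Prop :=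
  (∀ i j, i < n → j < n → f i = f j → i = j) ∧
  (∀ i, i + 1 < n → G.Adj (f i) (f (i + 1))) ∧ G.Adj (f (n - 1)) (f 0)

lemma HamW.adj_mod {V : Type*} {G : SimpleGraph V} {n : ℕ} {f : ℕ → V} (h : HamW G n f)
    {i : ℕ} (hi : i < n) : G.Adj (f i) (f ((i + 1) % n)) := by
  rcases Nat.lt_or_ge (i + 1) n with h1 | h1
  · rw [Nat.mod_eq_of_lt h1]; exact h.2.1 i h1
  · have : i + 1 = n := by omega
    rw [this, Nat.mod_self]
    have : i = n - 1 := by omega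
    rw [this]; exact h.2.2

lemma exists_walk_of_seq {V : Type*} (G : SimpleGraph V) (f : ℕ → V) (m : ℕ)
    (h : ∀ i, i < m → G.Adj (f i) (f (i + 1))) :
    ∃ p : G.Walk (f 0) (f m), p.support = (List.range (m + 1)).map f ∧
      p.edges = (List.range m).map (fun i => s(f i, f (i + 1))) := by
  induction m with
  | zero => exact ⟨Walk.nil, by simp, by simp⟩
  | succ m ih =>
    obtain ⟨p, hp, hq⟩ := ih (fun i hi => h i (by omega))
    refine ⟨p.concat (h m (by omega)), ?_, ?_⟩
    · rw [Walk.support_concat, hp, List.range_succ (n := m + 1)]; simp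
    · rw [Walk.edges_concat, hq, List.range_succ (n := m)]; simp

lemma HamW.isHam {V : Type*} [Finite V] {G : SimpleGraph V} {n : ℕ} {f : ℕ → V}
    (hn : 3 ≤ n) (hc : Nat.card V = n) (h : HamW G n f) : IsHamiltonianGr G := by
  obtain ⟨m, rfl⟩ : ∃ m, n = m + 1 := ⟨n - 1, by omega⟩
  obtain ⟨hinj, hadj, hlast⟩ := h
  rw [Nat.add_sub_cancel] at hlast
  obtain ⟨p, hp, hq⟩ := exists_walk_of_seq G f m (fun i hi => hadj i (by omega))
  refine ⟨f m, Walk.cons hlast p, ?_, ?_⟩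
  · rw [Walk.cons_isCycle_iff]
    refine ⟨?_, ?_⟩
    · rw [Walk.isPath_def, hp]
      refine List.Nodup.map_on ?_ List.nodup_range
      intro x hx y hy hxy
      exact hinj x y (by simpa using hx) (by simpa using hy) hxy
    · rw [hq]
      intro hmem
      simp only [List.mem_map, List.mem_range, Sym2.eq_iff] at hmem
      obtain ⟨i, hi, h1 | h1⟩ := hmem
      · have := hinj _ _ (by omega) (by omega) h1.1; omega
      · have := hinj _ _ (by omega) (by omega) h1.1
        have := hinj _ _ (by omega) (by omega) h1.2
        omega
  · intro u
    have hs : Function.Surjective (fun i : Fin (m + 1) => f i) := by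
      have hi : Function.Injective (fun i : Fin (m + 1) => f i) := by
        intro a b hab
        exact Fin.ext (hinj _ _ a.2 b.2 hab)
      exact ((Nat.bijective_iff_injective_and_card _).2 ⟨hi, by simp [hc]⟩).2
    obtain ⟨i, hi⟩ := hs u
    rw [Walk.support_cons, hp]
    refine List.mem_cons_of_mem _ (List.mem_map.2 ⟨i, List.mem_range.2 i.2, hi⟩)

lemma exists_hamW {V : Type*} {G : SimpleGraph V} (h : IsHamiltonianGr G) :
    ∃ (n : ℕ) (f : ℕ → V), 0 < n ∧ HamW G n f ∧ ∀ v, ∃ i, i < n ∧ f i = v := by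
  obtain ⟨v, w, hw, hs⟩ := h
  have h3 := hw.three_le_length
  refine ⟨w.length, w.getVert, by omega, ⟨?_, ?_, ?_⟩, ?_⟩
  · intro i j hi hj hij
    exact hw.getVert_injOn' (by simp; omega) (by simp; omega) hij
  · intro i hi
    exact w.adj_getVert_succ (by omega)
  · have := w.adj_getVert_succ (i := w.length - 1) (by omega)
    rw [Nat.sub_add_cancel (by omega), w.getVert_length] at this
    simpa using this
  · intro u
    obtain ⟨i, hi, hil⟩ := Walk.mem_support_iff_exists_getVert.1 (hs u)
    rcases Nat.lt_or_ge i w.length with h1 | h1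
    · exact ⟨i, h1, hi⟩
    · have : i = w.length := by omega
      subst this
      rw [w.getVert_length] at hi
      exact ⟨0, by omega, by simpa using hi⟩

lemma ore_path {V : Type*} [Fintype V] [DecidableEq V] {G : SimpleGraph V} [DecidableRel G.Adj]
    {n : ℕ} (hn : 3 ≤ n) (hc : Fintype.card V = n) (hG : ¬ ∃ f, HamW G n f) (f : ℕ → V)
    (hinj : ∀ i j, i < n → j < n → f i = f j → i = j)
    (hadj : ∀ i, i + 1 < n → G.Adj (f i) (f (i + 1))) :
    G.degree (f 0) + G.degree (f (n - 1)) ≤ n - 1 := by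
  have hsurj : ∀ v, ∃ i, i < n ∧ f i = v := by
    have hi : Function.Injective (fun i : Fin n => f i) := by
      intro a b hab
      exact Fin.ext (hinj _ _ a.2 b.2 hab)
    have hs := ((Nat.bijective_iff_injective_and_card _).2 ⟨hi, by simp [hc]⟩).2
    intro v
    obtain ⟨i, hi⟩ := hs v
    exact ⟨i, i.2, hi⟩
  let A := (Finset.range (n - 1)).filter (fun i => G.Adj (f 0) (f (i + 1)))
  let B := (Finset.range (n - 1)).filter (fun i => G.Adj (f (n - 1)) (f i))
  have hA : G.degree (f 0) ≤ A.card := by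
    rw [← G.card_neighborFinset_eq_degree]
    refine (Finset.card_le_card ?_).trans (Finset.card_image_le (f := fun i => f (i + 1)))
    intro v hv
    rw [mem_neighborFinset] at hv
    obtain ⟨i, hi, rfl⟩ := hsurj v
    have h0 : i ≠ 0 := by rintro rfl; exact G.loopless.irrefl _ hv
    rw [Finset.mem_image]
    have h1 : i - 1 + 1 = i := by omega
    refine ⟨i - 1, ?_, by rw [h1]⟩
    simp only [A, Finset.mem_filter, Finset.mem_range, h1]
    exact ⟨by omega, hv⟩
  have hB : G.degree (f (n - 1)) ≤ B.card := by
    rw [← G.card_neighborFinset_eq_degree]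
    refine (Finset.card_le_card ?_).trans (Finset.card_image_le (f := f))
    intro v hv
    rw [mem_neighborFinset] at hv
    obtain ⟨i, hi, rfl⟩ := hsurj v
    have h0 : i ≠ n - 1 := by rintro rfl; exact G.loopless.irrefl _ hv
    rw [Finset.mem_image]
    refine ⟨i, ?_, rfl⟩
    simp only [B, Finset.mem_filter, Finset.mem_range]
    exact ⟨by omega, hv⟩
  have hAB : Disjoint A B := by
    rw [Finset.disjoint_left]
    intro i hiA hiB
    simp only [A, B, Finset.mem_filter, Finset.mem_range] at hiA hiB
    apply hG
    refine ⟨fun j => if j ≤ i then f j else f (n + i - j), ?_, ?_, ?_⟩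
    · intro a b ha hb hab
      dsimp only at hab
      split_ifs at hab with h1 h2 h2 <;>
      · have := hinj _ _ (by omega) (by omega) hab
        omega
    · intro a ha
      dsimp only
      split_ifs with h1 h2 h2
      · exact hadj a (by omega)
      · have : a = i := by omega
        subst this
        have e : n + a - (a + 1) = n - 1 := by omega
        rw [e]; exact hiB.2.symm
      · omega
      · have := hadj (n + i - (a + 1)) (by omega)
        rw [show n + i - (a + 1) + 1 = n + i - a by omega] at this
        exact this.symm
    · dsimp only
      rw [if_neg (by omega), if_pos (by omega), show n + i - (n - 1) = i + 1 by omega]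
      exact hiA.2.symm
  have : (A ∪ B).card ≤ (Finset.range (n - 1)).card := by
    apply Finset.card_le_card
    intro i hi
    simp only [A, B, Finset.mem_union, Finset.mem_filter] at hi
    tauto
  rw [Finset.card_union_of_disjoint hAB, Finset.card_range] at this
  omega

lemma ore {V : Type*} [Fintype V] [DecidableEq V] {G : SimpleGraph V} [DecidableRel G.Adj]
    {n : ℕ} (hn : 3 ≤ n) (hc : Fintype.card V = n) (hG : ¬ ∃ f, HamW G n f) {u v : V}
    (g : ℕ → V) (hg : HamW (G ⊔ edge u v) n g) :
    G.degree u + G.degree v ≤ n - 1 := by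
  obtain ⟨i, hi, hna⟩ : ∃ i, i < n ∧ ¬ G.Adj (g i) (g ((i + 1) % n)) := by
    by_contra! hcon
    apply hG
    refine ⟨g, hg.1, ?_, ?_⟩
    · intro i hi
      have := hcon i (by omega)
      rwa [Nat.mod_eq_of_lt hi] at this
    · have := hcon (n - 1) (by omega)
      rwa [Nat.sub_add_cancel (by omega), Nat.mod_self] at this
  have hmodinj : ∀ a b, a < n → b < n → (i + 1 + a) % n = (i + 1 + b) % n → a = b := by
    intro a b ha hb hab
    have : a ≡ b [MOD n] := Nat.ModEq.add_left_cancel' (i + 1) hab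
    rwa [Nat.ModEq, Nat.mod_eq_of_lt ha, Nat.mod_eq_of_lt hb] at this
  let h : ℕ → V := fun j => g ((i + 1 + j) % n)
  have hinj : ∀ a b, a < n → b < n → h a = h b → a = b := by
    intro a b ha hb hab
    exact hmodinj a b ha hb (hg.1 _ _ (Nat.mod_lt _ (by omega)) (Nat.mod_lt _ (by omega)) hab)
  have hadj : ∀ a, (G ⊔ edge u v).Adj (h a) (h (a + 1)) := by
    intro a
    have := hg.adj_mod (i := (i + 1 + a) % n) (Nat.mod_lt _ (by omega))
    rwa [Nat.mod_add_mod] at this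
  have hlast : h (n - 1) = g i := by
    simp only [h]
    rw [show i + 1 + (n - 1) = i + n by omega, Nat.add_mod_right, Nat.mod_eq_of_lt hi]
  have h0 : h 0 = g ((i + 1) % n) := rfl
  have huv : (h 0 = u ∧ h (n - 1) = v) ∨ (h 0 = v ∧ h (n - 1) = u) := by
    have := hg.adj_mod hi
    rw [sup_adj] at this
    have := this.resolve_left hna
    rw [edge_adj] at this
    rw [h0, hlast]
    tauto
  have hadj' : ∀ a, a + 1 < n → G.Adj (h a) (h (a + 1)) := by
    intro a ha
    have h1 := hadj a
    rw [sup_adj] at h1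
    rcases h1 with h1 | h1
    · exact h1
    · exfalso
      rw [edge_adj] at h1
      have h2 : (h a = h 0 ∧ h (a + 1) = h (n - 1)) ∨ (h a = h (n - 1) ∧ h (a + 1) = h 0) := by
        rcases huv with ⟨e1, e2⟩ | ⟨e1, e2⟩ <;> rw [e1, e2] <;> tauto
      rcases h2 with ⟨e1, e2⟩ | ⟨e1, e2⟩
      · have := hinj _ _ (by omega) (by omega) e1
        have := hinj _ _ (by omega) (by omega) e2
        omega
      · have := hinj _ _ (by omega) (by omega) e2
        omega
  have := ore_path hn hc hG h hinj hadj'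
  rcases huv with ⟨e1, e2⟩ | ⟨e1, e2⟩ <;> rw [e1, e2] at this <;> omega

lemma exists_low_set {V : Type*} [Fintype V] [DecidableEq V] {G : SimpleGraph V}
    [DecidableRel G.Adj] {n : ℕ} (hn : 3 ≤ n) (hc : Fintype.card V = n)
    (hG : ¬ ∃ f, HamW G n f) :
    ∃ (i : ℕ) (S : Finset V), 2 * i < n ∧ S.card = i ∧ (∀ v ∈ S, G.degree v ≤ i) ∧
      ∃ v, G.degree v ≤ i := by
  classical
  obtain ⟨H, hGH, hmax⟩ := Finite.exists_le_maximal (p := fun H => ¬ ∃ f, HamW H n f) hG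
  have hH := hmax.prop
  have hore : ∀ u v, u ≠ v → ¬ H.Adj u v → H.degree u + H.degree v ≤ n - 1 := by
    intro u v huv hna
    have h1 : ¬ ¬ ∃ f, HamW (H ⊔ edge u v) n f :=
      hmax.not_prop_of_gt (H.lt_sup_edge _ _ huv hna)
    push Not at h1
    obtain ⟨f, hf⟩ := h1
    exact ore hn hc hH f hf
  let P := (Finset.univ : Finset (V × V)).filter (fun p => p.1 ≠ p.2 ∧ ¬ H.Adj p.1 p.2)
  have hP : P.Nonempty := by
    by_contra hcon
    rw [Finset.not_nonempty_iff_eq_empty, Finset.filter_eq_empty_iff] at hcon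
    have hall : ∀ u v, u ≠ v → H.Adj u v := by
      intro u v huv
      by_contra h
      exact hcon (Finset.mem_univ (u, v)) ⟨huv, h⟩
    apply hH
    have hn0 : NeZero n := ⟨by omega⟩
    let e := (Fintype.equivFinOfCardEq hc).symm
    have hinj : ∀ i j, i < n → j < n →
        e (Fin.ofNat n i) = e (Fin.ofNat n j) → i = j := by
      intro i j hi hj hij
      have := congrArg Fin.val (e.injective hij)
      simpa [Nat.mod_eq_of_lt hi, Nat.mod_eq_of_lt hj] using this
    refine ⟨fun i => e (Fin.ofNat n i), hinj, ?_, ?_⟩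
    · intro i hi
      apply hall
      intro h
      have := hinj _ _ (by omega) (by omega) h
      omega
    · apply hall
      intro h
      have := hinj _ _ (by omega) (by omega) h
      omega
  obtain ⟨⟨u, v⟩, huvP, huv⟩ := Finset.exists_max_image P (fun p => H.degree p.1 + H.degree p.2) hP
  have key : ∀ u v : V, u ≠ v → ¬ H.Adj u v → H.degree u ≤ H.degree v →
      (∀ a b, a ≠ b → ¬ H.Adj a b → H.degree a + H.degree b ≤ H.degree u + H.degree v) →
      ∃ (i : ℕ) (S : Finset V), 2 * i < n ∧ S.card = i ∧ (∀ v ∈ S, G.degree v ≤ i) ∧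
      ∃ v, G.degree v ≤ i := by
    intro u v huv hna hle hm
    have hd : ∀ w, G.degree w ≤ H.degree w := fun w => degree_le_of_le hGH
    have ho := hore u v huv hna
    have hcard : H.degree u ≤ ((Finset.univ \ H.neighborFinset v).erase v).card := by
      rw [Finset.card_erase_of_mem (by simp), Finset.card_sdiff_of_subset (Finset.subset_univ _),
        Finset.card_univ, hc, H.card_neighborFinset_eq_degree]
      omega
    obtain ⟨S, hS, hSc⟩ := Finset.exists_subset_card_eq hcard
    refine ⟨H.degree u, S, by omega, hSc, ?_, u, hd u⟩
    intro w hw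
    have := hS hw
    simp only [Finset.mem_erase, Finset.mem_sdiff, Finset.mem_univ, true_and,
      mem_neighborFinset] at this
    have h1 := hm w v this.1 (fun h => this.2 h.symm)
    have := hd w
    omega
  simp only [P, Finset.mem_filter, Finset.mem_univ, true_and] at huvP huv
  rcases le_total (H.degree u) (H.degree v) with h | h
  · exact key u v huvP.1 huvP.2 h (fun a b hab hn => huv (a, b) ⟨hab, hn⟩)
  · refine key v u huvP.1.symm (fun h => huvP.2 h.symm) h (fun a b hab hn => ?_)
    have := huv (a, b) ⟨hab, hn⟩
    simp only at this
    omega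

lemma edge_bound {V : Type*} [Fintype V] [DecidableEq V] (G : SimpleGraph V)
    [DecidableRel G.Adj] (S : Finset V) :
    G.edgeFinset.card ≤ (Fintype.card V - S.card).choose 2 + ∑ v ∈ S, G.degree v := by
  have hsub : G.edgeFinset ⊆ (Sᶜ.offDiag.image Sym2.mk.uncurry) ∪
      S.biUnion (fun v => G.incidenceFinset v) := by
    intro e he
    induction e using Sym2.ind with
    | _ x y =>
      rw [mem_edgeFinset, mem_edgeSet] at he
      rw [Finset.mem_union]
      by_cases hx : x ∈ S
      · right
        rw [Finset.mem_biUnion]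
        exact ⟨x, hx, by simp [incidenceSet, he]⟩
      by_cases hy : y ∈ S
      · right
        rw [Finset.mem_biUnion]
        exact ⟨y, hy, by simp [incidenceSet, he]⟩
      left
      rw [Finset.mem_image]
      exact ⟨(x, y), by simp [hx, hy, he.ne], rfl⟩
  refine (Finset.card_le_card hsub).trans ((Finset.card_union_le _ _).trans ?_)
  rw [Sym2.card_image_offDiag, Finset.card_compl]
  refine Nat.add_le_add_left (Finset.card_biUnion_le.trans ?_) _
  simp [card_incidenceFinset_eq_degree]

lemma upper_bound {V : Type*} (G : SimpleGraph V) (n k : ℕ) (hk : 2 ≤ k) (hn : 2 * k + 1 ≤ n)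
    (hc : Nat.card V = n) (hG : ¬ IsHamiltonianGr G) (hmin : MinDegreeEq G k) :
    ∃ i, k ≤ i ∧ 2 * i < n ∧ edgeCount G ≤ (n - i).choose 2 + i * (i - 1) + k := by
  classical
  have : Finite V := Nat.finite_of_card_ne_zero (by omega)
  have := Fintype.ofFinite V
  have hc' : Fintype.card V = n := by rw [← Nat.card_eq_fintype_card]; exact hc
  have hdeg : ∀ v, degN G v = G.degree v := by
    intro v
    rw [degN, Nat.card_eq_fintype_card, card_neighborSet_eq_degree]
  have he : edgeCount G = G.edgeFinset.card := by
    rw [edgeCount, Nat.card_eq_fintype_card, ← edgeFinset_card]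
  have hG' : ¬ ∃ f, HamW G n f := by
    rintro ⟨f, hf⟩
    exact hG (hf.isHam (by omega) hc)
  obtain ⟨hlow, w, hw⟩ := hmin
  simp only [hdeg] at hlow hw
  obtain ⟨i, S, hi, hS, hSd, x, hx⟩ := exists_low_set (by omega) hc' hG'
  have hki : k ≤ i := (hlow x).trans hx
  refine ⟨i, hki, hi, ?_⟩
  obtain ⟨R, hRc, hRd, hRw⟩ : ∃ R : Finset V, R.card + 1 = i ∧ (∀ v ∈ R, G.degree v ≤ i) ∧ w ∉ R := by
    by_cases hwS : w ∈ S
    · exact ⟨S.erase w, by rw [Finset.card_erase_of_mem hwS]; omega,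
        fun v hv => hSd v (Finset.mem_of_mem_erase hv), by simp⟩
    · obtain ⟨R, hR, hRc⟩ := Finset.exists_subset_card_eq (s := S) (n := i - 1) (by omega)
      exact ⟨R, by omega, fun v hv => hSd v (hR hv), fun h => hwS (hR h)⟩
  have hb := edge_bound G (insert w R)
  rw [Finset.sum_insert hRw, Finset.card_insert_of_notMem hRw, hRc, hc', hw] at hb
  have hs := Finset.sum_le_card_nsmul R (fun v => G.degree v) i hRd
  rw [smul_eq_mul, show R.card = i - 1 by omega, mul_comm] at hs
  rw [he]
  omega

/-- The extremal graph: vertices below `n - t` form a clique, the last `t` vertices are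
independent and joined to the first `t` vertices, except that the vertex `n - 1` is joined only
to the first `k` vertices. -/
def extG (n t k : ℕ) : SimpleGraph (Fin n) where
  Adj x y := x ≠ y ∧ ((x.val < n - t ∧ y.val < n - t) ∨
    (x.val < t ∧ y.val + 1 < n) ∨ (y.val < t ∧ x.val + 1 < n) ∨ x.val < k ∨ y.val < k)
  symm := ⟨by intro x y h; exact ⟨h.1.symm, by tauto⟩⟩
  loopless := ⟨by intro x h; exact h.1 rfl⟩

lemma extG_adj {n t k : ℕ} {x y : Fin n} : (extG n t k).Adj x y ↔ x.val ≠ y.val ∧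
    ((x.val < n - t ∧ y.val < n - t) ∨
    (x.val < t ∧ y.val + 1 < n) ∨ (y.val < t ∧ x.val + 1 < n) ∨ x.val < k ∨ y.val < k) := by
  simp [extG, Fin.ext_iff]

lemma extG_twoConnected {n t k : ℕ} (hk : 2 ≤ k) (hn : 2 * k + 1 ≤ n) :
    TwoConnected (extG n t k) := by
  refine ⟨by simp; omega, fun v => ?_⟩
  obtain ⟨c, hc, hcv⟩ : ∃ c : Fin n, c.val < k ∧ c ≠ v := by
    by_cases h : v.val = 0
    · exact ⟨⟨1, by omega⟩, by simp; omega, by simp [Fin.ext_iff]; omega⟩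
    · exact ⟨⟨0, by omega⟩, by simp; omega, by simp [Fin.ext_iff]; omega⟩
  rw [connected_iff_exists_forall_reachable]
  refine ⟨⟨c, hcv⟩, fun w => ?_⟩
  by_cases h : w.val = c
  · have : w = ⟨c, hcv⟩ := Subtype.ext h
    rw [this]
  · apply Adj.reachable
    rw [comap_adj]
    simp only [Function.Embedding.subtype_apply]
    rw [extG_adj]
    exact ⟨fun h' => h (Fin.ext h'.symm), by omega⟩

lemma extG_nonham {n t k : ℕ} (hkt : k ≤ t) (ht : 2 * t < n) (ht0 : 0 < t) :
    ¬ IsHamiltonianGr (extG n t k) := by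
  intro hH
  obtain ⟨L, f, hL, hf, hs⟩ := exists_hamW hH
  let A := (Finset.range L).filter (fun i => n - t ≤ (f i).val)
  let B := (Finset.range L).filter (fun i => (f i).val < t)
  have hAB : ∀ x y : Fin n, (extG n t k).Adj x y → n - t ≤ x.val → y.val < t := by
    intro x y h hx
    rw [extG_adj] at h
    omega
  have hA : t ≤ A.card := by
    have h1 : (Finset.Ico (n - t) n).card ≤ (A.image (fun i => (f i).val)).card := by
      apply Finset.card_le_card
      intro x hx
      rw [Finset.mem_Ico] at hx
      obtain ⟨i, hi, hfi⟩ := hs ⟨x, hx.2⟩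
      rw [Finset.mem_image]
      refine ⟨i, ?_, by rw [hfi]⟩
      simp only [A, Finset.mem_filter, Finset.mem_range, hfi]
      exact ⟨hi, hx.1⟩
    rw [Nat.card_Ico] at h1
    have := Finset.card_image_le (s := A) (f := fun i => (f i).val)
    omega
  have hB : B.card ≤ t := by
    rw [← Finset.card_range t]
    apply Finset.card_le_card_of_injOn (fun i => (f i).val)
    · intro i hi
      simp only [B, Finset.coe_filter, Set.mem_ofPred_eq] at hi
      simpa using hi.2
    · intro i hi j hj hij
      simp only [B, Finset.coe_filter, Set.mem_ofPred_eq, Finset.mem_range] at hi hj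
      exact hf.1 _ _ hi.1 hj.1 (Fin.ext hij)
  have hpred : ∀ i, i < L → ((i + (L - 1)) % L + 1) % L = i := by
    intro i hi
    rw [Nat.mod_add_mod, show i + (L - 1) + 1 = i + L by omega, Nat.add_mod_right,
      Nat.mod_eq_of_lt hi]
  have hmaps : ∀ i ∈ A, (i + (L - 1)) % L ∈ B := by
    intro i hi
    simp only [A, B, Finset.mem_filter, Finset.mem_range] at hi ⊢
    have hlt : (i + (L - 1)) % L < L := Nat.mod_lt _ hL
    refine ⟨hlt, ?_⟩
    have := hf.adj_mod hlt
    rw [hpred i hi.1] at this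
    exact hAB _ _ this.symm hi.2
  have hsurj : ∀ j ∈ B, ∃ i ∈ A, (i + (L - 1)) % L = j := by
    have himg : A.image (fun i => (i + (L - 1)) % L) = B := by
      apply Finset.eq_of_subset_of_card_le
      · intro j hj
        obtain ⟨i, hi, rfl⟩ := Finset.mem_image.1 hj
        exact hmaps i hi
      · rw [Finset.card_image_of_injOn]
        · omega
        · intro i hi j hj hij
          have hi' : i < L := by simpa using (Finset.mem_filter.1 hi).1
          have hj' : j < L := by simpa using (Finset.mem_filter.1 hj).1
          dsimp only at hij
          rw [← hpred i hi', ← hpred j hj', hij]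
    intro j hj
    rw [← himg] at hj
    obtain ⟨i, hi, h⟩ := Finset.mem_image.1 hj
    exact ⟨i, hi, h⟩
  have hstep : ∀ j, j ∈ A ∨ j ∈ B → (j + 1) % L ∈ A ∨ (j + 1) % L ∈ B := by
    rintro j (hj | hj)
    · right
      simp only [A, B, Finset.mem_filter, Finset.mem_range] at hj ⊢
      exact ⟨Nat.mod_lt _ hL, hAB _ _ (hf.adj_mod hj.1) hj.2⟩
    · left
      obtain ⟨i, hi, rfl⟩ := hsurj j hj
      rw [hpred i (by simpa using (Finset.mem_filter.1 hi).1)]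
      exact hi
  have hall : ∀ a, a ∈ A → ∀ m, (a + m) % L ∈ A ∨ (a + m) % L ∈ B := by
    intro a ha m
    induction m with
    | zero =>
      have : a < L := by simpa using (Finset.mem_filter.1 ha).1
      rw [Nat.add_zero, Nat.mod_eq_of_lt this]; exact Or.inl ha
    | succ m ih =>
      have := hstep _ ih
      rwa [Nat.mod_add_mod] at this
  obtain ⟨a, ha⟩ : A.Nonempty := Finset.card_pos.1 (by omega)
  obtain ⟨b, hb, hfb⟩ := hs ⟨t, by omega⟩
  have haL : a < L := by simpa using (Finset.mem_filter.1 ha).1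
  have := hall a ha (b + L - a)
  rw [show a + (b + L - a) = b + L by omega, Nat.add_mod_right, Nat.mod_eq_of_lt hb] at this
  simp only [A, B, Finset.mem_filter, hfb] at this
  omega

lemma extG_minDegree {n t k : ℕ} (hkt : k ≤ t) (ht : 2 * t < n) (hk : 2 ≤ k) :
    MinDegreeEq (extG n t k) k := by
  classical
  have hcard : ∀ p : Fin n → Prop, (∀ x, p x ↔ x.val < k) → Nat.card {x // p x} = k := by
    intro p hp
    have e : {x // p x} ≃ Fin k :=
      { toFun := fun x => ⟨x.1.1, (hp _).1 x.2⟩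
        invFun := fun x => ⟨⟨x.1, by omega⟩, (hp _).2 x.2⟩
        left_inv := fun x => rfl
        right_inv := fun x => rfl }
    rw [Nat.card_congr e, Nat.card_fin]
  constructor
  · intro v
    rw [degN]
    by_cases hv : v.val < k
    · have : ((extG n t k).neighborSet v) = {v}ᶜ := by
        ext x
        rw [mem_neighborSet, extG_adj]
        simp only [Set.mem_compl_iff, Set.mem_singleton_iff, Fin.ext_iff]
        omega
      rw [this, Nat.card_eq_fintype_card, Fintype.card_compl_set]
      simp
      omega
    · calc k = Nat.card {x : Fin n // x.val < k} := (hcard _ (fun x => Iff.rfl)).symm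
        _ ≤ _ := Nat.card_mono (Set.toFinite _) (t := (extG n t k).neighborSet v)
          (s := {x | x.val < k}) (by
            intro x hx
            rw [mem_neighborSet, extG_adj]
            simp only [Set.mem_ofPred_eq] at hx
            omega)
  · refine ⟨⟨n - 1, by omega⟩, ?_⟩
    rw [degN]
    refine hcard _ (fun x => ?_)
    rw [mem_neighborSet, extG_adj]
    simp only
    omega

lemma extG_edges {n t k : ℕ} (hkt : k ≤ t) (ht : 2 * t < n) (hk : 2 ≤ k) :
    (n - t).choose 2 + t * (t - 1) + k ≤ edgeCount (extG n t k) := by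
  classical
  let c : ℕ → ℕ := fun y => if y < n - t then y else if y + 1 < n then t else k
  have hc : ∀ y, y < n → c y ≤ y := by
    intro y hy
    simp only [c]
    split_ifs <;> omega
  let D := (Finset.range n).sigma (fun y => Finset.range (c y))
  have hD : D.card = (n - t).choose 2 + t * (t - 1) + k := by
    rw [Finset.card_sigma]
    simp only [Finset.card_range]
    obtain ⟨m, rfl⟩ : ∃ m, n = m + (t - 1) + 1 := ⟨n - t, by omega⟩
    have e : m + (t - 1) + 1 - t = m := by omega
    rw [Finset.sum_range_succ, Finset.sum_range_add]
    congr 1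
    · congr 1
      · rw [e, Nat.choose_two_right, ← Finset.sum_range_id]
        refine Finset.sum_congr rfl fun y hy => ?_
        simp only [Finset.mem_range] at hy
        simp only [c, e, if_pos hy]
      · rw [Finset.sum_congr rfl (g := fun _ => t)]
        · simp [mul_comm]
        · intro y hy
          simp only [Finset.mem_range] at hy
          simp only [c, e]
          rw [if_neg (by omega), if_pos (by omega)]
    · simp only [c, e]
      rw [if_neg (by omega), if_neg (by omega)]
  have he : edgeCount (extG n t k) = (extG n t k).edgeFinset.card := by
    rw [edgeCount, Nat.card_eq_fintype_card, ← edgeFinset_card]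
  rw [← hD, he]
  have hn0 : NeZero n := ⟨by omega⟩
  apply Finset.card_le_card_of_injOn (fun p => s(Fin.ofNat n p.2, Fin.ofNat n p.1))
  · rintro ⟨y, x⟩ hp
    simp only [D, Finset.coe_sigma, Set.mem_sigma_iff, Finset.coe_range, Set.mem_Iio] at hp
    have := hc y hp.1
    have h2 := hp.2
    rw [Finset.mem_coe, mem_edgeFinset, mem_edgeSet, extG_adj]
    simp only [Fin.ofNat, Nat.mod_eq_of_lt hp.1, Nat.mod_eq_of_lt (show x < n by omega)]
    simp only [c] at h2
    split_ifs at h2 <;> omega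
  · rintro ⟨y, x⟩ hp ⟨y', x'⟩ hp' h
    simp only [D, Finset.coe_sigma, Set.mem_sigma_iff, Finset.coe_range, Set.mem_Iio] at hp hp'
    have h1 := hc y hp.1
    have h2 := hc y' hp'.1
    simp only [Sym2.eq_iff, Fin.ext_iff, Fin.ofNat, Nat.mod_eq_of_lt hp.1, Nat.mod_eq_of_lt hp'.1,
      Nat.mod_eq_of_lt (show x < n by omega), Nat.mod_eq_of_lt (show x' < n by omega)] at h
    have h3 : x = x' ∧ y = y' := by omega
    rw [h3.1, h3.2]

lemma maxNonham {n k t : ℕ} (hk : 2 ≤ k) (hn : 2 * k + 1 ≤ n) (hkt : k ≤ t) (ht : 2 * t < n)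
    (hmax : ∀ i, k ≤ i → 2 * i < n →
      (n - i).choose 2 + i * (i - 1) + k ≤ (n - t).choose 2 + t * (t - 1) + k) :
    MaxNonhamEdges n k ((n - t).choose 2 + t * (t - 1) + k) := by
  have hup : ∀ (V : Type) (G : SimpleGraph V), Nat.card V = n → TwoConnected G →
      ¬ IsHamiltonianGr G → MinDegreeEq G k →
      edgeCount G ≤ (n - t).choose 2 + t * (t - 1) + k := by
    intro V G hc _ hG hmin
    obtain ⟨i, hi, hin, he⟩ := upper_bound G n k hk hn hc hG hmin
    exact he.trans (hmax i hi hin)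
  have h1 := extG_twoConnected (t := t) hk hn
  have h2 := extG_nonham hkt ht (by omega)
  have h3 := extG_minDegree hkt ht hk
  exact ⟨hup, extG n t k, h1, h2, h3,
    le_antisymm (hup _ _ (by simp) h1 h2 h3) (extG_edges hkt ht hk)⟩

lemma two_mul_bound {n i : ℕ} (k : ℕ) (hi : 0 < i) (hin : 2 * i < n) :
    2 * (((n - i).choose 2 + i * (i - 1) + k : ℕ) : ℤ) =
      ((n : ℤ) - i) * (n - i - 1) + 2 * (i * (i - 1)) + 2 * k := by
  obtain ⟨j, rfl⟩ : ∃ j, i = j + 1 := ⟨i - 1, by omega⟩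
  obtain ⟨m, rfl⟩ : ∃ m, n = (m + 1) + (j + 1) := ⟨n - j - 2, by omega⟩
  have h : (m + 1).choose 2 * 2 = (m + 1) * m := by
    rw [Nat.choose_two_right, Nat.add_sub_cancel]
    exact Nat.div_mul_cancel (by rw [mul_comm]; exact (Nat.even_mul_succ_self m).two_dvd)
  rw [Nat.add_sub_cancel, Nat.add_sub_cancel]
  have h' : ((m + 1).choose 2 : ℤ) * 2 = (m + 1) * m := by exact_mod_cast h
  push_cast
  linarith

theorem stmt4 (n k : ℕ) (hk : 2 ≤ k) (hn : 2 * k + 1 ≤ n) :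
    (((Odd n ∧ 6 * k - 5 ≤ n) ∨ (Even n ∧ 6 * k - 8 ≤ n)) →
        MaxNonhamEdges n k (Nat.choose (n - k) 2 + k ^ 2)) ∧
    ((Odd n ∧ n ≤ 6 * k - 7) →
        MaxNonhamEdges n k ((3 * n ^ 2 - 8 * n + 5) / 8 + k)) ∧
    ((Even n ∧ 2 * k + 2 ≤ n ∧ n ≤ 6 * k - 10) →
        MaxNonhamEdges n k ((3 * n ^ 2 - 10 * n + 16) / 8 + k)) := by
  refine ⟨fun h => ?_, fun h => ?_, fun h => ?_⟩
  · have e : (n - k).choose 2 + k ^ 2 = (n - k).choose 2 + k * (k - 1) + k := by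
      obtain ⟨j, rfl⟩ : ∃ j, k = j + 1 := ⟨k - 1, by omega⟩
      rw [Nat.add_sub_cancel]; ring
    rw [e]
    refine maxNonham hk hn le_rfl (by omega) (fun i hi hin => ?_)
    have h1 := two_mul_bound k (by omega) hin
    have h2 := two_mul_bound k (i := k) (n := n) (by omega) (by omega)
    have h3 : 3 * (k + i) ≤ 2 * n + 1 := by
      rcases h with ⟨⟨m, hm⟩, h⟩ | ⟨⟨m, hm⟩, h⟩ <;> omega
    zify at h3 hi
    have := mul_nonneg (sub_nonneg.2 hi) (sub_nonneg.2 h3)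
    zify
    push_cast at h1 h2
    nlinarith
  · obtain ⟨⟨m, hm⟩, h⟩ := h
    have ht : k ≤ m := by omega
    have h2 := two_mul_bound k (i := m) (n := n) (by omega) (by omega)
    have e : (3 * n ^ 2 - 8 * n + 5) / 8 + k = (n - m).choose 2 + m * (m - 1) + k := by
      have hle : 8 * n ≤ 3 * n ^ 2 := by nlinarith
      suffices 3 * n ^ 2 - 8 * n + 5 = 8 * ((n - m).choose 2 + m * (m - 1)) by
        rw [this, Nat.mul_div_cancel_left _ (by norm_num)]
      zify [hle]
      push_cast at h2
      subst hm
      push_cast at h2 ⊢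
      nlinarith
    rw [e]
    refine maxNonham hk hn ht (by omega) (fun i hi hin => ?_)
    have h1 := two_mul_bound k (by omega) hin
    have h3 : 2 * n + 1 ≤ 3 * (i + m) := by omega
    have him : i ≤ m := by omega
    zify at h3 him
    have := mul_nonneg (sub_nonneg.2 him) (sub_nonneg.2 h3)
    zify
    push_cast at h1 h2
    nlinarith
  · obtain ⟨⟨m', hm⟩, hn2, h⟩ := h
    obtain ⟨m, rfl⟩ : ∃ m, m' = m + 1 := ⟨m' - 1, by omega⟩
    have ht : k ≤ m := by omega
    have h2 := two_mul_bound k (i := m) (n := n) (by omega) (by omega)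
    have e : (3 * n ^ 2 - 10 * n + 16) / 8 + k = (n - m).choose 2 + m * (m - 1) + k := by
      have hle : 10 * n ≤ 3 * n ^ 2 := by nlinarith
      suffices 3 * n ^ 2 - 10 * n + 16 = 8 * ((n - m).choose 2 + m * (m - 1)) by
        rw [this, Nat.mul_div_cancel_left _ (by norm_num)]
      zify [hle]
      push_cast at h2
      subst hm
      push_cast at h2 ⊢
      nlinarith
    rw [e]
    refine maxNonham hk hn ht (by omega) (fun i hi hin => ?_)
    have h1 := two_mul_bound k (by omega) hin
    have h3 : 2 * n + 1 ≤ 3 * (i + m) := by omega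
    have him : i ≤ m := by omega
    zify at h3 him
    have := mul_nonneg (sub_nonneg.2 him) (sub_nonneg.2 h3)
    zify
    push_cast at h1 h2
    nlinarith
end

section
/- Let n, k be integers with k ≥ 2, and suppose (n is odd and n ≥ 6k-3) or (n is even and n ≥ 6k-6). A nonhamiltonian 2-connected graph G of order n with minimum degree exactly k has C(n-k,2) + k² edges if and only if G is isomorphic to K_k ∨ (K_{n-2k} + \overline{K_k}). -/
open SimpleGraph

/-- Hamilton cycle given as a cyclic enumeration of the vertices. -/
def HamSeq {V : Type} (n : ℕ) (H : SimpleGraph V) : Prop :=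
  ∃ f : ℕ → V, Set.InjOn f (Set.Iio n) ∧ ∀ i, H.Adj (f (i % n)) (f ((i + 1) % n))

lemma inj_surj {V : Type} [Fintype V] {n : ℕ} (hV : Fintype.card V = n) {f : ℕ → V}
    (hf : Set.InjOn f (Set.Iio n)) (v : V) : ∃ i, i < n ∧ f i = v := by
  classical
  have h1 : ((Finset.range n).image f) = Finset.univ := by
    apply Finset.eq_univ_of_card
    rw [Finset.card_image_of_injOn (by simpa using hf), Finset.card_range, hV]
  have h2 := Finset.mem_univ v
  rw [← h1] at h2
  simpa using h2

lemma walk_of_seq {V : Type} {H : SimpleGraph V} (f : ℕ → V) (m : ℕ)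
    (h : ∀ i, i < m → H.Adj (f i) (f (i + 1))) :
    ∃ w : H.Walk (f m) (f 0), w.support = ((List.range (m + 1)).map f).reverse := by
  induction m with
  | zero => exact ⟨Walk.nil, by simp⟩
  | succ m ih =>
    obtain ⟨w, hw⟩ := ih (fun i hi => h i (by omega))
    refine ⟨Walk.cons (h m (by omega)).symm w, ?_⟩
    rw [Walk.support_cons, hw, List.range_succ (n := m + 1)]
    simp

lemma HamSeq.isHam {V : Type} [Fintype V] {n : ℕ} (hV : Fintype.card V = n) (hn : 3 ≤ n)
    {H : SimpleGraph V} (h : HamSeq n H) : IsHamiltonianGr H := by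
  classical
  obtain ⟨f, hf, ha⟩ := h
  have hadj : ∀ i, i < n - 1 → H.Adj (f i) (f (i + 1)) := by
    intro i hi
    have := ha i
    rwa [Nat.mod_eq_of_lt (by omega), Nat.mod_eq_of_lt (by omega)] at this
  have hlast : H.Adj (f (n - 1)) (f 0) := by
    have := ha (n - 1)
    rwa [Nat.mod_eq_of_lt (by omega), Nat.sub_add_cancel (by omega), Nat.mod_self] at this
  obtain ⟨w', hw'⟩ : ∃ w' : H.Walk (f (n - 1)) (f 0),
      w'.support = ((List.range n).map f).reverse := by
    have := walk_of_seq (H := H) f (n - 1) hadj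
    rwa [Nat.sub_add_cancel (by omega)] at this
  have hp : w'.IsPath := by
    rw [Walk.isPath_def, hw', List.nodup_reverse]
    refine List.Nodup.map_on ?_ List.nodup_range
    intro x hx y hy hxy
    exact hf (by simpa using hx) (by simpa using hy) hxy
  refine ⟨_, Walk.cons hlast.symm w', ?_, ?_⟩
  · rw [Walk.cons_isCycle_iff]
    refine ⟨hp, ?_⟩
    intro he
    have hlen : w'.length = n - 1 := by
      have := w'.length_support
      rw [hw'] at this
      simp at this
      omega
    have h1 : w'.length = 1 := by
      rw [Sym2.eq_swap] at he
      exact (hp.length_eq_one_of_mem_edges he)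
    omega
  · intro u
    obtain ⟨i, hi, rfl⟩ := inj_surj hV hf u
    rw [Walk.support_cons, hw']
    simp only [List.mem_cons, List.mem_reverse, List.mem_map, List.mem_range]
    exact Or.inr ⟨i, hi, rfl⟩

/-- Crossing argument. -/
lemma crossing {V : Type} [Fintype V] {n : ℕ} (hV : Fintype.card V = n) (hn : 3 ≤ n)
    {H : SimpleGraph V} [DecidableRel H.Adj] (hH : ¬ HamSeq n H) (g : ℕ → V)
    (hg : Set.InjOn g (Set.Iio n)) (ha : ∀ i, i + 1 < n → H.Adj (g i) (g (i + 1))) :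
    H.degree (g 0) + H.degree (g (n - 1)) ≤ n - 1 := by
  classical
  have key : ∀ i, i + 1 < n → ¬ (H.Adj (g 0) (g (i + 1)) ∧ H.Adj (g (n - 1)) (g i)) := by
    rintro i hi ⟨h1, h2⟩
    apply hH
    refine ⟨fun j => if j ≤ i then g j else g (n + i - j), ?_, ?_⟩
    · intro x hx y hy hxy
      simp only [Set.mem_Iio] at hx hy
      have e : ∀ a b, a < n → b < n → g a = g b → a = b := fun a b ha hb hab => hg ha hb hab
      dsimp only at hxy
      split_ifs at hxy with c1 c2 c2
      · exact e _ _ hx hy hxy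
      · have := e _ _ (by omega) (by omega) hxy; omega
      · have := e _ _ (by omega) (by omega) hxy; omega
      · have := e _ _ (by omega) (by omega) hxy; omega
    · intro j
      have hj : j % n < n := Nat.mod_lt _ (by omega)
      have hj1 : (j + 1) % n = if j % n + 1 = n then 0 else j % n + 1 := by
        rw [Nat.add_mod, Nat.mod_eq_of_lt (a := 1) (by omega)]
        split_ifs with c
        · rw [c, Nat.mod_self]
        · exact Nat.mod_eq_of_lt (by omega)
      rw [hj1]
      generalize j % n = m at *
      dsimp only
      by_cases c : m + 1 = n
      · rw [if_pos c, if_neg (by omega), if_pos (by omega)]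
        have : n + i - m = i + 1 := by omega
        rw [this]; exact h1.symm
      · rw [if_neg c]
        by_cases c1 : m + 1 ≤ i
        · rw [if_pos (by omega), if_pos c1]; exact ha _ (by omega)
        · by_cases c2 : m = i
          · subst c2
            rw [if_pos le_rfl, if_neg c1]
            have : n + m - (m + 1) = n - 1 := by omega
            rw [this]; exact h2.symm
          · rw [if_neg (by omega), if_neg (by omega)]
            have : n + i - m = (n + i - (m + 1)) + 1 := by omega
            rw [this]
            exact (ha _ (by omega)).symm
  have d1 : H.degree (g 0) ≤ ((Finset.range (n - 1)).filter
      (fun i => H.Adj (g 0) (g (i + 1)))).card := by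
    rw [← card_neighborFinset_eq_degree]
    refine le_trans (Finset.card_le_card ?_) (Finset.card_image_le (f := fun i => g (i + 1)))
    intro x hx
    rw [mem_neighborFinset] at hx
    obtain ⟨i, hi, rfl⟩ := inj_surj hV hg x
    have : i ≠ 0 := by rintro rfl; exact H.irrefl hx
    obtain ⟨j, rfl⟩ := Nat.exists_eq_succ_of_ne_zero this
    simp only [Finset.mem_image, Finset.mem_filter, Finset.mem_range]
    exact ⟨j, ⟨by omega, hx⟩, rfl⟩
  have d2 : H.degree (g (n - 1)) ≤ ((Finset.range (n - 1)).filter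
      (fun i => H.Adj (g (n - 1)) (g i))).card := by
    rw [← card_neighborFinset_eq_degree]
    refine le_trans (Finset.card_le_card ?_) (Finset.card_image_le (f := g))
    intro x hx
    rw [mem_neighborFinset] at hx
    obtain ⟨i, hi, rfl⟩ := inj_surj hV hg x
    have : i ≠ n - 1 := by rintro rfl; exact H.irrefl hx
    simp only [Finset.mem_image, Finset.mem_filter, Finset.mem_range]
    exact ⟨i, ⟨by omega, hx⟩, rfl⟩
  have d3 : Disjoint ((Finset.range (n - 1)).filter (fun i => H.Adj (g 0) (g (i + 1))))
      ((Finset.range (n - 1)).filter (fun i => H.Adj (g (n - 1)) (g i))) := by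
    rw [Finset.disjoint_filter]
    intro i hi h1 h2
    rw [Finset.mem_range] at hi
    exact key i (by omega) ⟨h1, h2⟩
  have d4 := Finset.card_union_of_disjoint d3
  have d5 : (((Finset.range (n - 1)).filter (fun i => H.Adj (g 0) (g (i + 1)))) ∪
      ((Finset.range (n - 1)).filter (fun i => H.Adj (g (n - 1)) (g i)))).card ≤ n - 1 := by
    refine le_trans (Finset.card_le_card (t := Finset.range (n - 1)) ?_) (by simp)
    exact Finset.union_subset (Finset.filter_subset _ _) (Finset.filter_subset _ _)
  omega

/-- Ore-type lemma: nonadjacent pair whose addition creates a Hamilton cycle. -/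
lemma ore_pair {V : Type} [Fintype V] {n : ℕ} (hV : Fintype.card V = n) (hn : 3 ≤ n)
    {H : SimpleGraph V} [DecidableRel H.Adj] (hH : ¬ HamSeq n H) (u v : V)
    (hadd : HamSeq n (H ⊔ SimpleGraph.edge u v)) :
    H.degree u + H.degree v ≤ n - 1 := by
  obtain ⟨f, hf, ha⟩ := hadd
  have e : ∀ a b, a < n → b < n → f a = f b → a = b := fun a b ha hb hab => hf ha hb hab
  have : ∃ j, ¬ H.Adj (f (j % n)) (f ((j + 1) % n)) := by
    by_contra hc
    push Not at hc
    exact hH ⟨f, hf, hc⟩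
  obtain ⟨j, hj⟩ := this
  have hj' := ha j
  have hlt : ∀ m, m % n < n := fun m => Nat.mod_lt _ (by omega)
  have hadjE : ∀ a b, (H ⊔ SimpleGraph.edge u v).Adj a b → ¬ H.Adj a b →
      (a = u ∧ b = v) ∨ (a = v ∧ b = u) := by
    intro a b h1 h2
    simp only [sup_adj, edge_adj] at h1
    tauto
  have hends := hadjE _ _ hj' hj
  have hinj : Set.InjOn (fun m => f ((j + 1 + m) % n)) (Set.Iio n) := by
    intro x hx y hy hxy
    have h1 := e _ _ (hlt _) (hlt _) hxy
    have h2 : x ≡ y [MOD n] := Nat.ModEq.add_left_cancel' (j + 1) h1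
    exact Nat.ModEq.eq_of_lt_of_lt h2 hx hy
  have hlast : (j + 1 + (n - 1)) % n = j % n := by
    have : j + 1 + (n - 1) = j + n := by omega
    rw [this, Nat.add_mod_right]
  have hpath : ∀ i, i + 1 < n → H.Adj (f ((j + 1 + i) % n)) (f ((j + 1 + (i + 1)) % n)) := by
    intro i hi
    by_contra hc
    have h1 := hadjE _ _ (ha (j + 1 + i)) hc
    have e2 : ∀ a b, a < n → b < n → f ((j + 1 + a) % n) = f ((j + 1 + b) % n) → a = b :=
      fun a b ha hb hab => hinj ha hb hab
    have h0 : f ((j + 1) % n) = f ((j + 1 + 0) % n) := rfl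
    rw [← hlast, h0] at hends
    rcases h1 with ⟨p, q⟩ | ⟨p, q⟩ <;> rcases hends with ⟨r, s⟩ | ⟨r, s⟩
    · have := e2 _ _ (by omega) (by omega) (p.trans r.symm); omega
    · have := e2 _ _ (by omega) (by omega) (p.trans s.symm)
      have := e2 (i + 1) _ (by omega) (by omega) (q.trans r.symm); omega
    · have := e2 _ _ (by omega) (by omega) (p.trans s.symm)
      have := e2 (i + 1) _ (by omega) (by omega) (q.trans r.symm); omega
    · have := e2 _ _ (by omega) (by omega) (p.trans r.symm); omega
  have hc := crossing hV hn hH (fun m => f ((j + 1 + m) % n)) hinj hpath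
  rw [hlast, Nat.add_zero] at hc
  rcases hends with ⟨r, s⟩ | ⟨r, s⟩
  · rw [r, s] at hc; omega
  · rw [r, s] at hc; omega

lemma hamSeq_top {V : Type} [Fintype V] {n : ℕ} (hV : Fintype.card V = n) (hn : 3 ≤ n) :
    HamSeq n (⊤ : SimpleGraph V) := by
  have eqv : Fin n ≃ V := (Fintype.equivFinOfCardEq hV).symm
  have hlt : ∀ m, m % n < n := fun m => Nat.mod_lt _ (by omega)
  have hinj : Set.InjOn (fun m => eqv ⟨m % n, hlt m⟩) (Set.Iio n) := by
    intro x hx y hy hxy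
    simp only [Set.mem_Iio] at hx hy
    have := eqv.injective hxy
    simpa [Nat.mod_eq_of_lt hx, Nat.mod_eq_of_lt hy] using this
  refine ⟨_, hinj, ?_⟩
  intro i
  rw [top_adj]
  intro h
  have h1 : i % n = (i + 1) % n := hinj (hlt _) (hlt _) h
  have h2 : i + 0 ≡ i + 1 [MOD n] := h1
  have h3 : 0 = 1 := Nat.ModEq.eq_of_lt_of_lt (Nat.ModEq.add_left_cancel' i h2)
    (by omega) (by omega)
  omega

/-- Chvatal's theorem (contrapositive), in counting form. -/
lemma chvatal {V : Type} [Fintype V] {n : ℕ} (hV : Fintype.card V = n) (hn : 3 ≤ n)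
    {G : SimpleGraph V} [DecidableRel G.Adj] (hG : ¬ HamSeq n G) :
    ∃ i, 2 * i < n ∧ i ≤ (Finset.univ.filter (fun x => G.degree x ≤ i)).card ∧
      n - i ≤ (Finset.univ.filter (fun x => G.degree x ≤ n - i - 1)).card ∧
      ∃ u, G.degree u ≤ i := by
  classical
  obtain ⟨H, hGH, hmax⟩ := Finite.exists_le_maximal
    (p := fun H : SimpleGraph V => ¬ HamSeq n H) hG
  have hH := hmax.prop
  have hadd : ∀ u v, u ≠ v → ¬ H.Adj u v → HamSeq n (H ⊔ SimpleGraph.edge u v) := by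
    intro u v huv hnadj
    by_contra hc
    have := hmax.le_of_ge hc le_sup_left
    exact hnadj (this (by simp [edge_adj, huv]))
  have hne : (Finset.univ.filter (fun p : V × V => p.1 ≠ p.2 ∧ ¬ H.Adj p.1 p.2)).Nonempty := by
    by_contra hc
    rw [Finset.not_nonempty_iff_eq_empty, Finset.filter_eq_empty_iff] at hc
    apply hH
    have : H = ⊤ := by
      ext a b
      rw [top_adj]
      refine ⟨fun h => h.ne, fun h => ?_⟩
      by_contra h'
      exact hc (Finset.mem_univ (a, b)) ⟨h, h'⟩
    rw [this]
    exact hamSeq_top hV hn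
  obtain ⟨⟨u₀, v₀⟩, hp, hpm⟩ := Finset.exists_max_image _
    (fun p : V × V => H.degree p.1 + H.degree p.2) hne
  have hmx : ∀ a b, a ≠ b → ¬ H.Adj a b → H.degree a + H.degree b ≤ H.degree u₀ + H.degree v₀ := by
    intro a b h1 h2
    exact hpm (a, b) (by simp [h1, h2])
  simp only [Finset.mem_filter, Finset.mem_univ, true_and] at hp
  obtain ⟨u, v, huv, hnadj, hle, hmx⟩ : ∃ u v, u ≠ v ∧ ¬ H.Adj u v ∧ H.degree u ≤ H.degree v ∧
      ∀ a b, a ≠ b → ¬ H.Adj a b → H.degree a + H.degree b ≤ H.degree u + H.degree v := by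
    rcases le_total (H.degree u₀) (H.degree v₀) with h | h
    · exact ⟨u₀, v₀, hp.1, hp.2, h, hmx⟩
    · refine ⟨v₀, u₀, hp.1.symm, fun h' => hp.2 h'.symm, h, ?_⟩
      intro a b h1 h2
      have := hmx a b h1 h2
      omega
  have hsum := ore_pair hV hn hH u v (hadd u v huv hnadj)
  have hdeg : ∀ x, G.degree x ≤ H.degree x := fun x => degree_le_of_le hGH
  have hcompl : ∀ x, (Finset.univ.filter (fun y => ¬ H.Adj x y)).card = n - H.degree x := by
    intro x
    have h1 : (Finset.univ.filter (fun y => ¬ H.Adj x y)) = (H.neighborFinset x)ᶜ := by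
      ext y; simp
    rw [h1, Finset.card_compl, hV, card_neighborFinset_eq_degree]
  refine ⟨H.degree u, by omega, ?_, ?_, u, hdeg u⟩
  · have h1 : ((Finset.univ.filter (fun y => ¬ H.Adj v y)).erase v).card = n - H.degree v - 1 := by
      rw [Finset.card_erase_of_mem (by simp), hcompl]
    refine le_trans (b := n - H.degree v - 1) (by omega) ?_
    rw [← h1]
    apply Finset.card_le_card
    intro x hx
    simp only [Finset.mem_erase, Finset.mem_filter, Finset.mem_univ, true_and] at hx ⊢
    have := hmx x v hx.1 (fun h => hx.2 h.symm)
    have := hdeg x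
    omega
  · refine (hcompl u).symm.le.trans (Finset.card_le_card ?_)
    intro x hx
    simp only [Finset.mem_filter, Finset.mem_univ, true_and] at hx ⊢
    by_cases hxu : x = u
    · subst hxu
      have := hdeg x
      omega
    · have := hmx u x (Ne.symm hxu) hx
      have := hdeg x
      omega

lemma card_fin_interval (n a b : ℕ) (hb : b ≤ n) :
    (Finset.univ.filter (fun j : Fin n => a ≤ j.val ∧ j.val < b)).card = b - a := by
  rw [← Finset.card_map Fin.valEmbedding, ← Nat.card_Ico]
  congr 1
  ext x
  simp only [Finset.mem_map, Finset.mem_filter, Finset.mem_univ, true_and, Finset.mem_Ico,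
    Fin.valEmbedding_apply]
  constructor
  · rintro ⟨j, hj, rfl⟩; exact hj
  · intro h; exact ⟨⟨x, by omega⟩, h, rfl⟩

lemma degN_eq {V : Type} [Fintype V] (G : SimpleGraph V) [DecidableRel G.Adj] (v : V) :
    degN G v = G.degree v := by
  rw [degN, Nat.card_eq_fintype_card, card_neighborSet_eq_degree]

lemma edgeCount_eq {V : Type} [Fintype V] (G : SimpleGraph V) [DecidableRel G.Adj] :
    2 * edgeCount G = ∑ v, G.degree v := by
  classical
  rw [sum_degrees_eq_twice_card_edges, edgeCount, Nat.card_eq_fintype_card, ← edgeFinset_card]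

lemma F_adj (n c k : ℕ) (x y : Fin n) : (Fgraph n c k).Adj x y ↔
    x ≠ y ∧ (x.val < k ∨ y.val < k ∨ (x.val ≤ c - k ∧ y.val ≤ c - k)) := Iff.rfl

lemma edgeCount_F (n k : ℕ) (hk : 2 ≤ k) (hn : 2 * k + 1 ≤ n) :
    2 * edgeCount (Fgraph n (n - 1) k) = (n - k) * (n - k - 1) + 2 * k ^ 2 := by
  classical
  rw [edgeCount_eq]
  have hd : ∀ j : Fin n, (Fgraph n (n - 1) k).degree j =
      (if 0 ≤ j.val ∧ j.val < k then k else 0) + (if 0 ≤ j.val ∧ j.val < k then n - 1 - k else 0) +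
      (if k ≤ j.val ∧ j.val < n - k then n - k - 1 else 0) +
      (if n - k ≤ j.val ∧ j.val < n then k else 0) := by
    intro j
    have hj := j.isLt
    rw [← card_neighborFinset_eq_degree]
    by_cases c1 : j.val < k
    · have : (Fgraph n (n - 1) k).neighborFinset j = Finset.univ.erase j := by
        ext x
        simp only [mem_neighborFinset, F_adj, Finset.mem_erase, Finset.mem_univ, and_true]
        exact ⟨fun h => h.1.symm, fun h => ⟨h.symm, Or.inl c1⟩⟩
      rw [this, Finset.card_erase_of_mem (by simp), Finset.card_univ, Fintype.card_fin,
        if_pos (by omega), if_pos (by omega), if_neg (by omega), if_neg (by omega)]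
      omega
    · by_cases c2 : j.val < n - k
      · have : (Fgraph n (n - 1) k).neighborFinset j =
            (Finset.univ.filter (fun i : Fin n => 0 ≤ i.val ∧ i.val < n - k)).erase j := by
          ext x
          simp only [mem_neighborFinset, F_adj, Finset.mem_erase, Finset.mem_univ,
            Finset.mem_filter, true_and, ne_comm (a := x), ne_eq]
          refine and_congr_right fun _ => ?_
          omega
        rw [this, Finset.card_erase_of_mem (by simp; omega), card_fin_interval _ _ _ (by omega),
          if_neg (by omega), if_neg (by omega), if_pos (by omega), if_neg (by omega)]
        omega
      · have : (Fgraph n (n - 1) k).neighborFinset j =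
            (Finset.univ.filter (fun i : Fin n => 0 ≤ i.val ∧ i.val < k)) := by
          ext x
          simp only [mem_neighborFinset, F_adj, Finset.mem_univ,
            Finset.mem_filter, true_and, ne_eq, Fin.ext_iff]
          omega
        rw [this, card_fin_interval _ _ _ (by omega),
          if_neg (by omega), if_neg (by omega), if_neg (by omega), if_pos (by omega)]
        omega
  simp only [hd, Finset.sum_add_distrib]
  simp only [← Finset.sum_filter, Finset.sum_const, smul_eq_mul]
  rw [card_fin_interval _ _ _ (by omega), card_fin_interval _ _ _ (by omega),
    card_fin_interval _ _ _ (by omega)]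
  obtain ⟨r, rfl⟩ : ∃ r, n = 2 * k + 1 + r := ⟨n - (2 * k + 1), by omega⟩
  have e1 : 2 * k + 1 + r - 1 - k = k + r := by omega
  have e2 : 2 * k + 1 + r - k - 1 = k + r := by omega
  have e3 : 2 * k + 1 + r - k - k = r + 1 := by omega
  have e4 : 2 * k + 1 + r - (2 * k + 1 + r - k) = k := by omega
  have e5 : 2 * k + 1 + r - k = k + r + 1 := by omega
  rw [e4, e1, e2, e3, e5]
  simp only [Nat.sub_zero]
  ring

/-- Recognition of the extremal graph from its degree structure. -/
lemma iso_of_structure {V : Type} [Fintype V] [DecidableEq V] {n k : ℕ}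
    (hV : Fintype.card V = n) (hn : 2 * k + 1 ≤ n)
    (G : SimpleGraph V) (A B : Finset V) (hAB : A ⊆ B) (hA : A.card = k) (hB : B.card = n - k)
    (hadj : ∀ x y, G.Adj x y ↔ x ≠ y ∧ (x ∉ B ∨ y ∉ B ∨ (x ∉ A ∧ y ∉ A))) :
    Nonempty (G ≃g Fgraph n (n - 1) k) := by
  classical
  let c : V → Fin 3 := fun x => if x ∈ A then 2 else if x ∈ B then 1 else 0
  let c' : Fin n → Fin 3 := fun j => if n - k ≤ j.val then 2 else if k ≤ j.val then 1 else 0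
  have hfib : ∀ t : Fin 3, Nonempty ({a // c a = t} ≃ {b // c' b = t}) := by
    intro t
    refine ⟨Fintype.equivOfCardEq ?_⟩
    rw [Fintype.card_subtype, Fintype.card_subtype]
    fin_cases t
    · have h1 : (Finset.univ.filter (fun x => c x = 0)) = Bᶜ := by
        ext x
        have := @hAB x
        by_cases h1 : x ∈ A <;> by_cases h2 : x ∈ B <;> simp [c, h1, h2]
        exact h2 (this h1)
      have h2 : (Finset.univ.filter (fun x => c' x = 0)) =
          Finset.univ.filter (fun j : Fin n => 0 ≤ j.val ∧ j.val < k) := by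
        ext j
        simp only [Finset.mem_filter, Finset.mem_univ, true_and, c']
        split_ifs <;> simp <;> omega
      change (Finset.univ.filter (fun x => c x = 0)).card =
        (Finset.univ.filter (fun x => c' x = 0)).card
      rw [h1, h2, card_fin_interval _ _ _ (by omega), Finset.card_compl, hB, hV]
      omega
    · have h1 : (Finset.univ.filter (fun x => c x = 1)) = B \ A := by
        ext x
        by_cases h1 : x ∈ A <;> by_cases h2 : x ∈ B <;> simp [c, h1, h2]
      have h2 : (Finset.univ.filter (fun x => c' x = 1)) =
          Finset.univ.filter (fun j : Fin n => k ≤ j.val ∧ j.val < n - k) := by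
        ext j
        simp only [Finset.mem_filter, Finset.mem_univ, true_and, c']
        split_ifs <;> simp <;> omega
      change (Finset.univ.filter (fun x => c x = 1)).card =
        (Finset.univ.filter (fun x => c' x = 1)).card
      rw [h1, h2, card_fin_interval _ _ _ (by omega), Finset.card_sdiff_of_subset hAB, hB, hA]
    · have h1 : (Finset.univ.filter (fun x => c x = 2)) = A := by
        ext x
        by_cases h1 : x ∈ A <;> by_cases h2 : x ∈ B <;> simp [c, h1, h2]
      have h2 : (Finset.univ.filter (fun x => c' x = 2)) =
          Finset.univ.filter (fun j : Fin n => n - k ≤ j.val ∧ j.val < n) := by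
        ext j
        simp only [Finset.mem_filter, Finset.mem_univ, true_and, c']
        split_ifs <;> simp <;> omega
      change (Finset.univ.filter (fun x => c x = 2)).card =
        (Finset.univ.filter (fun x => c' x = 2)).card
      rw [h1, h2, card_fin_interval _ _ _ (by omega), hA]
      omega
  have ef := fun t => (hfib t).some
  have hmap : ∀ a, c' (Equiv.ofFiberEquiv ef a) = c a := fun a => Equiv.ofFiberEquiv_map ef a
  have hBm : ∀ a, a ∉ B ↔ (Equiv.ofFiberEquiv ef a).val < k := by
    intro a
    have h := hmap a
    have := @hAB a
    simp only [c, c'] at h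
    split_ifs at h <;> first | (simp at h; done) | (constructor <;> intro <;> first | omega | tauto)
  have hAm : ∀ a, a ∉ A ↔ (Equiv.ofFiberEquiv ef a).val ≤ n - 1 - k := by
    intro a
    have h := hmap a
    have := @hAB a
    simp only [c, c'] at h
    split_ifs at h <;> first | (simp at h; done) | (constructor <;> intro <;> first | omega | tauto)
  refine ⟨⟨Equiv.ofFiberEquiv ef, ?_⟩⟩
  intro a b
  rw [hadj, hBm, hBm, hAm, hAm]
  rw [F_adj, (Equiv.ofFiberEquiv ef).injective.ne_iff]

lemma main_forward {V : Type} [Fintype V] {n k : ℕ} (hk : 2 ≤ k)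
    (hn : (Odd n ∧ 6 * k - 3 ≤ n) ∨ (Even n ∧ 6 * k - 6 ≤ n))
    (hV : Fintype.card V = n) (G : SimpleGraph V) [DecidableRel G.Adj]
    (hG : ¬ HamSeq n G) (hmin : ∀ v, k ≤ G.degree v) (x0 : V) (hx0 : G.degree x0 = k)
    (hE : ∑ v, G.degree v = (n - k) * (n - k - 1) + 2 * k ^ 2) :
    Nonempty (G ≃g Fgraph n (n - 1) k) := by
  classical
  have hnk : 2 * k + 1 ≤ n := by
    rcases hn with ⟨h, h'⟩ | ⟨h, h'⟩
    · omega
    · omega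
  obtain ⟨i, hi, hAi, hBi, u, hu⟩ := chvatal hV (by omega) hG
  have hki : k ≤ i := (hmin u).trans hu
  have h3 : 3 * i + 3 * k ≤ 2 * n := by
    rcases hn with ⟨h, h'⟩ | ⟨h, h'⟩
    · omega
    · obtain ⟨m, rfl⟩ := h
      omega
  obtain ⟨A, hxA, hA, hAc⟩ := Finset.exists_subsuperset_card_eq (s := {x0})
    (t := Finset.univ.filter (fun x => G.degree x ≤ i)) (n := i)
    (by simp [hx0, hki]) (by simp; omega) hAi
  obtain ⟨B, hAB, hB, hBc⟩ := Finset.exists_subsuperset_card_eq (s := A)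
    (t := Finset.univ.filter (fun x => G.degree x ≤ n - i - 1)) (n := n - i)
    (by
      intro x hx
      have := hA hx
      simp only [Finset.mem_filter, Finset.mem_univ, true_and] at this ⊢
      omega) (by omega) hBi
  have hx0A : x0 ∈ A := by simpa using hxA
  have hdA : ∀ x ∈ A, G.degree x ≤ i := fun x hx => by simpa using hA hx
  have hdB : ∀ x ∈ B, G.degree x ≤ n - i - 1 := fun x hx => by simpa using hB hx
  have hdV : ∀ x, G.degree x ≤ n - 1 := by
    intro x
    have := G.degree_lt_card_verts x
    omega
  let c : V → ℕ := fun x => if x ∈ A then i else if x ∈ B then n - i - 1 else n - 1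
  have hdc : ∀ x, G.degree x ≤ c x := by
    intro x
    simp only [c]
    split_ifs with h1 h2
    · exact hdA x h1
    · exact hdB x h2
    · exact hdV x
  have hsumc : ∑ x, c x = i * i + (n - i - i) * (n - i - 1) + i * (n - 1) := by
    have h1 : ∑ x, c x = ∑ x ∈ A, c x + ∑ x ∈ B \ A, c x + ∑ x ∈ Bᶜ, c x := by
      rw [← Finset.sum_add_sum_compl B, ← Finset.sum_sdiff hAB]
      ring
    have h2 : ∑ x ∈ A, c x = i * i := by
      rw [Finset.sum_congr rfl (g := fun _ => i) (fun x hx => by simp [c, hx])]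
      simp [hAc]
    have h4 : ∑ x ∈ B \ A, c x = (n - i - i) * (n - i - 1) := by
      rw [Finset.sum_congr rfl (g := fun _ => n - i - 1) (fun x hx => by
        simp only [Finset.mem_sdiff] at hx
        simp [c, hx])]
      simp [Finset.card_sdiff_of_subset hAB, hAc, hBc]
    have h5 : ∑ x ∈ Bᶜ, c x = i * (n - 1) := by
      rw [Finset.sum_congr rfl (g := fun _ => n - 1) (fun x hx => by
        simp only [Finset.mem_compl] at hx
        simp [c, hx, show x ∉ A from fun h => hx (hAB h)])]
      simp [Finset.card_compl, hBc, hV]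
      left; omega
    rw [h1, h2, h4, h5]
  obtain ⟨r, hr⟩ : ∃ r, n = 2 * i + 1 + r := ⟨n - (2 * i + 1), by omega⟩
  have hsumc2 : ∑ x, c x = i * i + (r + 1) * (i + r) + i * (2 * i + r) := by
    rw [hsumc]
    congr 2
    · congr 1 <;> omega
    · omega
  have hE2 : (∑ v, G.degree v : ℤ) = ((n : ℤ) - k) * (n - k - 1) + 2 * k ^ 2 := by
    have := congrArg (Nat.cast (R := ℤ)) hE
    push_cast [Nat.cast_sub (show k ≤ n by omega),
      Nat.cast_sub (show 1 ≤ n - k by omega)] at this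
    exact this
  rcases hki.lt_or_eq with hlt | heq
  · exfalso
    obtain ⟨y0, hy0B, hy0⟩ : ∃ y ∈ Bᶜ, y ∉ G.neighborFinset x0 := by
      by_contra hc
      push Not at hc
      have h1 := Finset.card_le_card (s := Bᶜ) (t := G.neighborFinset x0) hc
      rw [Finset.card_compl, card_neighborFinset_eq_degree, hV] at h1
      omega
    have hy0B' : y0 ∉ B := by simpa using hy0B
    have hne : x0 ≠ y0 := by rintro rfl; exact hy0B' (hAB hx0A)
    have hy0d : G.degree y0 + 1 ≤ n - 1 := by
      rw [mem_neighborFinset] at hy0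
      have h1 : G.neighborFinset y0 ⊆ (Finset.univ.erase y0).erase x0 := by
        intro z hz
        rw [mem_neighborFinset] at hz
        simp only [Finset.mem_erase, Finset.mem_univ, and_true]
        exact ⟨fun h => hy0 (h ▸ hz.symm), hz.ne'⟩
      have h2 := Finset.card_le_card h1
      rw [card_neighborFinset_eq_degree, Finset.card_erase_of_mem (by simp [hne]),
        Finset.card_erase_of_mem (by simp), Finset.card_univ, hV] at h2
      omega
    have hs : ∑ x, (G.degree x + (if x = x0 then i - k else 0) + (if x = y0 then 1 else 0)) ≤
        ∑ x, c x := by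
      apply Finset.sum_le_sum
      intro x _
      by_cases h1 : x = x0
      · subst h1
        simp only [c, hx0A, if_true, if_neg hne, hx0]
        omega
      · by_cases h2 : x = y0
        · subst h2
          simp only [c, hy0B', show x ∉ A from fun h => hy0B' (hAB h), if_false, if_neg h1, if_true]
          omega
        · simpa [h1, h2] using hdc x
    simp only [Finset.sum_add_distrib, Finset.sum_ite_eq', Finset.mem_univ, if_true] at hs
    rw [hsumc2] at hs
    have hs2 : (∑ v, G.degree v : ℤ) + (i - k) + 1 ≤ i * i + (r + 1) * (i + r) + i * (2 * i + r) := by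
      have : ((∑ v, G.degree v + (i - k) + 1 : ℕ) : ℤ) ≤
        ((i * i + (r + 1) * (i + r) + i * (2 * i + r) : ℕ) : ℤ) := by exact_mod_cast hs
      push_cast [Nat.cast_sub hki] at this
      exact this
    rw [hE2] at hs2
    have hrz : (n : ℤ) = 2 * i + 1 + r := by exact_mod_cast hr
    have hp : (0 : ℤ) ≤ ((i : ℤ) - k) * (2 * n - 3 * i - 3 * k) :=
      mul_nonneg (by omega) (by omega)
    rw [hrz] at hs2 hp
    nlinarith
  · subst heq
    have hall : ∀ x ∈ Finset.univ, G.degree x = c x := by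
      rw [← Finset.sum_eq_sum_iff_of_le (fun x _ => hdc x), hsumc2]
      rw [hr] at hE2
      zify
      rw [hE2]
      push_cast
      ring
    have hall : ∀ x, G.degree x = c x := fun x => hall x (Finset.mem_univ x)
    have hD : ∀ x, x ∉ B → ∀ y, y ≠ x → G.Adj x y := by
      intro x hx y hy
      have h1 : G.degree x = n - 1 := by
        rw [hall]; simp [c, hx, show x ∉ A from fun h => hx (hAB h)]
      have h2 : G.neighborFinset x ⊆ Finset.univ.erase x := by
        intro z hz
        rw [mem_neighborFinset] at hz
        simp [hz.ne']
      have h3 := Finset.eq_of_subset_of_card_le h2 (by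
        rw [card_neighborFinset_eq_degree, h1, Finset.card_erase_of_mem (by simp),
          Finset.card_univ, hV])
      rw [← mem_neighborFinset, h3]
      simp [hy]
    have hAN : ∀ x ∈ A, G.neighborFinset x = Bᶜ := by
      intro x hx
      symm
      apply Finset.eq_of_subset_of_card_le
      · intro z hz
        rw [Finset.mem_compl] at hz
        rw [mem_neighborFinset]
        exact (hD z hz x (by rintro rfl; exact hz (hAB hx))).symm
      · rw [card_neighborFinset_eq_degree, hall, Finset.card_compl, hBc, hV]
        simp only [c, hx, if_true]
        omega
    have hCN : ∀ x ∈ B, x ∉ A → G.neighborFinset x = Aᶜ.erase x := by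
      intro x hx hxA
      apply Finset.eq_of_subset_of_card_le
      · intro z hz
        rw [mem_neighborFinset] at hz
        simp only [Finset.mem_erase, Finset.mem_compl]
        refine ⟨hz.ne', fun hzA => ?_⟩
        have h1 : x ∈ G.neighborFinset z := by rw [mem_neighborFinset]; exact hz.symm
        rw [hAN z hzA, Finset.mem_compl] at h1
        exact h1 hx
      · rw [card_neighborFinset_eq_degree, hall, Finset.card_erase_of_mem (by simpa using hxA),
          Finset.card_compl, hAc, hV]
        simp [c, hx, hxA]
    apply iso_of_structure hV hnk G A B hAB hAc hBc
    intro x y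
    by_cases hxB : x ∈ B
    · by_cases hxA : x ∈ A
      · rw [← mem_neighborFinset, hAN x hxA, Finset.mem_compl]
        constructor
        · intro h
          exact ⟨by rintro rfl; exact h hxB, Or.inr (Or.inl h)⟩
        · tauto
      · rw [← mem_neighborFinset, hCN x hxB hxA, Finset.mem_erase, Finset.mem_compl]
        have := @hAB y
        constructor
        · rintro ⟨h1, h2⟩
          exact ⟨h1.symm, Or.inr (Or.inr ⟨hxA, h2⟩)⟩
        · rintro ⟨h1, h2⟩
          exact ⟨h1.symm, by tauto⟩
    · exact ⟨fun h => ⟨h.ne, Or.inl hxB⟩, fun h => hD x hxB y h.1.symm⟩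

theorem stmt5 (n k : ℕ) (hk : 2 ≤ k)
    (hn : (Odd n ∧ 6 * k - 3 ≤ n) ∨ (Even n ∧ 6 * k - 6 ≤ n))
    (V : Type) (G : SimpleGraph V) (hV : Nat.card V = n) (hconn : TwoConnected G)
    (hham : ¬ IsHamiltonianGr G) (hdeg : MinDegreeEq G k) :
    edgeCount G = Nat.choose (n - k) 2 + k ^ 2 ↔
      Nonempty (G ≃g Fgraph n (n - 1) k) := by
  classical
  have hnk : 2 * k + 1 ≤ n := by
    rcases hn with ⟨h, h'⟩ | ⟨h, h'⟩
    · omega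
    · omega
  have : Finite V := Nat.finite_of_card_ne_zero (by omega)
  have : Fintype V := Fintype.ofFinite V
  have hV' : Fintype.card V = n := by rw [← hV, Nat.card_eq_fintype_card]
  have hch : 2 * Nat.choose (n - k) 2 = (n - k) * (n - k - 1) := by
    rw [Nat.choose_two_right]
    exact Nat.mul_div_cancel' (Nat.even_mul_pred_self (n - k)).two_dvd
  constructor
  · intro h
    obtain ⟨hmin, x0, hx0⟩ := hdeg
    refine main_forward hk hn hV' G (fun h => hham (h.isHam hV' (by omega)))
      (fun v => degN_eq G v ▸ hmin v) x0 (degN_eq G x0 ▸ hx0) ?_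
    rw [← edgeCount_eq, h]
    omega
  · rintro ⟨e⟩
    have h1 : edgeCount G = edgeCount (Fgraph n (n - 1) k) := Nat.card_congr e.mapEdgeSet
    have h2 := edgeCount_F n k hk hnk
    omega
end
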